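/- Let n ≥ 2, 1 < p < ∞ and β < 0. Let Ω ⊂ ℝⁿ be a bounded, open, convex set with P(Ω) = ρ, let Ω* be the ball centered at the origin with P(Ω*) = ρ, let v be a first eigenfunction of λ_{p,β}(Ω*), and let v_m be the minimum of v on the closure of Ω*. Then λ_{p,β}(Ω*) − λ_{p,β}(Ω) ≥ |β| · n^{n/(n−1)} ω_n^{1/(n−1)} ρ^{−1/(n−1)} · (v_m^p / ‖v‖_{L^p(Ω*)}^p) · (|Ω*| − |Ω|). -/

import Mathlib

open MeasureTheory Metric Set Bornology
open scoped NNReal ENNReal Pointwise symmDiff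

noncomputable section

/-- The perimeter of a (convex) set: the `(n-1)`-dimensional Hausdorff measure of its
topological boundary. -/
def perim (n : ℕ) (Ω : Set (EuclideanSpace ℝ (Fin n))) : ℝ :=
  (μH[(n : ℝ) - 1] (frontier Ω)).toReal

/-- The Rayleigh quotient of `u` on `Ω` with boundary parameter `β`. -/
def rayleigh (n : ℕ) (p β : ℝ) (Ω : Set (EuclideanSpace ℝ (Fin n)))
    (u : EuclideanSpace ℝ (Fin n) → ℝ) : ℝ :=
  ((∫ x in Ω, ‖fderiv ℝ u x‖ ^ p) +
      β * ∫ x in frontier Ω, |u x| ^ p ∂(μH[(n : ℝ) - 1])) /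
    ∫ x in Ω, |u x| ^ p

/-- The first Robin eigenvalue of the `p`-Laplacian on `Ω` with boundary parameter `β`. -/
def robinEig (n : ℕ) (p β : ℝ) (Ω : Set (EuclideanSpace ℝ (Fin n))) : ℝ :=
  sInf { r : ℝ | ∃ u : EuclideanSpace ℝ (Fin n) → ℝ,
    (∃ K : ℝ≥0, LipschitzOnWith K u (closure Ω)) ∧
    (0 < ∫ x in Ω, |u x| ^ p) ∧ r = rayleigh n p β Ω u }

/-- `v` is a first eigenfunction for the Robin `p`-Laplacian on `Ω`: a positive radial
Lipschitz function on the closure of `Ω` whose Rayleigh quotient equals `λ_{p,β}(Ω)`. -/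
def IsFirstEigenfunction (n : ℕ) (p β : ℝ) (Ω : Set (EuclideanSpace ℝ (Fin n)))
    (v : EuclideanSpace ℝ (Fin n) → ℝ) : Prop :=
  (∃ K : ℝ≥0, LipschitzOnWith K v (closure Ω)) ∧
  (∀ x ∈ closure Ω, 0 < v x) ∧
  (∃ h : ℝ → ℝ, ∀ x ∈ closure Ω, v x = h ‖x‖) ∧
  (0 < ∫ x in Ω, |v x| ^ p) ∧
  rayleigh n p β Ω v = robinEig n p β Ω

/-- `ω_n`, the Lebesgue measure of the unit ball of `ℝⁿ`. -/
def unitBallVol (n : ℕ) : ℝ :=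
  (volume (ball (0 : EuclideanSpace ℝ (Fin n)) 1)).toReal

theorem volume_add_ge_of_isCompact {A B : Set ℝ} (hA : IsCompact A) (hB : IsCompact B)
    (hA0 : A.Nonempty) (hB0 : B.Nonempty) : volume A + volume B ≤ volume (A + B) := by
  have ha := hA.sSup_mem hA0
  have hb := hB.sInf_mem hB0
  set a := sSup A
  set b := sInf B
  have h1 : volume A = volume ((fun x => x + b) '' A) := by
    simp [image_add_right]
  have h2 : volume B = volume ((fun x => a + x) '' B) := by
    simp [image_add_left]
  have hd : volume (((fun x => x + b) '' A) ∩ ((fun x => a + x) '' B)) = 0 := by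
    refine measure_mono_null (t := {a + b}) ?_ (by simp)
    rintro _ ⟨⟨x, hx, rfl⟩, ⟨y, hy, hxy⟩⟩
    have h3 : x ≤ a := le_csSup hA.bddAbove hx
    have h4 : b ≤ y := csInf_le hB.bddBelow hy
    simp only [mem_singleton_iff] at *
    linarith
  have hmeas : MeasurableSet ((fun x => a + x) '' B) :=
    (hB.image (by fun_prop)).measurableSet
  have := measure_union_add_inter (μ := volume) ((fun x => x + b) '' A) hmeas
  rw [hd, add_zero, ← h1, ← h2] at this
  rw [← this]
  apply measure_mono
  rintro _ (⟨x, hx, rfl⟩ | ⟨x, hx, rfl⟩)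
  · exact add_mem_add hx hb
  · exact add_mem_add ha hx

theorem volume_add_ge {A B C : Set ℝ} (hA : MeasurableSet A) (hB : MeasurableSet B)
    (hA0 : A.Nonempty) (hB0 : B.Nonempty) (hC : ∀ x ∈ A, ∀ y ∈ B, x + y ∈ C) :
    volume A + volume B ≤ volume C := by
  rw [hA.measure_eq_iSup_isCompact, hB.measure_eq_iSup_isCompact]
  obtain ⟨a, ha⟩ := hA0
  obtain ⟨b, hb⟩ := hB0
  have key : ∀ K, K ⊆ A → IsCompact K → ∀ L, L ⊆ B → IsCompact L →
      volume K + volume L ≤ volume C := by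
    intro K hK hKc L hL hLc
    have h := volume_add_ge_of_isCompact (hKc.insert a) (hLc.insert b) (by simp) (by simp)
    have h1 : volume K ≤ volume (insert a K) := measure_mono (by simp)
    have h2 : volume L ≤ volume (insert b L) := measure_mono (by simp)
    refine (add_le_add h1 h2).trans (h.trans (measure_mono ?_))
    rintro _ ⟨x, hx, y, hy, rfl⟩
    refine hC x ?_ y ?_
    · rcases hx with rfl | hx; exacts [ha, hK hx]
    · rcases hy with rfl | hy; exacts [hb, hL hy]
  simp only [iSup_and']
  exact ENNReal.biSup_add_biSup_le' ⟨∅, empty_subset _, isCompact_empty⟩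
    ⟨∅, empty_subset _, isCompact_empty⟩ fun K hK L hL => key K hK.1 hK.2 L hL.1 hL.2

theorem lintegral_superlevel {f g h : ℝ → ℝ} {l : ℝ} (hl0 : 0 < l) (hl1 : l < 1)
    (hf : Measurable f) (hg : Measurable g) (hh : Measurable h)
    (hf0 : ∀ x, 0 ≤ f x) (hg0 : ∀ x, 0 ≤ g x) (hh0 : ∀ x, 0 ≤ h x)
    (hf1 : ∀ x, f x ≤ 1) (hg1 : ∀ x, g x ≤ 1)
    (hfs : ∀ t < 1, ∃ x, t < f x) (hgs : ∀ t < 1, ∃ x, t < g x)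
    (H : ∀ t, 0 < t → ∀ x y, t < f x → t < g y → t < h ((1 - l) * x + l * y)) :
    ENNReal.ofReal (1 - l) * (∫⁻ x, ENNReal.ofReal (f x)) +
      ENNReal.ofReal l * (∫⁻ x, ENNReal.ofReal (g x)) ≤ ∫⁻ x, ENNReal.ofReal (h x) := by
  have mf : Measurable fun t => volume {a | t < f a} :=
    Antitone.measurable fun s t hst => measure_mono fun x (hx : t < f x) => lt_of_le_of_lt hst hx
  have mg : Measurable fun t => volume {a | t < g a} :=
    Antitone.measurable fun s t hst => measure_mono fun x (hx : t < g x) => lt_of_le_of_lt hst hx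
  rw [lintegral_eq_lintegral_meas_lt _ (.of_forall hf0) hf.aemeasurable,
    lintegral_eq_lintegral_meas_lt _ (.of_forall hg0) hg.aemeasurable,
    lintegral_eq_lintegral_meas_lt _ (.of_forall hh0) hh.aemeasurable,
    ← lintegral_const_mul _ mf, ← lintegral_const_mul _ mg, ← lintegral_add_left (by fun_prop)]
  refine setLIntegral_mono' measurableSet_Ioi fun t ht => ?_
  rcases lt_or_ge t 1 with h1 | h1
  · have e1 : ENNReal.ofReal (1 - l) * volume {a | t < f a} =
        volume ((1 - l) • {a | t < f a}) := by
      rw [Measure.addHaar_smul]; simp [abs_of_pos (sub_pos.2 hl1)]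
    have e2 : ENNReal.ofReal l * volume {a | t < g a} = volume (l • {a | t < g a}) := by
      rw [Measure.addHaar_smul]; simp [abs_of_pos hl0]
    rw [e1, e2]
    refine volume_add_ge ((measurableSet_lt measurable_const hf).const_smul₀ _)
      ((measurableSet_lt measurable_const hg).const_smul₀ _) ?_ ?_ ?_
    · exact Set.Nonempty.smul_set (hfs t h1)
    · exact Set.Nonempty.smul_set (hgs t h1)
    · rintro _ ⟨x, hx, rfl⟩ _ ⟨y, hy, rfl⟩
      exact H t ht x y hx hy
  · have : {a | t < f a} = ∅ := by ext x; simp; linarith [hf1 x]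
    have h2 : {a | t < g a} = ∅ := by ext x; simp; linarith [hg1 x]
    simp [this, h2]

/-- Bounded nonnegative measurable functions with bounded support. -/
def TameFun {X : Type*} [NormedAddCommGroup X] [MeasurableSpace X] (f : X → ℝ) : Prop :=
  Measurable f ∧ (∀ x, 0 ≤ f x) ∧ ∃ C, (∀ x, f x ≤ C) ∧ ∀ x, f x ≠ 0 → ‖x‖ ≤ C

theorem TameFun.integrable {X : Type*} [NormedAddCommGroup X] [MeasurableSpace X] [ProperSpace X]
    [BorelSpace X] {μ : Measure X} [IsFiniteMeasureOnCompacts μ] {f : X → ℝ} (hf : TameFun f) :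
    Integrable f μ := by
  obtain ⟨hm, h0, C, hC, hs⟩ := hf
  have : IntegrableOn f (closedBall 0 C) μ :=
    Measure.integrableOn_of_bounded (M := C) (isCompact_closedBall _ _).measure_lt_top.ne
      hm.aestronglyMeasurable
      (.of_forall fun x => by rw [Real.norm_of_nonneg (h0 x)]; exact hC x)
  rwa [integrableOn_iff_integrable_of_support_subset] at this
  intro x hx
  simpa using hs x hx

theorem TameFun.ofReal_integral {X : Type*} [NormedAddCommGroup X] [MeasurableSpace X]
    [ProperSpace X] [BorelSpace X] {μ : Measure X} [IsFiniteMeasureOnCompacts μ] {f : X → ℝ}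
    (hf : TameFun f) : ENNReal.ofReal (∫ x, f x ∂μ) = ∫⁻ x, ENNReal.ofReal (f x) ∂μ :=
  ofReal_integral_eq_lintegral_ofReal hf.integrable (.of_forall hf.2.1)

theorem TameFun.div_const {X : Type*} [NormedAddCommGroup X] [MeasurableSpace X] {f : X → ℝ}
    (hf : TameFun f) {c : ℝ} (hc : 0 ≤ c) : TameFun fun x => f x / c := by
  obtain ⟨hm, h0, C, hC, hs⟩ := hf
  refine ⟨hm.div_const c, fun x => div_nonneg (h0 x) hc, max (C / c) C,
    fun x => le_max_of_le_left (div_le_div_of_nonneg_right (hC x) hc), fun x hx => le_max_of_le_right (hs x ?_)⟩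
  intro h; simp [h] at hx

/-- The Prékopa–Leindler inequality on the line. -/
theorem prekopa_leindler_real {f g h : ℝ → ℝ} {l : ℝ} (hl0 : 0 < l) (hl1 : l < 1)
    (hf : TameFun f) (hg : TameFun g) (hh : TameFun h)
    (H : ∀ x y, f x ^ (1 - l) * g y ^ l ≤ h ((1 - l) * x + l * y)) :
    (∫ x, f x) ^ (1 - l) * (∫ x, g x) ^ l ≤ ∫ x, h x := by
  have hl1' : 0 < 1 - l := by linarith
  have hI : 0 ≤ ∫ x, h x := integral_nonneg hh.2.1
  by_cases hf0 : ∀ x, f x = 0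
  · simp [hf0, Real.zero_rpow hl1'.ne', hI]
  by_cases hg0 : ∀ x, g x = 0
  · simp [hg0, Real.zero_rpow hl0.ne', hI]
  push Not at hf0 hg0
  have bf : BddAbove (range f) := by
    obtain ⟨C, hC, -⟩ := hf.2.2; exact ⟨C, by rintro _ ⟨x, rfl⟩; exact hC x⟩
  have bg : BddAbove (range g) := by
    obtain ⟨C, hC, -⟩ := hg.2.2; exact ⟨C, by rintro _ ⟨x, rfl⟩; exact hC x⟩
  have ha : 0 < ⨆ x, f x := by
    obtain ⟨x, hx⟩ := hf0
    exact (lt_of_le_of_ne (hf.2.1 x) hx.symm).trans_le (le_ciSup bf x)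
  have hb : 0 < ⨆ x, g x := by
    obtain ⟨x, hx⟩ := hg0
    exact (lt_of_le_of_ne (hg.2.1 x) hx.symm).trans_le (le_ciSup bg x)
  set a := ⨆ x, f x
  set b := ⨆ x, g x
  set c := a ^ (1 - l) * b ^ l
  have hc : 0 < c := by positivity
  have key := lintegral_superlevel (f := fun x => f x / a) (g := fun x => g x / b)
    (h := fun x => h x / c) hl0 hl1 (hf.div_const ha.le).1 (hg.div_const hb.le).1
    (hh.div_const hc.le).1 (hf.div_const ha.le).2.1 (hg.div_const hb.le).2.1
    (hh.div_const hc.le).2.1 (fun x => div_le_one_of_le₀ (le_ciSup bf x) ha.le)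
    (fun x => div_le_one_of_le₀ (le_ciSup bg x) hb.le)
    (fun t ht => by
      obtain ⟨x, hx⟩ := exists_lt_of_lt_ciSup (show t * a < ⨆ x, f x from by
        change t * a < a; nlinarith)
      exact ⟨x, by rwa [lt_div_iff₀ ha]⟩)
    (fun t ht => by
      obtain ⟨x, hx⟩ := exists_lt_of_lt_ciSup (show t * b < ⨆ x, g x from by
        change t * b < b; nlinarith)
      exact ⟨x, by rwa [lt_div_iff₀ hb]⟩)
    (fun t ht x y hx hy => by
      rw [lt_div_iff₀ ha] at hx
      rw [lt_div_iff₀ hb] at hy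
      rw [lt_div_iff₀ hc]
      refine lt_of_lt_of_le ?_ (H x y)
      have e : t * c = (t * a) ^ (1 - l) * (t * b) ^ l := by
        rw [Real.mul_rpow ht.le ha.le, Real.mul_rpow ht.le hb.le, mul_mul_mul_comm,
          ← Real.rpow_add ht]
        simp [c]
      rw [e]
      exact mul_lt_mul'' (Real.rpow_lt_rpow (by positivity) hx hl1')
        (Real.rpow_lt_rpow (by positivity) hy hl0) (by positivity) (by positivity))
  rw [← (hf.div_const ha.le).ofReal_integral, ← (hg.div_const hb.le).ofReal_integral,
    ← (hh.div_const hc.le).ofReal_integral, ← ENNReal.ofReal_mul hl1'.le,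
    ← ENNReal.ofReal_mul hl0.le, ← ENNReal.ofReal_add
      (mul_nonneg hl1'.le (integral_nonneg (hf.div_const ha.le).2.1))
      (mul_nonneg hl0.le (integral_nonneg (hg.div_const hb.le).2.1)),
    ENNReal.ofReal_le_ofReal_iff (integral_nonneg (hh.div_const hc.le).2.1)] at key
  simp only [integral_div] at key
  have hF : 0 ≤ ∫ x, f x := integral_nonneg hf.2.1
  have hG : 0 ≤ ∫ x, g x := integral_nonneg hg.2.1
  have := Real.geom_mean_le_arith_mean2_weighted hl1'.le hl0.le (div_nonneg hF ha.le)
    (div_nonneg hG hb.le) (by ring)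
  have h2 := this.trans key
  rw [Real.div_rpow hF ha.le, Real.div_rpow hG hb.le, div_mul_div_comm,
    div_le_div_iff_of_pos_right hc] at h2
  exact h2

theorem TameFun.section_integral {n : ℕ} {f : (Fin (n + 1) → ℝ) → ℝ} (hf : TameFun f) :
    (∀ t, TameFun fun y : Fin n → ℝ => f (Fin.cons t y)) ∧
    TameFun (fun t : ℝ => ∫ y : Fin n → ℝ, f (Fin.cons t y)) ∧
    ∫ x, f x = ∫ t : ℝ, ∫ y : Fin n → ℝ, f (Fin.cons t y) := by
  obtain ⟨hm, h0, C, hC, hs⟩ := id hf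
  have mcons : Measurable fun q : ℝ × (Fin n → ℝ) => (Fin.cons q.1 q.2 : Fin (n + 1) → ℝ) := by
    refine measurable_pi_lambda _ fun i => ?_
    refine Fin.cases ?_ (fun j => ?_) i
    · simpa using measurable_fst
    · exact (measurable_pi_apply j).comp measurable_snd
  have n1 : ∀ t (y : Fin n → ℝ), |t| ≤ ‖(Fin.cons t y : Fin (n + 1) → ℝ)‖ := fun t y => by
    simpa using norm_le_pi_norm (Fin.cons t y : Fin (n + 1) → ℝ) 0
  have n2 : ∀ t (y : Fin n → ℝ), ‖y‖ ≤ ‖(Fin.cons t y : Fin (n + 1) → ℝ)‖ := fun t y => by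
    refine (pi_norm_le_iff_of_nonneg (norm_nonneg _)).2 fun i => ?_
    simpa using norm_le_pi_norm (Fin.cons t y : Fin (n + 1) → ℝ) i.succ
  have hsec : ∀ t, TameFun fun y : Fin n → ℝ => f (Fin.cons t y) := fun t =>
    ⟨hm.comp (mcons.comp measurable_prodMk_left), fun y => h0 _, C, fun y => hC _,
      fun y hy => (n2 t y).trans (hs _ hy)⟩
  refine ⟨hsec, ⟨?_, fun t => integral_nonneg fun y => h0 _, ?_⟩, ?_⟩
  · exact ((hm.comp mcons).stronglyMeasurable.integral_prod_right').measurable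
  · refine ⟨max C (C * volume.real (closedBall (0 : Fin n → ℝ) C)), fun t => ?_, fun t ht => ?_⟩
    · refine le_max_of_le_right ?_
      beta_reduce
      have e : ∫ y : Fin n → ℝ, f (Fin.cons t y) =
          ∫ y in closedBall (0 : Fin n → ℝ) C, f (Fin.cons t y) := by
        symm
        refine setIntegral_eq_integral_of_forall_compl_eq_zero fun y hy => ?_
        by_contra h
        exact hy (by simpa using (n2 t y).trans (hs _ h))
      rw [e]
      have := norm_setIntegral_le_of_norm_le_const (μ := volume)
        (f := fun y : Fin n → ℝ => f (Fin.cons t y)) (s := closedBall 0 C) (C := C)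
        (isCompact_closedBall _ _).measure_lt_top
        (fun y _ => by rw [Real.norm_of_nonneg (h0 _)]; exact hC _)
      exact (le_abs_self _).trans this
    · refine le_max_of_le_left ?_
      by_contra h
      refine ht ?_
      have : ∀ y : Fin n → ℝ, f (Fin.cons t y) = 0 := fun y => by
        by_contra h'
        exact h ((n1 t y).trans (hs _ h'))
      simp [this]
  · have mp := (volume_preserving_piFinSuccAbove (fun _ : Fin (n + 1) => ℝ) 0).symm
    rw [← mp.integral_comp']
    have e : ∀ q, (MeasurableEquiv.piFinSuccAbove (fun _ : Fin (n + 1) => ℝ) 0).symm q =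
        Fin.cons q.1 q.2 := fun q => Fin.insertNth_zero' q.1 q.2
    have hi : Integrable (f ∘ (MeasurableEquiv.piFinSuccAbove (fun _ : Fin (n + 1) => ℝ) 0).symm)
        (volume.prod volume) :=
      (mp.integrable_comp_emb (MeasurableEquiv.measurableEmbedding _)).2
        (hf.integrable (μ := volume))
    simp only [Function.comp_def, e] at hi ⊢
    exact integral_prod _ hi

/-- The Prékopa–Leindler inequality. -/
theorem prekopa_leindler {n : ℕ} {f g h : (Fin n → ℝ) → ℝ} {l : ℝ} (hl0 : 0 < l) (hl1 : l < 1)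
    (hf : TameFun f) (hg : TameFun g) (hh : TameFun h)
    (H : ∀ x y, f x ^ (1 - l) * g y ^ l ≤ h ((1 - l) • x + l • y)) :
    (∫ x, f x) ^ (1 - l) * (∫ x, g x) ^ l ≤ ∫ x, h x := by
  induction n with
  | zero =>
    have := H default default
    have e : ∀ k : (Fin 0 → ℝ) → ℝ, ∫ x, k x = k default := fun k => by
      rw [Measure.volume_pi_eq_dirac (default : Fin 0 → ℝ), integral_dirac]
    rw [e, e, e]
    exact this.trans_eq (congrArg h (Subsingleton.elim _ _))
  | succ n ih =>
    obtain ⟨f1, f2, f3⟩ := hf.section_integral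
    obtain ⟨g1, g2, g3⟩ := hg.section_integral
    obtain ⟨h1, h2, h3⟩ := hh.section_integral
    rw [f3, g3, h3]
    refine prekopa_leindler_real hl0 hl1 f2 g2 h2 fun s t => ?_
    refine ih (f1 s) (g1 t) (h1 _) fun x y => ?_
    refine (H _ _).trans (le_of_eq ?_)
    congr 1
    ext i
    refine Fin.cases ?_ (fun j => ?_) i <;> simp

theorem tameFun_indicator {X : Type*} [NormedAddCommGroup X] [MeasurableSpace X] [BorelSpace X]
    {A : Set X} (hA : IsCompact A) : TameFun (A.indicator fun _ => (1 : ℝ)) := by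
  obtain ⟨C, hC⟩ := hA.isBounded.exists_norm_le
  refine ⟨measurable_const.indicator hA.measurableSet,
    fun x => indicator_nonneg (fun _ _ => zero_le_one) x, max C 1, fun x => ?_, fun x hx => ?_⟩
  · exact le_max_of_le_right (indicator_le_self' (fun _ _ => zero_le_one) x)
  · exact le_max_of_le_left (hC x (mem_of_indicator_ne_zero hx))

theorem brunn_minkowski_pi {n : ℕ} {A B : Set (Fin n → ℝ)} (hA : IsCompact A) (hB : IsCompact B)
    {l : ℝ} (hl0 : 0 < l) (hl1 : l < 1) :
    volume.real A ^ (1 - l) * volume.real B ^ l ≤ volume.real ((1 - l) • A + l • B) := by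
  have hC : IsCompact ((1 - l) • A + l • B) := (hA.smul _).add (hB.smul _)
  have := prekopa_leindler hl0 hl1 (tameFun_indicator hA) (tameFun_indicator hB)
    (tameFun_indicator hC) fun x y => ?_
  · simpa [integral_indicator, hA.measurableSet, hB.measurableSet, hC.measurableSet] using this
  · by_cases hx : x ∈ A
    · by_cases hy : y ∈ B
      · have : (1 - l) • x + l • y ∈ (1 - l) • A + l • B :=
          add_mem_add (smul_mem_smul_set hx) (smul_mem_smul_set hy)
        simp [hx, hy, this]
      · simp only [hy, not_false_eq_true, indicator_of_notMem, Real.zero_rpow hl0.ne', mul_zero]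
        exact indicator_nonneg (fun _ _ => zero_le_one) _
    · simp only [hx, not_false_eq_true, indicator_of_notMem,
        Real.zero_rpow (sub_pos.2 hl1).ne', zero_mul]
      exact indicator_nonneg (fun _ _ => zero_le_one) _

section
variable {E : Type*} [NormedAddCommGroup E] [InnerProductSpace ℝ E] [FiniteDimensional ℝ E]
  [MeasurableSpace E] [BorelSpace E]

theorem brunn_minkowski_mul {A B : Set E} (hA : IsCompact A) (hB : IsCompact B)
    {l : ℝ} (hl0 : 0 < l) (hl1 : l < 1) :
    volume.real A ^ (1 - l) * volume.real B ^ l ≤ volume.real ((1 - l) • A + l • B) := by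
  let L := (stdOrthonormalBasis ℝ E).measurableEquiv.trans
    (MeasurableEquiv.toLp 2 (Fin (Module.finrank ℝ E) → ℝ)).symm
  have hmp : MeasurePreserving L volume volume :=
    (stdOrthonormalBasis ℝ E).measurePreserving_measurableEquiv.trans
      (EuclideanSpace.volume_preserving_symm_measurableEquiv_toLp (Fin (Module.finrank ℝ E)))
  let L' : E ≃L[ℝ] (Fin (Module.finrank ℝ E) → ℝ) :=
    (stdOrthonormalBasis ℝ E).repr.toContinuousLinearEquiv.trans
      (EuclideanSpace.equiv (Fin (Module.finrank ℝ E)) ℝ)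
  have hv : ∀ s : Set E, volume.real (L' '' s) = volume.real s := fun s => by
    have h1 : L' '' s = L '' s := rfl
    rw [h1, measureReal_def, measureReal_def, ← hmp.measure_preimage_equiv,
      preimage_image_eq _ L.injective]
  have := brunn_minkowski_pi (hA.image L'.continuous) (hB.image L'.continuous) hl0 hl1
  rw [hv, hv, ← image_smul_set, ← image_smul_set, ← image_add, hv] at this
  exact this

/-- The Brunn–Minkowski inequality. -/
theorem brunn_minkowski {A B : Set E} (hA : IsCompact A) (hB : IsCompact B)
    (hA0 : A.Nonempty) (hB0 : B.Nonempty) {a b : ℝ} (ha : 0 ≤ a) (hb : 0 ≤ b)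
    (haA : a ^ Module.finrank ℝ E ≤ volume.real A) (hbB : b ^ Module.finrank ℝ E ≤ volume.real B) :
    (a + b) ^ Module.finrank ℝ E ≤ volume.real (A + B) := by
  set n := Module.finrank ℝ E
  have hf : volume (A + B) ≠ ∞ := (hA.add hB).measure_lt_top.ne
  rcases ha.eq_or_lt with rfl | ha
  · obtain ⟨x, hx⟩ := hA0
    rw [zero_add]
    refine hbB.trans ?_
    have : volume.real B = volume.real ({x} + B) := by simp [measureReal_def]
    rw [this]
    exact measureReal_mono (add_subset_add_right (by simpa using hx)) hf
  rcases hb.eq_or_lt with rfl | hb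
  · obtain ⟨x, hx⟩ := hB0
    rw [add_zero]
    refine haA.trans ?_
    have : volume.real A = volume.real (A + {x}) := by simp [measureReal_def]
    rw [this]
    exact measureReal_mono (add_subset_add_left (by simpa using hx)) hf
  set l := b / (a + b) with hl
  have hab : 0 < a + b := by positivity
  have hl0 : 0 < l := by positivity
  have hl1' : 1 - l = a / (a + b) := by rw [hl]; field_simp; ring
  have hl1 : l < 1 := by
    have : 0 < 1 - l := by rw [hl1']; positivity
    linarith
  have hl2 : 0 < 1 - l := sub_pos.2 hl1
  have h := brunn_minkowski_mul (hA.smul (1 - l)⁻¹) (hB.smul l⁻¹) hl0 hl1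
  rw [smul_inv_smul₀ hl2.ne', smul_inv_smul₀ hl0.ne'] at h
  refine le_trans ?_ h
  have h1 : (a + b) ^ n ≤ volume.real ((1 - l)⁻¹ • A) := by
    rw [measureReal_def, Measure.addHaar_smul, ENNReal.toReal_mul,
      ENNReal.toReal_ofReal (abs_nonneg _), abs_of_pos (by positivity)]
    calc (a + b) ^ n = ((1 - l)⁻¹) ^ n * a ^ n := by
          rw [hl1', ← mul_pow]; congr 1; field_simp
      _ ≤ _ := by gcongr; exact haA
  have h2 : (a + b) ^ n ≤ volume.real (l⁻¹ • B) := by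
    rw [measureReal_def, Measure.addHaar_smul, ENNReal.toReal_mul,
      ENNReal.toReal_ofReal (abs_nonneg _), abs_of_pos (by positivity)]
    calc (a + b) ^ n = (l⁻¹) ^ n * b ^ n := by
          rw [hl, ← mul_pow]; congr 1; field_simp
      _ ≤ _ := by gcongr; exact hbB
  calc (a + b) ^ n = ((a + b) ^ n) ^ (1 - l) * ((a + b) ^ n) ^ l := by
        rw [← Real.rpow_add (by positivity)]; simp
    _ ≤ _ := by gcongr
end

/-- A monotone additive function on the nonnegative reals is linear. -/
theorem linear_of_monotone_additive {g : ℝ≥0 → ℝ} (hm : Monotone g)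
    (ha : ∀ s t, g (s + t) = g s + g t) (t : ℝ≥0) : g t = t * g 1 := by
  have hn : ∀ (n : ℕ) (s : ℝ≥0), g (n * s) = n * g s := fun n s => by
    induction n with
    | zero => have := ha 0 0; simp at this ⊢; exact this
    | succ n ih => push_cast; rw [add_mul, ha, ih, one_mul]; ring
  have h1 : 0 ≤ g 1 := by
    have := hn 0 1
    simp at this
    rw [← this]; exact hm zero_le_one
  have key : ∀ n : ℕ, n * |g t - t * g 1| ≤ g 1 := fun n => by
    have a1 : ((⌊(n : ℝ≥0) * t⌋₊ : ℝ≥0)) ≤ n * t := Nat.floor_le (zero_le)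
    have a2 : (n : ℝ≥0) * t ≤ ((⌊(n : ℝ≥0) * t⌋₊ + 1 : ℕ) : ℝ≥0) := by
      push_cast; exact (Nat.lt_floor_add_one _).le
    have b1 := hm a1
    have b2 := hm a2
    rw [hn] at b1 b2
    rw [← mul_one ((⌊(n : ℝ≥0) * t⌋₊ : ℝ≥0)), hn] at b1
    rw [← mul_one (((⌊(n : ℝ≥0) * t⌋₊ + 1 : ℕ) : ℝ≥0)), hn] at b2
    have c1 : ((⌊(n : ℝ≥0) * t⌋₊ : ℕ) : ℝ) ≤ n * t := by exact_mod_cast a1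
    have c2 : (n : ℝ) * t ≤ (⌊(n : ℝ≥0) * t⌋₊ : ℕ) + 1 := by exact_mod_cast a2
    push_cast at b2
    have : (n : ℝ) * |g t - t * g 1| = |n * (g t - t * g 1)| := by
      rw [abs_mul, Nat.abs_cast]
    rw [this, abs_le]
    constructor <;> nlinarith
  by_contra hne
  have hp : 0 < |g t - t * g 1| := abs_pos.2 (sub_ne_zero.2 hne)
  obtain ⟨n, hn'⟩ := exists_nat_gt (g 1 / |g t - t * g 1|)
  rw [div_lt_iff₀ hp] at hn'
  exact absurd (key n) (not_le.2 hn')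

section
variable {E : Type*} [NormedAddCommGroup E] [InnerProductSpace ℝ E]

/-- The segment from the origin to `v`, as a convex body. -/
def segBody (v : E) : ConvexBody E where
  carrier := segment ℝ 0 v
  convex' := convex_segment 0 v
  isCompact' := by
    rw [segment_eq_image]
    exact isCompact_Icc.image (by fun_prop)
  nonempty' := ⟨0, left_mem_segment ℝ 0 v⟩

theorem mem_segBody {v x : E} : x ∈ (segBody v : Set E) ↔ ∃ r : ℝ, 0 ≤ r ∧ r ≤ 1 ∧ r • v = x := by
  change x ∈ segment ℝ 0 v ↔ _
  rw [segment_eq_image]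
  simp [and_assoc]

theorem mem_add_smul_segBody {M : ConvexBody E} {v x : E} {t : ℝ≥0} :
    x ∈ ((M + t • segBody v : ConvexBody E) : Set E) ↔
      ∃ m ∈ (M : Set E), ∃ r : ℝ, 0 ≤ r ∧ r ≤ t ∧ m + r • v = x := by
  rw [ConvexBody.coe_add, ConvexBody.coe_smul', Set.mem_add]
  constructor
  · rintro ⟨m, hm, _, ⟨y, hy, rfl⟩, rfl⟩
    obtain ⟨r, h0, h1, rfl⟩ := mem_segBody.1 hy
    refine ⟨m, hm, t * r, by positivity, ?_, ?_⟩
    · nlinarith [t.coe_nonneg]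
    · simp [mul_smul]
  · rintro ⟨m, hm, r, h0, h1, rfl⟩
    refine ⟨m, hm, r • v, ?_, rfl⟩
    rcases eq_or_ne t 0 with rfl | ht
    · refine ⟨0, mem_segBody.2 ⟨0, by simp⟩, ?_⟩
      have : r = 0 := le_antisymm (by simpa using h1) h0
      simp [this]
    · have ht' : (0 : ℝ) < t := by positivity
      refine ⟨(r / t) • v, mem_segBody.2 ⟨r / t, by positivity, by rw [div_le_one ht']; exact h1, rfl⟩, ?_⟩
      change (t : ℝ) • (r / t) • v = _
      rw [smul_smul, mul_div_cancel₀ _ ht'.ne']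

theorem ConvexBody.add_mono {K K' L L' : ConvexBody E} (h : K ≤ K') (h' : L ≤ L') :
    K + L ≤ K' + L' := by
  rw [← SetLike.coe_subset_coe, ConvexBody.coe_add, ConvexBody.coe_add]
  exact add_subset_add h h'

theorem ConvexBody.le_add_of_zero_mem {K L : ConvexBody E} (h : (0 : E) ∈ (L : Set E)) :
    K ≤ K + L := by
  rw [← SetLike.coe_subset_coe, ConvexBody.coe_add]
  exact fun x hx => ⟨x, hx, 0, h, by simp⟩

/-- The increment of a function on convex bodies in the direction `s`. -/
def incr (s : ConvexBody E) (G : ConvexBody E → ℝ) : ConvexBody E → ℝ :=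
  fun M => G (M + s) - G M

/-- Monotone functions on convex bodies that are affine along segments. -/
structure SegAffine (G : ConvexBody E → ℝ) : Prop where
  mono : Monotone G
  affine : ∀ (v : E) (M : ConvexBody E) (t : ℝ≥0),
    G (M + t • segBody v) = G M + t * incr (segBody v) G M

theorem SegAffine.incr {G : ConvexBody E → ℝ} (hG : SegAffine G) (v : E) :
    SegAffine (incr (segBody v) G) where
  mono M M' h := by
    by_contra! hlt
    set d := _root_.incr (segBody v) G M
    set d' := _root_.incr (segBody v) G M'
    have key : ∀ n : ℕ, n * (d - d') ≤ G M' - G M := fun n => by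
      have := hG.mono (ConvexBody.add_mono h (le_refl ((n : ℝ≥0) • segBody v)))
      rw [hG.affine, hG.affine] at this
      push_cast at this
      linarith
    obtain ⟨n, hn⟩ := exists_nat_gt ((G M' - G M) / (d - d'))
    rw [div_lt_iff₀ (by linarith)] at hn
    exact absurd (key n) (not_le.2 hn)
  affine w M t := by
    have h1 : M + t • segBody w + segBody v = M + segBody v + t • segBody w := add_right_comm _ _ _
    have h2 : M + segBody w + segBody v = M + segBody v + segBody w := add_right_comm _ _ _
    simp only [_root_.incr]
    rw [h1, h2, hG.affine, hG.affine]
    simp only [_root_.incr]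
    ring

theorem SegAffine.incr_nonneg {G : ConvexBody E → ℝ} (hG : SegAffine G) (v : E)
    (M : ConvexBody E) : 0 ≤ _root_.incr (segBody v) G M :=
  sub_nonneg.2 (hG.mono (ConvexBody.le_add_of_zero_mem (left_mem_segment ℝ 0 v)))

variable [MeasurableSpace E] [BorelSpace E] [FiniteDimensional ℝ E]

/-- The volume of a convex body. -/
def bodyVol (M : ConvexBody E) : ℝ := volume.real (M : Set E)

theorem bodyVol_mono : Monotone (bodyVol : ConvexBody E → ℝ) := fun M M' h =>
  measureReal_mono h M'.isCompact.measure_lt_top.ne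

theorem diff_add_smul_segBody (M : ConvexBody E) (v : E) (s t : ℝ≥0) :
    ((M + (t + s) • segBody v : ConvexBody E) : Set E) \ (M + t • segBody v : ConvexBody E) =
      (fun x => (t : ℝ) • v + x) '' (((M + s • segBody v : ConvexBody E) : Set E) \ M) := by
  ext x
  constructor
  · rintro ⟨hx, hx'⟩
    obtain ⟨m, hm, r, h0, h1, rfl⟩ := mem_add_smul_segBody.1 hx
    have hr : (t : ℝ) ≤ r := by
      by_contra! h
      exact hx' (mem_add_smul_segBody.2 ⟨m, hm, r, h0, h.le, rfl⟩)
    refine ⟨m + (r - t) • v, ⟨mem_add_smul_segBody.2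
      ⟨m, hm, r - t, by linarith, by push_cast at h1; linarith, rfl⟩, fun h => hx' ?_⟩, ?_⟩
    · refine mem_add_smul_segBody.2 ⟨_, h, t, t.coe_nonneg, le_rfl, ?_⟩
      rw [sub_smul]; abel
    · simp only [sub_smul]; abel
  · rintro ⟨w, ⟨hw, hw'⟩, rfl⟩
    obtain ⟨m, hm, r, h0, h1, rfl⟩ := mem_add_smul_segBody.1 hw
    refine ⟨mem_add_smul_segBody.2 ⟨m, hm, t + r, by positivity, by push_cast; linarith, ?_⟩,
      fun h => hw' ?_⟩
    · simp only [add_smul]; abel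
    · obtain ⟨m', hm', r', h0', h1', he⟩ := mem_add_smul_segBody.1 h
      beta_reduce at he
      have e : m' = m + (r + (t - r')) • v := by
        have : m' = (t : ℝ) • v + (m + r • v) - r' • v := by rw [← he]; abel
        rw [this]; simp only [add_smul, sub_smul]; abel
      rcases h0.eq_or_lt with rfl | hr
      · simpa using hm
      have hd : 0 < r + (t - r') := by linarith
      have hc := M.convex hm hm' (a := (t - r') / (r + (t - r'))) (b := r / (r + (t - r')))
        (div_nonneg (by linarith) hd.le) (by positivity) (by field_simp; ring)
      convert hc using 1
      rw [e, smul_add, smul_smul, ← add_assoc, ← add_smul]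
      congr 2
      · rw [← add_div, add_comm _ r, div_self hd.ne', one_smul]
      · field_simp

theorem bodyVol_segAffine : SegAffine (bodyVol : ConvexBody E → ℝ) where
  mono := bodyVol_mono
  affine v M t := by
    have hle : ∀ s t : ℝ≥0, M + t • segBody v ≤ M + (t + s) • segBody v := fun s t x hx => by
      obtain ⟨m, hm, r, h0, h1, rfl⟩ := mem_add_smul_segBody.1 hx
      exact mem_add_smul_segBody.2 ⟨m, hm, r, h0, by push_cast; linarith [s.coe_nonneg], rfl⟩
    have hdiff : ∀ s t : ℝ≥0, bodyVol (M + (t + s) • segBody v) - bodyVol (M + t • segBody v) =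
        bodyVol (M + s • segBody v) - bodyVol M := fun s t => by
      have h0 : M ≤ M + s • segBody v := by simpa using hle s 0
      unfold bodyVol
      rw [← measureReal_sdiff (hle s t) (ConvexBody.isCompact _).measurableSet
          (ConvexBody.isCompact _).measure_lt_top.ne,
        ← measureReal_sdiff h0 (ConvexBody.isCompact _).measurableSet
          (ConvexBody.isCompact _).measure_lt_top.ne, diff_add_smul_segBody]
      simp only [measureReal_def, image_add_left, measure_preimage_add]
    have := linear_of_monotone_additive (g := fun t => bodyVol (M + t • segBody v) - bodyVol M)
      (fun s t h => by
        have := bodyVol_mono (hle (t - s) s)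
        rw [add_tsub_cancel_of_le h] at this
        simpa using this)
      (fun s t => by linarith [hdiff t s]) t
    simp only [one_smul] at this
    simp only [incr]
    linarith

end

theorem second_deriv_nonpos_of_isLocalMax {f f' : ℝ → ℝ} {d : ℝ}
    (hf : ∀ᶠ t in nhds 0, HasDerivAt f (f' t) t) (hf' : HasDerivAt f' d 0) (h0 : f' 0 = 0)
    (hmax : IsLocalMax f 0) : d ≤ 0 := by
  by_contra! hd
  have h1 : ∀ᶠ t in nhds 0, HasDerivAt (fun t => f t - d / 4 * t ^ 2) (f' t - d / 2 * t) t := by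
    filter_upwards [hf] with t ht
    have := ht.fun_sub (((hasDerivAt_id' t).fun_pow 2).const_mul (d / 4))
    exact this.congr_deriv (by push_cast; ring)
  have h2 : deriv (fun t => f t - d / 4 * t ^ 2) =ᶠ[nhds 0] fun t => f' t - d / 2 * t := by
    filter_upwards [h1] with t ht using ht.deriv
  have h3 : deriv (deriv (fun t => f t - d / 4 * t ^ 2)) 0 = d / 2 := by
    rw [h2.deriv_eq]
    have := hf'.sub ((hasDerivAt_id (0 : ℝ)).const_mul (d / 2))
    rw [show (fun t => f' t - d / 2 * t) = f' - fun y => d / 2 * id y from rfl, this.deriv]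
    ring
  have h4 := isLocalMin_of_deriv_deriv_pos (f := fun t => f t - d / 4 * t ^ 2) (x₀ := 0)
    (by rw [h3]; linarith) (by rw [h2.eq_of_nhds]; simp [h0]) h1.self_of_nhds.continuousAt
  have h5 : ∀ᶠ t in nhds (0 : ℝ), t = 0 := by
    filter_upwards [h4, hmax] with t h h'
    beta_reduce at h
    have : d / 4 * t ^ 2 ≤ 0 := by linarith
    have : t ^ 2 ≤ 0 := by nlinarith
    nlinarith [sq_nonneg t, pow_eq_zero_iff (two_ne_zero) |>.1 (le_antisymm this (sq_nonneg t))]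
  obtain ⟨e, he, h6⟩ := Metric.eventually_nhds_iff.1 h5
  have := h6 (y := e / 2) (by rw [Real.dist_eq, sub_zero, abs_of_pos (by linarith)]; linarith)
  linarith

/-- The second-order condition for midpoint concavity of `f ^ (1 / m)`. -/
theorem second_order_of_root_concave {f f' : ℝ → ℝ} {c : ℝ} {m : ℕ} (hm : m ≠ 0)
    (hf : ∀ t, HasDerivAt f (f' t) t) (hf' : HasDerivAt f' c 0) (h0 : 0 < f 0)
    (hroot : ∀ᶠ t in nhds 0, ∀ a b : ℝ, 0 ≤ a → 0 ≤ b → a ^ m ≤ f t → b ^ m ≤ f (-t) →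
      (a + b) ^ m ≤ 2 ^ m * f 0) :
    m * (f 0 * c) ≤ (m - 1) * f' 0 ^ 2 := by
  have hm' : (0 : ℝ) < m := by positivity
  have hpos : ∀ᶠ t in nhds 0, 0 < f t := (hf 0).continuousAt.eventually (lt_mem_nhds h0)
  have hneg : Filter.Tendsto (fun t : ℝ => -t) (nhds 0) (nhds 0) := by
    simpa using (continuous_neg.tendsto (0 : ℝ))
  set r : ℝ := 1 / m with hr
  set p : ℝ → ℝ := fun t => f t ^ r with hp
  set p' : ℝ → ℝ := fun t => f' t * r * f t ^ (r - 1) with hp'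
  set d : ℝ := (c * r) * f 0 ^ (r - 1) + f' 0 * r * (f' 0 * (r - 1) * f 0 ^ (r - 1 - 1)) with hd
  have hpd : ∀ᶠ t in nhds 0, HasDerivAt p (p' t) t := by
    filter_upwards [hpos] with t ht using (hf t).rpow_const (Or.inl ht.ne')
  have hpd' : HasDerivAt p' d 0 :=
    (hf'.mul_const r).mul ((hf 0).rpow_const (Or.inl h0.ne'))
  have hn0 : (-(0 : ℝ)) = 0 := neg_zero
  have key : d + d ≤ 0 := by
    refine second_deriv_nonpos_of_isLocalMax (f := fun t => p t + p (-t))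
      (f' := fun t => p' t - p' (-t)) ?_ ?_ (by simp) ?_
    · filter_upwards [hpd, hneg.eventually hpd] with t h1 h2
      have := h1.fun_add (h2.scomp t (hasDerivAt_neg t))
      exact this.congr_deriv (by simp [sub_eq_add_neg])
    · have h2 : HasDerivAt (fun t => p' (-t)) (-d) 0 := by
        have := HasDerivAt.scomp (g₁ := p') (h := fun t : ℝ => -t) (g₁' := d) (h' := -1) 0
          (by rw [neg_zero]; exact hpd') (hasDerivAt_neg 0)
        simpa [Function.comp_def] using this
      exact (hpd'.fun_sub h2).congr_deriv (by ring)
    · have hpow : ∀ t, 0 < f t → p t ^ m = f t := fun t ht => by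
        simp only [hp, hr]
        rw [← Real.rpow_natCast, ← Real.rpow_mul ht.le, one_div_mul_cancel hm'.ne', Real.rpow_one]
      have : ∀ᶠ t in nhds 0, p t + p (-t) ≤ p 0 + p (-0) := by
        filter_upwards [hroot, hpos, hneg.eventually hpos] with t h1 h2 h3
        have h4 := h1 (p t) (p (-t)) (by positivity) (by positivity) (hpow t h2).le (hpow _ h3).le
        rw [← hpow 0 h0, ← mul_pow] at h4
        have h5 := le_of_pow_le_pow_left₀ hm (by positivity) h4
        rw [neg_zero]; linarith
      exact this
  have e1 : f 0 ^ (r - 1) = f 0 ^ (r - 1 - 1) * f 0 := by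
    rw [← Real.rpow_add_one h0.ne']; congr 1; ring
  have hX : 0 < f 0 ^ (r - 1 - 1) := by positivity
  have e2 : d = f 0 ^ (r - 1 - 1) * (r * (f 0 * c + (r - 1) * f' 0 ^ 2)) := by
    rw [hd, e1]; ring
  have e3 : r * (f 0 * c + (r - 1) * f' 0 ^ 2) ≤ 0 := by
    by_contra! h
    have := mul_pos hX h
    linarith
  have e4 : m * (m * (r * (f 0 * c + (r - 1) * f' 0 ^ 2))) =
      m * (f 0 * c) - (m - 1) * f' 0 ^ 2 := by
    rw [hr]; field_simp; ring
  have : m * (m * (r * (f 0 * c + (r - 1) * f' 0 ^ 2))) ≤ 0 :=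
    mul_nonpos_of_nonneg_of_nonpos hm'.le (mul_nonpos_of_nonneg_of_nonpos hm'.le e3)
  linarith

theorem MvPolynomial.hasDerivAt_eval_line {ι : Type*} [Fintype ι] (P : MvPolynomial ι ℝ)
    (y x : ι → ℝ) (t : ℝ) :
    HasDerivAt (fun t : ℝ => MvPolynomial.eval (y + t • x) P)
      (∑ i, x i * MvPolynomial.eval (y + t • x) (MvPolynomial.pderiv i P)) t := by
  classical
  induction P using MvPolynomial.induction_on with
  | C a => simpa using hasDerivAt_const t a
  | add P Q hP hQ => simpa [mul_add, Finset.sum_add_distrib] using hP.fun_add hQ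
  | mul_X P j hP =>
    have h1 : HasDerivAt (fun t : ℝ => (y + t • x) j) (x j) t := by
      simpa using ((hasDerivAt_id t).mul_const (x j)).const_add (y j)
    simp only [map_mul, MvPolynomial.eval_X]
    refine (hP.fun_mul h1).congr_deriv ?_
    simp only [Derivation.leibniz, MvPolynomial.pderiv_X, smul_eq_mul, map_add, map_mul,
      MvPolynomial.eval_X, mul_add, Finset.sum_add_distrib, Finset.sum_mul]
    rw [add_comm]
    congr 1
    · rw [Finset.sum_eq_single j]
      · simp; ring
      · intro b _ hb
        simp [hb.symm, Pi.single_apply]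
      · simp
    · exact Finset.sum_congr rfl fun i _ => by ring

section
variable {E : Type*} [NormedAddCommGroup E] [InnerProductSpace ℝ E]

/-- `P` represents `y ↦ G (K + ∑ yᵢ [0, sᵢ])`. -/
def Represents {ι : Type*} [Fintype ι] (s : ι → E) (K : ConvexBody E) (P : MvPolynomial ι ℝ)
    (G : ConvexBody E → ℝ) : Prop :=
  ∀ y : ι → ℝ≥0, MvPolynomial.eval (fun i => (y i : ℝ)) P = G (K + ∑ i, y i • segBody (s i))

theorem SegAffine.exists_represents {ι : Type*} [Fintype ι] (s : ι → E) (K : ConvexBody E)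
    {G : ConvexBody E → ℝ} (hG : SegAffine G) : ∃ P, Represents s K P G := by
  classical
  suffices h : ∀ (S : Finset ι) (G : ConvexBody E → ℝ), SegAffine G → ∃ P : MvPolynomial ι ℝ,
      ∀ y : ι → ℝ≥0, MvPolynomial.eval (fun i => (y i : ℝ)) P =
        G (K + ∑ i ∈ S, y i • segBody (s i)) from h Finset.univ G hG
  intro S
  induction S using Finset.induction_on with
  | empty => exact fun G _ => ⟨MvPolynomial.C (G K), fun y => by simp⟩
  | insert i S hi ih =>
    intro G hG
    obtain ⟨P, hP⟩ := ih G hG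
    obtain ⟨Q, hQ⟩ := ih _ (hG.incr (s i))
    refine ⟨P + MvPolynomial.X i * Q, fun y => ?_⟩
    rw [Finset.sum_insert hi, add_comm (y i • _), ← add_assoc, hG.affine]
    simp [hP, hQ]

theorem Represents.pderiv {ι : Type*} [Fintype ι] {s : ι → E} {K : ConvexBody E}
    {P : MvPolynomial ι ℝ} {G : ConvexBody E → ℝ} (h : Represents s K P G) (hG : SegAffine G)
    (i : ι) : Represents s K (MvPolynomial.pderiv i P) (incr (segBody (s i)) G) := by
  classical
  intro y
  set N := K + ∑ i, y i • segBody (s i)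
  have h1 := (MvPolynomial.hasDerivAt_eval_line P (fun i => (y i : ℝ)) (Pi.single i 1) 0)
  have h2 : HasDerivWithinAt (fun t : ℝ => G N + t * incr (segBody (s i)) G N)
      (incr (segBody (s i)) G N) (Ici 0) 0 := by
    simpa using (((hasDerivAt_id (0 : ℝ)).mul_const (incr (segBody (s i)) G N)).const_add
      (G N)).hasDerivWithinAt
  have h3 : HasDerivWithinAt (fun t : ℝ => MvPolynomial.eval
      ((fun i => (y i : ℝ)) + t • (Pi.single i 1 : ι → ℝ)) P)
      (incr (segBody (s i)) G N) (Ici 0) 0 := by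
    refine h2.congr_of_mem (fun t ht => ?_) (by simp)
    lift t to ℝ≥0 using ht
    have := h (y + Pi.single i t)
    rw [show (fun j => (((y + Pi.single i t : ι → ℝ≥0) j : ℝ≥0) : ℝ)) =
      (fun i => (y i : ℝ)) + (t : ℝ) • (Pi.single i 1 : ι → ℝ) from ?_] at this
    · rw [this, ← hG.affine]
      congr 1
      simp only [N, Pi.add_apply, add_smul, Finset.sum_add_distrib, ← add_assoc]
      congr 1
      rw [Finset.sum_eq_single i]
      · simp
      · intro j _ hj; simp [hj]
      · simp
    · ext j
      rcases eq_or_ne j i with rfl | hj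
      · simp
      · simp [hj]
  have h4 := (uniqueDiffOn_Ici (0 : ℝ) 0 self_mem_Ici).eq_deriv _ h3 h1.hasDerivWithinAt
  rw [h4, Finset.sum_eq_single i]
  · simp
  · intro j _ hj; simp [hj]
  · simp

variable [MeasurableSpace E] [BorelSpace E] [FiniteDimensional ℝ E]

theorem bodyVol_smul (c : ℝ≥0) (M : ConvexBody E) :
    bodyVol (c • M) = c ^ Module.finrank ℝ E * bodyVol M := by
  unfold bodyVol
  rw [ConvexBody.coe_smul', measureReal_def]
  have : (c • (M : Set E)) = (c : ℝ) • (M : Set E) := rfl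
  rw [this, Measure.addHaar_smul, ENNReal.toReal_mul, ENNReal.toReal_ofReal (abs_nonneg _),
    abs_of_nonneg (by positivity), measureReal_def]

theorem incr_bodyVol_two_smul {m : ℕ} (hn : Module.finrank ℝ E = m + 1) (v : E)
    (M : ConvexBody E) :
    incr (segBody v) bodyVol ((2 : ℝ≥0) • M) = 2 ^ m * incr (segBody v) bodyVol M := by
  have h : (2 : ℝ≥0) • M + segBody v = (2 : ℝ≥0) • (M + (1 / 2 : ℝ≥0) • segBody v) := by
    rw [smul_add, smul_smul]; simp
  have := bodyVol_segAffine.affine v M (1 / 2)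
  simp only [incr] at this ⊢
  rw [h, bodyVol_smul, bodyVol_smul, this, hn]
  push_cast
  rw [pow_succ]
  ring

theorem incr_brunn_minkowski {m : ℕ} (hm : m ≠ 0) (hn : Module.finrank ℝ E = m + 1) (v : E)
    (M M' : ConvexBody E) {a b : ℝ≥0} (ha : (a : ℝ) ^ m ≤ incr (segBody v) bodyVol M)
    (hb : (b : ℝ) ^ m ≤ incr (segBody v) bodyVol M') :
    ((a : ℝ) + b) ^ m ≤ incr (segBody v) bodyVol (M + M') := by
  set D := incr (segBody v) bodyVol (M + M')
  have hD : 0 ≤ D := bodyVol_segAffine.incr_nonneg v _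
  rcases eq_or_lt_of_le (show (0 : ℝ) ≤ a + b by positivity) with h0 | hab
  · rw [← h0, zero_pow hm]; exact hD
  have key : ∀ k : ℕ, k * (((a : ℝ) + b) ^ (m + 1) - (a + b) * D) ≤ bodyVol (M + M') := fun k => by
    set c : ℝ := (k : ℝ) ^ (1 / ((m : ℝ) + 1)) with hc
    have hc0 : 0 ≤ c := by positivity
    have hck : c ^ (m + 1) = k := by
      rw [hc, ← Real.rpow_natCast, ← Real.rpow_mul (by positivity)]
      push_cast
      rw [one_div_mul_cancel (by positivity), Real.rpow_one]
    have vol0 : ∀ L : ConvexBody E, 0 ≤ bodyVol L := fun L => measureReal_nonneg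
    have aux : ∀ (L : ConvexBody E) (x : ℝ≥0), (x : ℝ) ^ m ≤ incr (segBody v) bodyVol L →
        (c * x) ^ (m + 1) ≤ bodyVol (L + (k * x : ℝ≥0) • segBody v) := fun L x hx => by
      rw [bodyVol_segAffine.affine, mul_pow, hck]
      have : (k : ℝ) * x * x ^ m ≤ (k * x) * incr (segBody v) bodyVol L := by gcongr
      have h3 := vol0 L
      push_cast
      rw [pow_succ]
      linarith
    have h1 := aux M a ha
    have h2 := aux M' b hb
    rw [← hn] at h1 h2
    have h3 := brunn_minkowski (ConvexBody.isCompact _) (ConvexBody.isCompact _)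
      (ConvexBody.nonempty _) (ConvexBody.nonempty _) (by positivity) (by positivity) h1 h2
    rw [← ConvexBody.coe_add, add_add_add_comm, ← add_smul] at h3
    have h4 := bodyVol_segAffine.affine v (M + M') (k * a + k * b)
    rw [← mul_add, mul_pow, hn, hck] at h3
    have h5 : (k : ℝ) * (a + b) ^ (m + 1) ≤ bodyVol (M + M') + (k * a + k * b) * D := by
      refine h3.trans (le_of_eq ?_)
      push_cast at h4
      exact h4
    linarith
  have h1 : ((a : ℝ) + b) ^ (m + 1) - (a + b) * D ≤ 0 := by
    by_contra! h
    obtain ⟨k, hk⟩ := exists_nat_gt (bodyVol (M + M') / (((a : ℝ) + b) ^ (m + 1) - (a + b) * D))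
    rw [div_lt_iff₀ h] at hk
    exact absurd (key k) (not_le.2 hk)
  rw [pow_succ, mul_comm, ← mul_sub] at h1
  by_contra! h
  have := mul_pos hab (sub_pos.2 h)
  linarith

/-- The second-order inequality for the directional increments of volume. -/
theorem second_order_incr {ι : Type*} [Fintype ι] {m : ℕ} (hm : m ≠ 0)
    (hn : Module.finrank ℝ E = m + 1) {s : ι → E} {K : ConvexBody E} {v : E}
    {P : MvPolynomial ι ℝ} (hP : Represents s K P (incr (segBody v) bodyVol)) {y : ι → ℝ}
    (hy : ∀ i, 0 < y i) (hpos : 0 < MvPolynomial.eval y P) (x : ι → ℝ) :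
    m * (MvPolynomial.eval y P * ∑ i, ∑ j, x i * x j *
        MvPolynomial.eval y (MvPolynomial.pderiv j (MvPolynomial.pderiv i P))) ≤
      (m - 1) * (∑ i, x i * MvPolynomial.eval y (MvPolynomial.pderiv i P)) ^ 2 := by
  have h1 := fun t => MvPolynomial.hasDerivAt_eval_line P y x t
  have h2 : HasDerivAt (fun t : ℝ => ∑ i, x i * MvPolynomial.eval (y + t • x)
      (MvPolynomial.pderiv i P)) (∑ i, ∑ j, x i * x j *
        MvPolynomial.eval y (MvPolynomial.pderiv j (MvPolynomial.pderiv i P))) 0 := by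
    refine HasDerivAt.fun_sum fun i _ => ?_
    have := (MvPolynomial.hasDerivAt_eval_line (MvPolynomial.pderiv i P) y x 0).const_mul (x i)
    exact this.congr_deriv (by simp [Finset.mul_sum, mul_assoc])
  have h := second_order_of_root_concave hm h1 h2 (by simpa using hpos) ?_
  · simpa using h
  have hev : ∀ᶠ t in nhds (0 : ℝ), ∀ i, |t * x i| < y i := by
    rw [Filter.eventually_all]
    intro i
    have : Filter.Tendsto (fun t : ℝ => |t * x i|) (nhds 0) (nhds 0) := by
      have hc : Continuous fun t : ℝ => |t * x i| := by fun_prop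
      simpa using hc.tendsto 0
    exact this.eventually (gt_mem_nhds (hy i))
  filter_upwards [hev] with t ht a b ha hb hat hbt
  lift a to ℝ≥0 using ha
  lift b to ℝ≥0 using hb
  have e : ∀ u : ℝ, |u| = |t| → ∀ i, 0 ≤ (y + u • x) i := fun u hu i => by
    have := ht i
    rw [abs_mul, ← hu, ← abs_mul] at this
    have := (abs_lt.1 this).1
    simp; linarith
  have r : ∀ u : ℝ, |u| = |t| → MvPolynomial.eval (y + u • x) P =
      incr (segBody v) bodyVol (K + ∑ i, ((y + u • x) i).toNNReal • segBody (s i)) := fun u hu => by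
    rw [← hP]
    congr 2
    ext i
    rw [Real.coe_toNNReal _ (e u hu i)]
  have r1 := r t rfl
  have r2 := r (-t) (abs_neg t)
  have r0 : MvPolynomial.eval y P =
      incr (segBody v) bodyVol (K + ∑ i, (y i).toNNReal • segBody (s i)) := by
    rw [← hP]
    congr 2
    ext i
    rw [Real.coe_toNNReal _ (hy i).le]
  rw [r1] at hat
  rw [r2] at hbt
  have := incr_brunn_minkowski hm hn v _ _ hat hbt
  simp only [zero_smul, add_zero]
  rw [r0, ← incr_bodyVol_two_smul hn]
  refine this.trans (le_of_eq ?_)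
  congr 1
  rw [add_add_add_comm, ← Finset.sum_add_distrib, smul_add, Finset.smul_sum, two_smul]
  congr 1
  refine Finset.sum_congr rfl fun i _ => ?_
  rw [← add_smul, smul_smul]
  congr 1
  ext
  have h1 := e t rfl i
  have h2 := e (-t) (abs_neg t) i
  push_cast
  rw [Real.coe_toNNReal _ h1, Real.coe_toNNReal _ h2, Real.coe_toNNReal _ (hy i).le]
  simp
  ring
end

section
open Matrix
variable {ι : Type*} [Fintype ι]

theorem Matrix.IsSymm.exists_eigenbasis [DecidableEq ι] {N : Matrix ι ι ℝ} (hN : N.IsSymm) :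
    ∃ (v : ι → ι → ℝ) (l : ι → ℝ), (∀ i j, v i ⬝ᵥ v j = if i = j then 1 else 0) ∧
      (∀ i, N *ᵥ v i = l i • v i) ∧ ∀ u : ι → ℝ, u = ∑ i, (u ⬝ᵥ v i) • v i := by
  have hH : N.IsHermitian := by
    rw [Matrix.IsHermitian, Matrix.conjTranspose_eq_transpose_of_trivial]; exact hN
  refine ⟨fun i => (hH.eigenvectorBasis i).ofLp, hH.eigenvalues, fun i j => ?_, fun i => ?_,
    fun u => ?_⟩
  · have := orthonormal_iff_ite.1 hH.eigenvectorBasis.orthonormal j i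
    rw [EuclideanSpace.inner_eq_star_dotProduct] at this
    simpa [eq_comm] using this
  · exact hH.mulVec_eigenvectorBasis i
  · have := hH.eigenvectorBasis.sum_repr' (WithLp.toLp 2 u)
    have := congrArg WithLp.ofLp this
    simp only [EuclideanSpace.inner_eq_star_dotProduct, WithLp.ofLp_sum, WithLp.ofLp_smul,
      star_trivial] at this
    exact this.symm

theorem spectral_bound {N : Matrix ι ι ℝ} (hN : N.IsSymm) {w b : ι → ℝ} {C : ℝ}
    (h1 : ∀ u : ι → ℝ, u ⬝ᵥ N *ᵥ u ≤ u ⬝ᵥ u)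
    (h2 : ∀ u : ι → ℝ, N *ᵥ u = u → ∃ c : ℝ, u = c • w)
    (h3 : ∀ (a : ℝ) (u : ι → ℝ), C * a ^ 2 + 2 * a * (b ⬝ᵥ u) + u ⬝ᵥ N *ᵥ u ≤
      (a • b + N *ᵥ u) ⬝ᵥ (a • b + N *ᵥ u)) :
    C * (w ⬝ᵥ w) ≤ (b ⬝ᵥ w) ^ 2 := by
  classical
  obtain ⟨v, l, hv, hl, hu⟩ := hN.exists_eigenbasis
  have dot : ∀ c e : ι → ℝ, (∑ i, c i • v i) ⬝ᵥ (∑ i, e i • v i) = ∑ i, c i * e i := fun c e => by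
    simp [sum_dotProduct, dotProduct_sum, hv, mul_comm]
  have hNs : ∀ c : ι → ℝ, N *ᵥ (∑ i, c i • v i) = ∑ i, (l i * c i) • v i := fun c => by
    simp only [mulVec_sum, mulVec_smul, hl, smul_smul]
    exact Finset.sum_congr rfl fun i _ => by rw [mul_comm]
  have hll : ∀ i, l i ≤ l i ^ 2 := fun i => by
    have := h3 0 (v i)
    simpa [hl, hv, pow_two] using this
  have hl1 : ∀ i, l i ≤ 1 := fun i => by simpa [hl, hv] using h1 (v i)
  have hl2 : ∀ i, l i = 1 ∨ l i ≤ 0 := fun i => by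
    by_contra! h
    have := lt_of_le_of_ne (hl1 i) h.1
    nlinarith [hll i, h.2]
  set B : ι → ℝ := fun i => b ⬝ᵥ v i
  let c : ι → ℝ := fun i => if l i = 1 then 0 else if l i = 0 then B i / 2 else - B i / l i
  have key : C ≤ ∑ i, if l i = 1 then B i ^ 2 else 0 := by
    have h := h3 1 (∑ i, c i • v i)
    rw [hNs, dot, one_smul] at h
    nth_rw 2 3 [hu b] at h
    nth_rw 1 [hu b] at h
    rw [dot, ← Finset.sum_add_distrib] at h
    simp only [← add_smul] at h
    rw [dot] at h
    have : ∀ i, (B i + l i * c i) * (B i + l i * c i) - 2 * (B i * c i) - c i * (l i * c i) ≤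
        if l i = 1 then B i ^ 2 else 0 := fun i => by
      rcases hl2 i with h | h
      · simp [c, h]; nlinarith
      · have h1 : l i ≠ 1 := by linarith
        by_cases h0 : l i = 0
        · simp [c, h0]; nlinarith
        · have hlt : l i < 0 := lt_of_le_of_ne h h0
          simp only [c, h1, h0, if_false]
          have e : (B i + l i * (-B i / l i)) * (B i + l i * (-B i / l i)) -
            2 * (B i * (-B i / l i)) - -B i / l i * (l i * (-B i / l i)) = B i ^ 2 / l i := by
            field_simp; ring
          rw [e]
          exact div_nonpos_of_nonneg_of_nonpos (sq_nonneg _) h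
    have h5 := Finset.sum_le_sum fun i (_ : i ∈ Finset.univ) => this i
    rw [Finset.sum_sub_distrib, Finset.sum_sub_distrib, ← Finset.mul_sum] at h5
    simp only [B] at h5 ⊢
    linarith
  have hww : 0 ≤ w ⬝ᵥ w := by
    rw [dotProduct]; exact Finset.sum_nonneg fun i _ => mul_self_nonneg _
  by_cases hex : ∃ k, l k = 1
  · obtain ⟨k, hk⟩ := hex
    have huniq : ∀ i, l i = 1 ↔ i = k := fun i => by
      refine ⟨fun hi => ?_, fun h => h ▸ hk⟩
      obtain ⟨c1, e1⟩ := h2 (v i) (by rw [hl, hi, one_smul])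
      obtain ⟨c2, e2⟩ := h2 (v k) (by rw [hl, hk, one_smul])
      by_contra hne
      have a1 := hv i k
      have a2 := hv i i
      have a3 := hv k k
      rw [if_neg hne, e1, e2] at a1
      rw [if_pos rfl, e1] at a2
      rw [if_pos rfl, e2] at a3
      simp only [smul_dotProduct, dotProduct_smul, smul_eq_mul] at a1 a2 a3
      have : (c1 * (c1 * (w ⬝ᵥ w))) * (c2 * (c2 * (w ⬝ᵥ w))) = 0 := by
        linear_combination (c1 * c2 * (w ⬝ᵥ w)) * a1
      rw [a2, a3] at this
      norm_num at this
    simp only [huniq, Finset.sum_ite_eq', Finset.mem_univ, if_true] at key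
    obtain ⟨c2, e2⟩ := h2 (v k) (by rw [hl, hk, one_smul])
    have a3 := hv k k
    rw [if_pos rfl, e2] at a3
    simp only [smul_dotProduct, dotProduct_smul, smul_eq_mul] at a3
    have hB : B k = c2 * (b ⬝ᵥ w) := by simp only [B]; rw [e2]; simp
    calc C * (w ⬝ᵥ w) ≤ B k ^ 2 * (w ⬝ᵥ w) := by gcongr
      _ = (c2 * (c2 * (w ⬝ᵥ w))) * (b ⬝ᵥ w) ^ 2 := by rw [hB]; ring
      _ = _ := by rw [a3, one_mul]
  · push Not at hex
    simp only [hex, if_false, Finset.sum_const_zero] at key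
    nlinarith [sq_nonneg (b ⬝ᵥ w)]

/-- A Lorentzian-type inequality for nonnegative irreducible symmetric matrices. -/
theorem lorentz_bound {M : ι → ι → ℝ} (hM : ∀ i j, M i j = M j i) (hM0 : ∀ i j, 0 ≤ M i j)
    {z b d : ι → ℝ} {C : ℝ} (hz : ∀ i, 0 < z i) (hd : ∀ i, ∑ j, M i j * z j = d i)
    (hd0 : ∀ i, 0 < d i) (hconn : ∀ i j, ∃ k, 0 < M i k ∧ 0 < M k j)
    (h : ∀ (a : ℝ) (x : ι → ℝ), C * a ^ 2 + 2 * a * (∑ i, b i * x i) +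
      ∑ i, x i * ∑ j, M i j * x j ≤ ∑ i, z i / d i * (a * b i + ∑ j, M i j * x j) ^ 2) :
    C * ∑ i, z i * d i ≤ (∑ i, b i * z i) ^ 2 := by
  classical
  set r : ι → ℝ := fun i => √(d i / z i) with hr
  have hr0 : ∀ i, 0 < r i := fun i => Real.sqrt_pos.2 (div_pos (hd0 i) (hz i))
  have hr2 : ∀ i, r i ^ 2 = d i / z i := fun i =>
    Real.sq_sqrt (div_pos (hd0 i) (hz i)).le
  let N : Matrix ι ι ℝ := Matrix.of fun i j => M i j / (r i * r j)
  have hNu : ∀ u i, (N *ᵥ u) i = (∑ j, M i j * (u j / r j)) / r i := fun u i => by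
    simp only [mulVec, dotProduct, N, Matrix.of_apply, Finset.sum_div]
    refine Finset.sum_congr rfl fun j _ => ?_
    have := (hr0 i).ne'; have := (hr0 j).ne'
    field_simp
  have hiden : ∀ u : ι → ℝ, u ⬝ᵥ u - u ⬝ᵥ N *ᵥ u =
      1 / 2 * ∑ i, ∑ j, M i j * z i * z j * (u i / r i / z i - u j / r j / z j) ^ 2 := fun u => by
    set x : ι → ℝ := fun i => u i / r i with hx
    have e1 : u ⬝ᵥ u = ∑ i, ∑ j, M i j * z j * (x i ^ 2 / z i) := by
      rw [dotProduct]
      refine Finset.sum_congr rfl fun i _ => ?_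
      rw [← Finset.sum_mul, hd, hx]
      have h1 := (hr0 i).ne'; have h2 := (hz i).ne'
      have h3 := hr2 i
      beta_reduce
      rw [div_pow, h3]
      have h4 := (hd0 i).ne'
      field_simp
    have e2 : u ⬝ᵥ N *ᵥ u = ∑ i, ∑ j, M i j * x i * x j := by
      rw [dotProduct]
      refine Finset.sum_congr rfl fun i _ => ?_
      rw [hNu, hx]
      simp only [Finset.mul_sum, Finset.sum_div]
      refine Finset.sum_congr rfl fun j _ => ?_
      ring
    have e3 : u ⬝ᵥ u = ∑ i, ∑ j, M i j * z i * (x j ^ 2 / z j) := by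
      rw [e1, Finset.sum_comm]
      refine Finset.sum_congr rfl fun i _ => Finset.sum_congr rfl fun j _ => ?_
      rw [hM]
    have e4 : u ⬝ᵥ u - u ⬝ᵥ N *ᵥ u = 1 / 2 * (u ⬝ᵥ u + u ⬝ᵥ u - 2 * (u ⬝ᵥ N *ᵥ u)) := by ring
    rw [e4]
    nth_rw 1 [e1]
    nth_rw 1 [e3]
    rw [e2]
    congr 1
    simp only [Finset.mul_sum, ← Finset.sum_add_distrib, ← Finset.sum_sub_distrib]
    refine Finset.sum_congr rfl fun i _ => Finset.sum_congr rfl fun j _ => ?_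
    have := (hz i).ne'; have := (hz j).ne'
    change _ = M i j * z i * z j * (x i / z i - x j / z j) ^ 2
    field_simp
    ring
  have hnn : ∀ (u : ι → ℝ) i j, 0 ≤ M i j * z i * z j * (u i / r i / z i - u j / r j / z j) ^ 2 :=
    fun u i j => mul_nonneg (mul_nonneg (mul_nonneg (hM0 i j) (hz i).le) (hz j).le) (sq_nonneg _)
  have hsb := spectral_bound (N := N) (w := fun i => r i * z i) (b := fun i => b i / r i) (C := C)
    ?_ ?_ ?_ ?_
  · convert hsb using 2
    · rw [dotProduct]
      refine Finset.sum_congr rfl fun i _ => ?_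
      have := hr2 i
      have h1 := (hz i).ne'
      calc z i * d i = (d i / z i) * z i ^ 2 := by field_simp
        _ = _ := by rw [← this]; ring
    · rw [dotProduct]
      refine Finset.sum_congr rfl fun i _ => ?_
      have := (hr0 i).ne'
      field_simp
  · ext i j
    simp [N, hM i j, mul_comm]
  · intro u
    have := hiden u
    have h2 : 0 ≤ 1 / 2 * ∑ i, ∑ j, M i j * z i * z j * (u i / r i / z i - u j / r j / z j) ^ 2 :=
      mul_nonneg (by norm_num) (Finset.sum_nonneg fun i _ => Finset.sum_nonneg fun j _ => hnn u i j)
    linarith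
  · intro u hu
    have h1 := hiden u
    rw [hu, sub_self] at h1
    have h2 : ∑ i, ∑ j, M i j * z i * z j * (u i / r i / z i - u j / r j / z j) ^ 2 = 0 := by
      linarith
    rw [Finset.sum_eq_zero_iff_of_nonneg fun i _ => Finset.sum_nonneg fun j _ => hnn u i j] at h2
    have h3 : ∀ i j, 0 < M i j → u i / r i / z i = u j / r j / z j := fun i j hij => by
      have := (Finset.sum_eq_zero_iff_of_nonneg fun j _ => hnn u i j).1 (h2 i (Finset.mem_univ _)) j
        (Finset.mem_univ _)
      have hp : M i j * z i * z j ≠ 0 := (mul_pos (mul_pos hij (hz i)) (hz j)).ne'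
      have := (mul_eq_zero.1 this).resolve_left hp
      exact sub_eq_zero.1 (pow_eq_zero_iff (two_ne_zero) |>.1 this)
    rcases isEmpty_or_nonempty ι with he | ⟨⟨i0⟩⟩
    · exact ⟨0, Subsingleton.elim _ _⟩
    refine ⟨u i0 / r i0 / z i0, funext fun i => ?_⟩
    obtain ⟨k, hk1, hk2⟩ := hconn i0 i
    have := (h3 _ _ hk1).trans (h3 _ _ hk2)
    have h5 := (hr0 i).ne'
    have h6 := (hz i).ne'
    simp only [Pi.smul_apply, smul_eq_mul]
    rw [this]
    field_simp
  · intro a u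
    have := h a fun i => u i / r i
    convert this using 1
    · congr 1
      · congr 2
        rw [dotProduct]
        refine Finset.sum_congr rfl fun i _ => ?_
        ring
      · rw [dotProduct]
        refine Finset.sum_congr rfl fun i _ => ?_
        rw [hNu]
        ring
    · rw [dotProduct]
      refine Finset.sum_congr rfl fun i _ => ?_
      simp only [Pi.add_apply, Pi.smul_apply, smul_eq_mul, hNu]
      have h1 : z i / d i = (r i ^ 2)⁻¹ := by rw [hr2, inv_div]
      rw [h1]
      have := (hr0 i).ne'
      field_simp
end

theorem lorentz_of_second_order {m F A Hx Hz T Tz Tzz a : ℝ} (hm : 1 < m) (hF : 0 < F)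
    (hTzz : 0 < Tzz) (hq : ∀ t : ℝ, m * (F * (T + 2 * t * Tz + t ^ 2 * Tzz)) ≤
      (m - 1) * (Hx + t * Hz) ^ 2) (hqz : m * (F * Tzz) ≤ (m - 1) * Hz ^ 2)
    (hA : A = m * (m - 1) * F) :
    A * a ^ 2 + 2 * (m - 1) * a * Hx + T ≤ ((m - 1) * a * Hz + Tz) ^ 2 / Tzz := by
  have hHz : Hz ≠ 0 := by
    rintro rfl
    have : 0 < m * (F * Tzz) := by positivity
    nlinarith
  obtain ⟨t, ht⟩ : ∃ t, Hx + t * Hz = - (m * F * a) :=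
    ⟨(-(m * F * a) - Hx) / Hz, by field_simp; ring⟩
  have h1 := hq t
  rw [ht] at h1
  have h2 : T + 2 * t * Tz + t ^ 2 * Tzz ≤ (m - 1) * (m * F * a ^ 2) := by
    have : (m * F) * (T + 2 * t * Tz + t ^ 2 * Tzz) ≤ (m * F) * ((m - 1) * (m * F * a ^ 2)) := by
      nlinarith
    exact le_of_mul_le_mul_left this (by positivity)
  have h3 : Hx = - (m * F * a) - t * Hz := by linarith
  rw [le_div_iff₀ hTzz, hA, h3]
  nlinarith [sq_nonneg ((m - 1) * a * Hz + Tz + t * Tzz), mul_le_mul_of_nonneg_right h2 hTzz.le]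

section
variable {ι : Type*} [Fintype ι]

theorem sum_quadratic_add (T : ι → ι → ℝ) (hT : ∀ j k, T j k = T k j) (x z : ι → ℝ) (t : ℝ) :
    ∑ j, ∑ k, (x j + t * z j) * (x k + t * z k) * T j k =
      ∑ j, ∑ k, x j * x k * T j k + 2 * t * ∑ j, ∑ k, x j * z k * T j k +
        t ^ 2 * ∑ j, ∑ k, z j * z k * T j k := by
  have h : ∑ j, ∑ k, x j * z k * T j k = ∑ j, ∑ k, z j * x k * T j k := by
    rw [Finset.sum_comm]
    exact Finset.sum_congr rfl fun j _ => Finset.sum_congr rfl fun k _ => by rw [hT]; ring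
  rw [two_mul, add_mul]
  nth_rw 2 [h]
  simp only [Finset.mul_sum, ← Finset.sum_add_distrib]
  exact Finset.sum_congr rfl fun j _ => Finset.sum_congr rfl fun k _ => by ring

theorem aggregate_second_order {m : ℝ} (hm : 1 < m) {F : ι → ℝ} {H : ι → ι → ℝ}
    {T : ι → ι → ι → ℝ} {z : ι → ℝ} (hF : ∀ i, 0 < F i) (hH : ∀ i j, H i j = H j i)
    (hT1 : ∀ i j k, T i j k = T j i k) (hT2 : ∀ i j k, T i j k = T i k j)
    (hz : ∀ i, 0 < z i) (hT0 : ∀ i j k, 0 ≤ T i j k)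
    (hpos : ∀ i j, ∃ k, (∃ l, 0 < T i k l) ∧ ∃ l, 0 < T k j l)
    (hq : ∀ i (x : ι → ℝ), m * (F i * ∑ j, ∑ k, x j * x k * T i j k) ≤
      (m - 1) * (∑ j, x j * H i j) ^ 2) :
    m * ((∑ i, z i * F i) * ∑ i, ∑ j, ∑ k, z i * z j * z k * T i j k) ≤
      (m - 1) * (∑ i, ∑ j, z i * z j * H i j) ^ 2 := by
  set M : ι → ι → ℝ := fun i j => ∑ k, T i j k * z k with hM
  have hMs : ∀ i j, M i j = M j i := fun i j => by simp only [hM, hT1 i j]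
  have hM0 : ∀ i j, 0 ≤ M i j := fun i j =>
    Finset.sum_nonneg fun k _ => mul_nonneg (hT0 _ _ _) (hz k).le
  have hMpos : ∀ i j, (∃ l, 0 < T i j l) → 0 < M i j := fun i j ⟨l, hl⟩ =>
    Finset.sum_pos' (fun k _ => mul_nonneg (hT0 _ _ _) (hz k).le)
      ⟨l, Finset.mem_univ _, mul_pos hl (hz l)⟩
  have hconn : ∀ i j, ∃ k, 0 < M i k ∧ 0 < M k j := fun i j => by
    obtain ⟨k, h1, h2⟩ := hpos i j
    exact ⟨k, hMpos _ _ h1, hMpos _ _ h2⟩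
  set d : ι → ℝ := fun i => ∑ j, M i j * z j with hd
  have hd0 : ∀ i, 0 < d i := fun i => by
    obtain ⟨k, h1, -⟩ := hconn i i
    exact Finset.sum_pos' (fun k _ => mul_nonneg (hM0 _ _) (hz k).le)
      ⟨k, Finset.mem_univ _, mul_pos h1 (hz k)⟩
  have hdT : ∀ i, ∑ j, ∑ k, z j * z k * T i j k = d i := fun i => by
    simp only [hd, hM, Finset.sum_mul]
    exact Finset.sum_congr rfl fun j _ => Finset.sum_congr rfl fun k _ => by ring
  have hMx : ∀ i (x : ι → ℝ), ∑ j, ∑ k, x j * z k * T i j k = ∑ j, M i j * x j := fun i x => by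
    simp only [hM, Finset.sum_mul]
    exact Finset.sum_congr rfl fun j _ => Finset.sum_congr rfl fun k _ => by ring
  have hind : ∀ i (a : ℝ) (x : ι → ℝ), m * (m - 1) * F i * a ^ 2 +
      2 * (m - 1) * a * (∑ j, x j * H i j) + ∑ j, ∑ k, x j * x k * T i j k ≤
      ((m - 1) * a * (∑ j, z j * H i j) + ∑ j, M i j * x j) ^ 2 / d i := fun i a x => by
    refine lorentz_of_second_order hm (hF i) (hd0 i) (fun t => ?_) ?_ rfl
    · have := hq i fun j => x j + t * z j
      rw [sum_quadratic_add _ (hT2 i), hdT, hMx] at this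
      simpa [add_mul, Finset.sum_add_distrib, mul_assoc, ← Finset.mul_sum] using this
    · have := hq i z
      rwa [hdT] at this
  have key := lorentz_bound (M := M) (z := z) (b := fun i => (m - 1) * ∑ j, z j * H i j) (d := d)
    (C := m * (m - 1) * ∑ i, z i * F i) hMs hM0 hz (fun i => rfl) hd0 hconn fun a x => by
      have := Finset.sum_le_sum fun i (_ : i ∈ Finset.univ) =>
        mul_le_mul_of_nonneg_left (hind i a x) (hz i).le
      refine le_trans (le_of_eq ?_) (this.trans (le_of_eq ?_))
      · simp only [mul_add, Finset.sum_add_distrib]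
        congr 1
        · congr 1
          · simp only [Finset.mul_sum, Finset.sum_mul]
            exact Finset.sum_congr rfl fun i _ => by ring
          · simp only [Finset.mul_sum, Finset.sum_mul]
            rw [Finset.sum_comm]
            exact Finset.sum_congr rfl fun j _ => Finset.sum_congr rfl fun k _ => by
              rw [hH]; ring
        · simp only [hM, Finset.mul_sum, Finset.sum_mul]
          calc ∑ j, ∑ k, ∑ i, x j * (T j k i * z i * x k)
              = ∑ j, ∑ i, ∑ k, x j * (T j k i * z i * x k) :=
                Finset.sum_congr rfl fun j _ => Finset.sum_comm
            _ = ∑ i, ∑ j, ∑ k, x j * (T j k i * z i * x k) := Finset.sum_comm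
            _ = _ := Finset.sum_congr rfl fun i _ => Finset.sum_congr rfl fun j _ =>
                Finset.sum_congr rfl fun k _ => by rw [hT2 j k i, hT1 j i k]; ring
      · refine Finset.sum_congr rfl fun i _ => ?_
        ring
  have e1 : ∑ i, ∑ j, ∑ k, z i * z j * z k * T i j k = ∑ i, z i * d i := by
    refine Finset.sum_congr rfl fun i _ => ?_
    rw [← hdT]
    simp only [Finset.mul_sum]
    exact Finset.sum_congr rfl fun j _ => Finset.sum_congr rfl fun k _ => by ring
  have e2 : ∑ i, ((m - 1) * ∑ j, z j * H i j) * z i = (m - 1) * ∑ i, ∑ j, z i * z j * H i j := by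
    simp only [Finset.mul_sum, Finset.sum_mul]
    exact Finset.sum_congr rfl fun j _ => Finset.sum_congr rfl fun k _ => by ring
  rw [e1]
  rw [e2] at key
  have hm1 : 0 < m - 1 := by linarith
  refine le_of_mul_le_mul_left ?_ hm1
  linarith
end

section
variable {E : Type*} [NormedAddCommGroup E] [InnerProductSpace ℝ E]

/-- A point, as a convex body. -/
def pointBody (x : E) : ConvexBody E where
  carrier := {x}
  convex' := convex_singleton x
  isCompact' := isCompact_singleton
  nonempty' := singleton_nonempty x

theorem coe_pointBody_add (x : E) (M : ConvexBody E) :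
    ((pointBody x + M : ConvexBody E) : Set E) = (fun y => x + y) '' (M : Set E) := by
  rw [ConvexBody.coe_add]
  exact singleton_add

theorem coe_sum_smul_segBody {ι : Type*} [Fintype ι] (w : ι → ℝ≥0) (b : ι → E) :
    ((∑ i, w i • segBody (b i) : ConvexBody E) : Set E) =
      parallelepiped (fun i => (w i : ℝ) • b i) := by
  rw [parallelepiped_eq_sum_segment]
  have h : ∀ S : Finset ι, ((∑ i ∈ S, w i • segBody (b i) : ConvexBody E) : Set E) =
      ∑ i ∈ S, segment ℝ 0 ((w i : ℝ) • b i) := fun S => by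
    classical
    induction S using Finset.induction_on with
    | empty => simp
    | insert i S hi ih =>
      rw [Finset.sum_insert hi, Finset.sum_insert hi, ConvexBody.coe_add, ih]
      congr 1
      ext x
      have := mem_add_smul_segBody (M := 0) (v := b i) (t := w i) (x := x)
      rw [zero_add] at this
      rw [this, segment_eq_image]
      simp only [ConvexBody.coe_zero, Set.mem_zero, exists_eq_left, zero_add, smul_zero, mem_image,
        mem_Icc, smul_smul]
      constructor
      · rintro ⟨r, h0, h1, rfl⟩
        rcases eq_or_ne (w i) 0 with hw | hw
        · refine ⟨0, by simp, ?_⟩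
          have : r = 0 := le_antisymm (by simpa [hw] using h1) h0
          simp [this]
        · have hw' : (0 : ℝ) < w i := by positivity
          exact ⟨r / w i, ⟨by positivity, by rwa [div_le_one hw']⟩, by
            rw [div_mul_cancel₀ _ hw'.ne']⟩
      · rintro ⟨r, ⟨h0, h1⟩, rfl⟩
        exact ⟨r * w i, by positivity, mul_le_of_le_one_left (by positivity) h1, rfl⟩
  exact h _

/-- Increments of a function whose values on boxes are monomials are again monomials. -/
theorem incr_box {ι : Type*} [Fintype ι] [DecidableEq ι] {b : ι → E} {x : E} {S : Finset ι} {V : ℝ}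
    {G : ConvexBody E → ℝ}
    (hG : ∀ w : ι → ℝ≥0, G (pointBody x + ∑ i, w i • segBody (b i)) = V * ∏ i ∈ S, (w i : ℝ))
    {j : ι} (hj : j ∈ S) (w : ι → ℝ≥0) :
    incr (segBody (b j)) G (pointBody x + ∑ i, w i • segBody (b i)) =
      V * ∏ i ∈ S.erase j, (w i : ℝ) := by
  have h1 : pointBody x + ∑ i, w i • segBody (b i) + segBody (b j) =
      pointBody x + ∑ i, (w + Pi.single j 1 : ι → ℝ≥0) i • segBody (b i) := by
    simp [add_smul, Finset.sum_add_distrib, add_assoc, Pi.single_apply]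
  rw [incr, h1, hG, hG, ← Finset.mul_prod_erase S _ hj, ← Finset.mul_prod_erase S _ hj]
  have : ∏ i ∈ S.erase j, ((w + Pi.single j 1 : ι → ℝ≥0) i : ℝ) = ∏ i ∈ S.erase j, (w i : ℝ) :=
    Finset.prod_congr rfl fun i hi => by simp [Finset.ne_of_mem_erase hi]
  rw [this]
  simp
  ring

theorem exists_box_le {M : ConvexBody E} (hM : (interior (M : Set E)).Nonempty) {ι : Type*}
    [Fintype ι] (b : ι → E) :
    ∃ (x : E) (ε : ℝ≥0), 0 < ε ∧ pointBody x + ∑ i, ε • segBody (b i) ≤ M := by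
  obtain ⟨x, hx⟩ := hM
  obtain ⟨r, hr, hrM⟩ := Metric.isOpen_iff.1 isOpen_interior x hx
  set B := ∑ i, ‖b i‖ with hB
  have hB0 : 0 ≤ B := Finset.sum_nonneg fun _ _ => norm_nonneg _
  refine ⟨x, (r / (2 * (B + 1))).toNNReal, Real.toNNReal_pos.2 (by positivity), ?_⟩
  rw [← SetLike.coe_subset_coe, coe_pointBody_add, coe_sum_smul_segBody]
  rintro _ ⟨y, hy, rfl⟩
  obtain ⟨t, ht, rfl⟩ := (mem_parallelepiped_iff _ _).1 hy
  refine interior_subset (hrM ?_)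
  rw [mem_ball, dist_eq_norm, add_sub_cancel_left]
  have h1 : ‖∑ i, t i • (((r / (2 * (B + 1))).toNNReal : ℝ) • b i)‖ ≤ r / (2 * (B + 1)) * B := by
    rw [hB, Finset.mul_sum]
    refine norm_sum_le_of_le _ fun i _ => ?_
    have h2 := ht.1 i
    have h3 := ht.2 i
    simp only [Pi.zero_apply, Pi.one_apply] at h2 h3
    rw [Real.coe_toNNReal _ (by positivity), norm_smul, norm_smul, Real.norm_of_nonneg h2,
      Real.norm_of_nonneg (by positivity)]
    exact mul_le_of_le_one_left (by positivity) h3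
  refine h1.trans_lt ?_
  rw [div_mul_eq_mul_div, div_lt_iff₀ (by positivity)]
  nlinarith

variable [MeasurableSpace E] [BorelSpace E] [FiniteDimensional ℝ E]

theorem bodyVol_pointBody_add (x : E) (M : ConvexBody E) : bodyVol (pointBody x + M) = bodyVol M := by
  rw [bodyVol, coe_pointBody_add, bodyVol, measureReal_def, measureReal_def, image_add_left,
    measure_preimage_add]

theorem bodyVol_box {ι : Type*} [Fintype ι] (b : Module.Basis ι ℝ E) :
    ∃ V : ℝ, 0 < V ∧ ∀ (x : E) (w : ι → ℝ≥0),
      bodyVol (pointBody x + ∑ i, w i • segBody (b i)) = V * ∏ i, (w i : ℝ) := by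
  classical
  refine ⟨volume.real (parallelepiped b), ?_, fun x w => ?_⟩
  · rw [measureReal_def]
    refine ENNReal.toReal_pos ?_ b.parallelepiped.isCompact.measure_lt_top.ne
    have := b.parallelepiped.interior_nonempty
    exact (Measure.measure_pos_of_nonempty_interior _ this).ne'
  · rw [bodyVol_pointBody_add, bodyVol, coe_sum_smul_segBody]
    have hc := Measure.isAddLeftInvariant_eq_smul (volume : Measure E) b.addHaar
    rw [hc, measureReal_def, measureReal_def, Measure.smul_apply, Measure.smul_apply,
      Measure.addHaar_parallelepiped, Measure.addHaar_parallelepiped, AlternatingMap.map_smul_univ,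
      b.det_self]
    simp [abs_of_nonneg, Finset.prod_nonneg, mul_comm, ENNReal.smul_def]

theorem LinearIndependent.exists_basis_range {k : ℕ} {v : Fin k → E} (hv : LinearIndependent ℝ v) :
    ∃ (ι : Set E) (_ : Fintype ι) (b : Module.Basis ι ℝ E) (e : Fin k → ι),
      Function.Injective e ∧ ∀ i, b (e i) = v i := by
  let b := Module.Basis.extend hv.linearIndepOn_id
  refine ⟨_, FiniteDimensional.fintypeBasisIndex b, b,
    fun i => ⟨v i, Module.Basis.subset_extend hv.linearIndepOn_id (mem_range_self i)⟩, ?_, ?_⟩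
  · intro i j hij
    exact hv.injective (Subtype.ext_iff.1 hij)
  · intro i
    exact Module.Basis.extend_apply_self _ _

theorem incr_pos {M : ConvexBody E} (hM : (interior (M : Set E)).Nonempty) {a : E} (ha : a ≠ 0) :
    0 < incr (segBody a) bodyVol M := by
  classical
  have hli : LinearIndependent ℝ ![a] := by
    rw [linearIndependent_unique_iff]
    simpa
  obtain ⟨ι, _, b, e, -, hb⟩ := hli.exists_basis_range
  obtain ⟨V, hV, hbox⟩ := bodyVol_box b
  obtain ⟨x, ε, hε, hle⟩ := exists_box_le hM b
  have h1 := incr_box (S := Finset.univ) (hbox x) (Finset.mem_univ (e 0)) (fun _ => ε)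
  rw [hb] at h1
  refine lt_of_lt_of_le ?_ ((bodyVol_segAffine.incr a).mono hle)
  have : (0 : ℝ) < ε := hε
  exact h1 ▸ mul_pos hV (Finset.prod_pos fun _ _ => this)

theorem incr_three_pos {M : ConvexBody E} (hM : (interior (M : Set E)).Nonempty) {v : Fin 3 → E}
    (hv : LinearIndependent ℝ v) :
    0 < incr (segBody (v 2)) (incr (segBody (v 1)) (incr (segBody (v 0)) bodyVol)) M := by
  classical
  obtain ⟨ι, _, b, e, he, hb⟩ := hv.exists_basis_range
  obtain ⟨V, hV, hbox⟩ := bodyVol_box b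
  obtain ⟨x, ε, hε, hle⟩ := exists_box_le hM b
  have h1 := incr_box (S := Finset.univ) (hbox x) (Finset.mem_univ (e 0))
  have h2 := incr_box h1 (j := e 1) (by simp [he.eq_iff])
  have h3 := incr_box h2 (j := e 2) (by simp [he.eq_iff]) (fun _ => ε)
  rw [hb, hb, hb] at h3
  refine lt_of_lt_of_le ?_ ((((bodyVol_segAffine.incr _).incr _).incr _).mono hle)
  rw [h3]
  have : (0 : ℝ) < ε := hε
  exact mul_pos hV (Finset.prod_pos fun _ _ => this)
end

theorem MvPolynomial.pderiv_pderiv_comm {ι : Type*} (i j : ι) (P : MvPolynomial ι ℝ) :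
    MvPolynomial.pderiv i (MvPolynomial.pderiv j P) =
      MvPolynomial.pderiv j (MvPolynomial.pderiv i P) := by
  classical
  have h : ⁅(MvPolynomial.pderiv i : Derivation ℝ (MvPolynomial ι ℝ) (MvPolynomial ι ℝ)),
      (MvPolynomial.pderiv j : Derivation ℝ (MvPolynomial ι ℝ) (MvPolynomial ι ℝ))⁆ = 0 := by
    refine MvPolynomial.derivation_ext fun k => ?_
    have : ∀ l k : ι, ∃ c : ℝ, (Pi.single l (1 : MvPolynomial ι ℝ) : ι → _) k = MvPolynomial.C c :=
      fun l k => by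
        rcases eq_or_ne k l with rfl | h
        · exact ⟨1, by simp⟩
        · exact ⟨0, by simp [h]⟩
    rw [Derivation.commutator_apply, MvPolynomial.pderiv_X, MvPolynomial.pderiv_X]
    obtain ⟨c, hc⟩ := this j k
    obtain ⟨d, hd⟩ := this i k
    simp [hc, hd]
  have h2 := congrArg (fun D => D P) h
  simpa [Derivation.commutator_apply, sub_eq_zero] using h2

section
variable {E : Type*} [NormedAddCommGroup E] [InnerProductSpace ℝ E]
variable {ι : Type*} [Fintype ι]

theorem exists_notMem_span_pair {s : ι → E} (hs : Submodule.span ℝ (range s) = ⊤)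
    (h3 : 3 ≤ Module.finrank ℝ E) (a b : E) : ∃ k, s k ∉ Submodule.span ℝ {a, b} := by
  classical
  by_contra! h
  have h1 : Submodule.span ℝ {a, b} = ⊤ := by
    rw [eq_top_iff, ← hs, Submodule.span_le]
    rintro _ ⟨k, rfl⟩
    exact h k
  have h2 := finrank_span_finset_le_card (R := ℝ) ({a, b} : Finset E)
  rw [Finset.coe_pair, Set.finrank, h1, finrank_top] at h2
  have := Finset.card_le_two (a := a) (b := b)
  omega

theorem linearIndependent_three {a b c : E} (ha : a ≠ 0) (hb : b ∉ Submodule.span ℝ {a})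
    (hc : c ∉ Submodule.span ℝ {a, b}) : LinearIndependent ℝ ![a, b, c] := by
  rw [linearIndependent_finSucc']
  have e : Fin.init ![a, b, c] = ![a, b] := by
    ext i; fin_cases i <;> rfl
  rw [e]
  refine ⟨?_, ?_⟩
  · rw [LinearIndependent.pair_iff' ha]
    rintro r rfl
    exact hb (Submodule.smul_mem _ _ (Submodule.mem_span_singleton_self a))
  · rw [Matrix.range_cons, Matrix.range_cons, Matrix.range_empty, union_empty]
    exact hc

variable [MeasurableSpace E] [BorelSpace E] [FiniteDimensional ℝ E]

/-- The mixed volume derivative of a body in the direction of the zonotope `∑ [0, sᵢ]`. -/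
def zper (s : ι → E) (M : ConvexBody E) : ℝ := ∑ i, incr (segBody (s i)) bodyVol M

theorem zper_mono (s : ι → E) : Monotone (zper s) := fun _ _ h =>
  Finset.sum_le_sum fun i _ => (bodyVol_segAffine.incr (s i)).mono h

theorem zper_nonneg (s : ι → E) (M : ConvexBody E) : 0 ≤ zper s M :=
  Finset.sum_nonneg fun i _ => bodyVol_segAffine.incr_nonneg (s i) M

theorem zper_second_order {m : ℕ} (hm : m ≠ 0) (hn : Module.finrank ℝ E = m + 1) {s : ι → E}
    (hs0 : ∀ i, s i ≠ 0) (hs : Submodule.span ℝ (range s) = ⊤) {K : ConvexBody E}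
    (hK : (interior (K : Set E)).Nonempty) {P : MvPolynomial ι ℝ} (hP : Represents s K P bodyVol)
    {y : ι → ℝ} (hy : ∀ i, 0 < y i) :
    m * ((∑ i, MvPolynomial.eval y (MvPolynomial.pderiv i P)) *
        ∑ i, ∑ j, ∑ k, MvPolynomial.eval y
          (MvPolynomial.pderiv k (MvPolynomial.pderiv j (MvPolynomial.pderiv i P)))) ≤
      (m - 1) * (∑ i, ∑ j, MvPolynomial.eval y
        (MvPolynomial.pderiv j (MvPolynomial.pderiv i P))) ^ 2 := by
  set M : ConvexBody E := K + ∑ i, (y i).toNNReal • segBody (s i) with hM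
  have hKM : K ≤ M := by
    refine ConvexBody.le_add_of_zero_mem ?_
    rw [coe_sum_smul_segBody, mem_parallelepiped_iff]
    exact ⟨0, by simp, by simp⟩
  have hMi : (interior (M : Set E)).Nonempty := hK.mono (interior_mono hKM)
  have hyy : (fun i => ((y i).toNNReal : ℝ)) = y := by
    ext i; rw [Real.coe_toNNReal _ (hy i).le]
  have h1 : ∀ i, Represents s K (MvPolynomial.pderiv i P) (incr (segBody (s i)) bodyVol) :=
    fun i => hP.pderiv bodyVol_segAffine i
  have h2 : ∀ i j, Represents s K (MvPolynomial.pderiv j (MvPolynomial.pderiv i P))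
      (incr (segBody (s j)) (incr (segBody (s i)) bodyVol)) :=
    fun i j => (h1 i).pderiv (bodyVol_segAffine.incr _) j
  have h3 : ∀ i j k, Represents s K
      (MvPolynomial.pderiv k (MvPolynomial.pderiv j (MvPolynomial.pderiv i P)))
      (incr (segBody (s k)) (incr (segBody (s j)) (incr (segBody (s i)) bodyVol))) :=
    fun i j k => (h2 i j).pderiv ((bodyVol_segAffine.incr _).incr _) k
  have hF : ∀ i, 0 < MvPolynomial.eval y (MvPolynomial.pderiv i P) := fun i => by
    rw [← hyy, h1 i]
    exact incr_pos hMi (hs0 i)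
  have hq := fun i => second_order_incr hm hn (h1 i) hy (hF i)
  rcases (Nat.one_le_iff_ne_zero.2 hm).eq_or_lt with rfl | hm1
  · have : ∀ i, ∑ j, ∑ k, MvPolynomial.eval y
        (MvPolynomial.pderiv k (MvPolynomial.pderiv j (MvPolynomial.pderiv i P))) ≤ 0 := fun i => by
      have := hq i 1
      simp at this
      exact nonpos_of_mul_nonpos_right this (hF i)
    have h4 := mul_nonpos_of_nonneg_of_nonpos
      (Finset.sum_nonneg fun i (_ : i ∈ Finset.univ) => (hF i).le)
      (Finset.sum_nonpos fun i (_ : i ∈ Finset.univ) => this i)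
    simpa using h4
  · have hT1 : ∀ i j k, MvPolynomial.eval y
        (MvPolynomial.pderiv k (MvPolynomial.pderiv j (MvPolynomial.pderiv i P))) =
        MvPolynomial.eval y
        (MvPolynomial.pderiv k (MvPolynomial.pderiv i (MvPolynomial.pderiv j P))) := fun i j k => by
      rw [MvPolynomial.pderiv_pderiv_comm j i]
    have hpos : ∀ i j k, s j ∉ Submodule.span ℝ {s i} → s k ∉ Submodule.span ℝ {s i, s j} →
        0 < MvPolynomial.eval y
        (MvPolynomial.pderiv k (MvPolynomial.pderiv j (MvPolynomial.pderiv i P))) :=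
      fun i j k hj hk => by
        rw [← hyy, h3 i j k]
        have := incr_three_pos hMi (linearIndependent_three (hs0 i) hj hk)
        simpa only [Matrix.cons_val] using this
    have h3n : 3 ≤ Module.finrank ℝ E := by omega
    have hT0 : ∀ i j k, 0 ≤ MvPolynomial.eval y
        (MvPolynomial.pderiv k (MvPolynomial.pderiv j (MvPolynomial.pderiv i P))) :=
      fun i j k => by
        rw [← hyy, h3 i j k]
        exact ((bodyVol_segAffine.incr _).incr _).incr_nonneg _ _
    have hT2 : ∀ i j k, MvPolynomial.eval y
        (MvPolynomial.pderiv k (MvPolynomial.pderiv j (MvPolynomial.pderiv i P))) =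
        MvPolynomial.eval y
        (MvPolynomial.pderiv j (MvPolynomial.pderiv k (MvPolynomial.pderiv i P))) := fun i j k => by
      rw [MvPolynomial.pderiv_pderiv_comm k j]
    have hH : ∀ i j, MvPolynomial.eval y (MvPolynomial.pderiv j (MvPolynomial.pderiv i P)) =
        MvPolynomial.eval y (MvPolynomial.pderiv i (MvPolynomial.pderiv j P)) := fun i j => by
      rw [MvPolynomial.pderiv_pderiv_comm j i]
    have hconn : ∀ i j, ∃ k, (∃ l, 0 < MvPolynomial.eval y
        (MvPolynomial.pderiv l (MvPolynomial.pderiv k (MvPolynomial.pderiv i P)))) ∧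
        ∃ l, 0 < MvPolynomial.eval y
        (MvPolynomial.pderiv l (MvPolynomial.pderiv j (MvPolynomial.pderiv k P))) := fun i j => by
      obtain ⟨k, hk⟩ := exists_notMem_span_pair hs h3n (s i) (s j)
      obtain ⟨l, hl⟩ := exists_notMem_span_pair hs h3n (s i) (s k)
      obtain ⟨l', hl'⟩ := exists_notMem_span_pair hs h3n (s j) (s k)
      refine ⟨k, ⟨l, hpos _ _ _ (fun h => hk ?_) hl⟩, l', ?_⟩
      · exact Submodule.span_mono (by simp) h
      · rw [hT1]
        exact hpos _ _ _ (fun h => hk (Submodule.span_mono (by simp) h)) hl'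
    clear hpos h3 h2 h1
    obtain ⟨T, hT⟩ : ∃ T : ι → ι → ι → ℝ, ∀ i j k, MvPolynomial.eval y
        (MvPolynomial.pderiv k (MvPolynomial.pderiv j (MvPolynomial.pderiv i P))) = T i j k :=
      ⟨_, fun _ _ _ => rfl⟩
    obtain ⟨H, hH'⟩ : ∃ H : ι → ι → ℝ, ∀ i j, MvPolynomial.eval y
        (MvPolynomial.pderiv j (MvPolynomial.pderiv i P)) = H i j :=
      ⟨_, fun _ _ => rfl⟩
    simp only [hT, hH'] at hH hT0 hT1 hT2 hconn hq ⊢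
    have := aggregate_second_order (m := m) (by exact_mod_cast hm1) (z := fun _ => 1) hF
      hH hT1 hT2 (fun _ => one_pos) hT0 hconn hq
    simpa using this
end

theorem concaveOn_root {m : ℕ} (hm : m ≠ 0) {g g' g'' : ℝ → ℝ}
    (hg : ∀ t, HasDerivAt g (g' t) t) (hg' : ∀ t, HasDerivAt g' (g'' t) t)
    (hpos : ∀ t, 0 ≤ t → 0 < g t)
    (h : ∀ t, 0 < t → m * (g t * g'' t) ≤ (m - 1) * g' t ^ 2) :
    ConcaveOn ℝ (Ici 0) (fun t => g t ^ (1 / (m : ℝ))) := by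
  have hm' : (0 : ℝ) < m := by positivity
  refine concaveOn_of_hasDerivWithinAt2_nonpos (convex_Ici 0)
    (f' := fun t => g' t * (1 / (m : ℝ)) * g t ^ (1 / (m : ℝ) - 1))
    (f'' := fun t => g'' t * (1 / (m : ℝ)) * g t ^ (1 / (m : ℝ) - 1) +
      g' t * (1 / (m : ℝ)) * (g' t * (1 / (m : ℝ) - 1) * g t ^ (1 / (m : ℝ) - 1 - 1))) ?_ ?_ ?_ ?_
  · intro t ht
    exact ((hg t).continuousAt.rpow_const (Or.inl (hpos t ht).ne')).continuousWithinAt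
  · intro t ht
    rw [interior_Ici] at ht
    exact ((hg t).rpow_const (Or.inl (hpos t (le_of_lt ht)).ne')).hasDerivWithinAt
  · intro t ht
    rw [interior_Ici] at ht
    exact (((hg' t).mul_const _).fun_mul
      ((hg t).rpow_const (Or.inl (hpos t (le_of_lt ht)).ne'))).hasDerivWithinAt
  · intro t ht
    rw [interior_Ici] at ht
    have h1 := h t ht
    have h2 := hpos t (le_of_lt ht)
    have e : g t ^ (1 / (m : ℝ) - 1) = g t ^ (1 / (m : ℝ) - 1 - 1) * g t := by
      rw [Real.rpow_sub_one h2.ne' (1 / (m : ℝ) - 1), div_mul_cancel₀ _ h2.ne']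
    have h3 : 0 < g t ^ (1 / (m : ℝ) - 1 - 1) := Real.rpow_pos_of_pos h2 _
    rw [e]
    have : g'' t * (1 / (m : ℝ)) * (g t ^ (1 / (m : ℝ) - 1 - 1) * g t) +
      g' t * (1 / (m : ℝ)) * (g' t * (1 / (m : ℝ) - 1) * g t ^ (1 / (m : ℝ) - 1 - 1)) =
      g t ^ (1 / (m : ℝ) - 1 - 1) * (1 / m ^ 2) * (m * (g t * g'' t) - (m - 1) * g' t ^ 2) := by
      field_simp
      ring
    rw [this]
    exact mul_nonpos_of_nonneg_of_nonpos (by positivity) (by linarith)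

/-- A concave function bounded below by a linear function grows at least at that rate. -/
theorem ConcaveOn.add_mul_le {f : ℝ → ℝ} (hf : ConcaveOn ℝ (Ici 0) f) {c : ℝ}
    (hc : ∀ t, 0 < t → c * t ≤ f t) {t : ℝ} (ht : 0 ≤ t) : f 0 + c * t ≤ f t := by
  rcases ht.eq_or_lt with rfl | ht
  · simp
  by_contra! hlt
  obtain ⟨T, hT⟩ := exists_gt (max t (t * f 0 / (f 0 + c * t - f t)))
  have hT1 : t < T := (le_max_left _ _).trans_lt hT
  have hT2 := (le_max_right _ _).trans_lt hT
  rw [div_lt_iff₀ (by linarith)] at hT2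
  have hT0 : 0 < T := ht.trans hT1
  have h := hf.2 (mem_Ici.2 le_rfl) (mem_Ici.2 hT0.le) (show 0 ≤ 1 - t / T by rw [sub_nonneg, div_le_one hT0]; exact hT1.le)
    (show 0 ≤ t / T by positivity) (by ring)
  simp only [smul_eq_mul, mul_zero, zero_add] at h
  rw [div_mul_cancel₀ _ hT0.ne'] at h
  have h2 : t / T * (c * T) ≤ t / T * f T := by gcongr; exact hc T hT0
  have h3 : t / T * (c * T) = c * t := by field_simp
  have h4 : (1 - t / T) * f 0 + c * t ≤ f t := by linarith
  have h5 : T * ((1 - t / T) * f 0 + c * t) = T * f 0 - t * f 0 + T * (c * t) := by field_simp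
  have h6 := mul_le_mul_of_nonneg_left h4 hT0.le
  rw [h5] at h6
  nlinarith

section
variable {E : Type*} [NormedAddCommGroup E] [InnerProductSpace ℝ E]
variable {ι : Type*} [Fintype ι]

/-- The zonotope `∑ [0, sᵢ]`. -/
def zono (s : ι → E) : ConvexBody E := ∑ i, segBody (s i)

theorem sum_smul_segBody_const (s : ι → E) (t : ℝ≥0) : ∑ i, t • segBody (s i) = t • zono s := by
  rw [zono, Finset.smul_sum]

variable [MeasurableSpace E] [BorelSpace E] [FiniteDimensional ℝ E]

theorem Represents.eval_const {s : ι → E} {K : ConvexBody E} {P : MvPolynomial ι ℝ}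
    {G : ConvexBody E → ℝ} (hP : Represents s K P G) {t : ℝ} (ht : 0 ≤ t) :
    MvPolynomial.eval (0 + t • (1 : ι → ℝ)) P = G (K + t.toNNReal • zono s) := by
  rw [← sum_smul_segBody_const, ← hP fun _ => t.toNNReal]
  congr 2
  ext i
  simp [Real.coe_toNNReal _ ht]

theorem sum_eval_pderiv_const {s : ι → E} {K : ConvexBody E} {P : MvPolynomial ι ℝ}
    (hP : Represents s K P bodyVol) {t : ℝ} (ht : 0 ≤ t) :
    ∑ i, MvPolynomial.eval (0 + t • (1 : ι → ℝ)) (MvPolynomial.pderiv i P) =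
      zper s (K + t.toNNReal • zono s) :=
  Finset.sum_congr rfl fun i _ => (hP.pderiv bodyVol_segAffine i).eval_const ht

theorem hasDerivAt_eval_const {s : ι → E} {K : ConvexBody E} {P : MvPolynomial ι ℝ}
    (hP : Represents s K P bodyVol) {t : ℝ} (ht : 0 ≤ t) :
    HasDerivAt (fun t : ℝ => MvPolynomial.eval (0 + t • (1 : ι → ℝ)) P)
      (zper s (K + t.toNNReal • zono s)) t :=
  (MvPolynomial.hasDerivAt_eval_line P 0 1 t).congr_deriv (by
    simpa using sum_eval_pderiv_const hP ht)

theorem tendsto_bodyVol_slope (s : ι → E) (K : ConvexBody E) :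
    Filter.Tendsto (fun t : ℝ => (bodyVol (K + t.toNNReal • zono s) - bodyVol K) / t)
      (nhdsWithin 0 (Ioi 0)) (nhds (zper s K)) := by
  obtain ⟨P, hP⟩ := bodyVol_segAffine.exists_represents s K
  have h := (hasDerivAt_eval_const hP le_rfl).hasDerivWithinAt (s := Ioi 0)
  rw [hasDerivWithinAt_iff_tendsto_slope' (by simp)] at h
  simp only [Real.toNNReal_zero, zero_smul, add_zero] at h
  refine h.congr' ?_
  filter_upwards [self_mem_nhdsWithin] with t ht
  have h0 := hP.eval_const le_rfl
  simp only [Real.toNNReal_zero, zero_smul, add_zero] at h0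
  rw [slope_def_field, hP.eval_const (le_of_lt ht), sub_zero]
  simp only [zero_smul, add_zero]
  rw [h0]

theorem zper_pointBody_add_smul {m : ℕ} (hn : Module.finrank ℝ E = m + 1) (s : ι → E) (x : E)
    {t : ℝ} (ht : 0 < t) :
    zper s (pointBody x + t.toNNReal • zono s) = (m + 1) * t ^ m * bodyVol (zono s) := by
  obtain ⟨P, hP⟩ := bodyVol_segAffine.exists_represents s (pointBody x)
  have h1 := hasDerivAt_eval_const hP ht.le
  have h2 : HasDerivAt (fun t : ℝ => t ^ (m + 1) * bodyVol (zono s))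
      ((m + 1) * t ^ m * bodyVol (zono s)) t := by
    simpa using (hasDerivAt_pow (m + 1) t).mul_const (bodyVol (zono s))
  refine h1.unique (h2.congr_of_eventuallyEq ?_)
  filter_upwards [Ioi_mem_nhds ht] with u hu
  rw [hP.eval_const (le_of_lt hu), bodyVol_pointBody_add, bodyVol_smul, hn,
    Real.coe_toNNReal _ (le_of_lt hu)]

/-- The Brunn–Minkowski type inequality for `zper`. -/
theorem zper_root_add_le {m : ℕ} (hm : m ≠ 0) (hn : Module.finrank ℝ E = m + 1) {s : ι → E}
    (hs0 : ∀ i, s i ≠ 0) (hs : Submodule.span ℝ (range s) = ⊤) {K : ConvexBody E}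
    (hK : (interior (K : Set E)).Nonempty) {t : ℝ} (ht : 0 ≤ t) :
    zper s K ^ (1 / (m : ℝ)) + ((m + 1) * bodyVol (zono s)) ^ (1 / (m : ℝ)) * t ≤
      zper s (K + t.toNNReal • zono s) ^ (1 / (m : ℝ)) := by
  obtain ⟨P, hP⟩ := bodyVol_segAffine.exists_represents s K
  obtain ⟨x, hx⟩ := hK.mono interior_subset
  have hι : Nonempty ι := by
    by_contra h
    rw [not_nonempty_iff] at h
    rw [range_eq_empty, Submodule.span_empty] at hs
    have := finrank_bot ℝ E
    rw [hs, finrank_top] at this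
    omega
  have hpos : ∀ t : ℝ, 0 ≤ t →
      0 < ∑ i, MvPolynomial.eval (0 + t • (1 : ι → ℝ)) (MvPolynomial.pderiv i P) := fun t ht => by
    rw [sum_eval_pderiv_const hP ht]
    have h0 : (0 : E) ∈ ((t.toNNReal • zono s : ConvexBody E) : Set E) := by
      rw [← sum_smul_segBody_const, coe_sum_smul_segBody, mem_parallelepiped_iff]
      exact ⟨0, by simp, by simp⟩
    exact Finset.sum_pos (fun i _ => incr_pos
      (hK.mono (interior_mono (ConvexBody.le_add_of_zero_mem h0))) (hs0 i)) Finset.univ_nonempty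
  have hd1 : ∀ t : ℝ, HasDerivAt
      (fun t : ℝ => ∑ i, MvPolynomial.eval (0 + t • (1 : ι → ℝ)) (MvPolynomial.pderiv i P))
      (∑ i, ∑ j, MvPolynomial.eval (0 + t • (1 : ι → ℝ))
        (MvPolynomial.pderiv j (MvPolynomial.pderiv i P))) t := fun t => by
    refine HasDerivAt.fun_sum fun i _ => ?_
    simpa using MvPolynomial.hasDerivAt_eval_line (MvPolynomial.pderiv i P) 0 1 t
  have hd2 : ∀ t : ℝ, HasDerivAt
      (fun t : ℝ => ∑ i, ∑ j, MvPolynomial.eval (0 + t • (1 : ι → ℝ))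
        (MvPolynomial.pderiv j (MvPolynomial.pderiv i P)))
      (∑ i, ∑ j, ∑ k, MvPolynomial.eval (0 + t • (1 : ι → ℝ))
        (MvPolynomial.pderiv k (MvPolynomial.pderiv j (MvPolynomial.pderiv i P)))) t := fun t => by
    refine HasDerivAt.fun_sum fun i _ => HasDerivAt.fun_sum fun j _ => ?_
    simpa using MvPolynomial.hasDerivAt_eval_line
      (MvPolynomial.pderiv j (MvPolynomial.pderiv i P)) 0 1 t
  have hconc := concaveOn_root hm hd1 hd2 hpos fun t ht =>
    zper_second_order hm hn hs0 hs hK hP (fun i => by simpa using ht)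
  have hm' : (0 : ℝ) < m := by positivity
  have := hconc.add_mul_le (c := ((m + 1) * bodyVol (zono s)) ^ (1 / (m : ℝ))) (fun t ht => ?_) ht
  · rw [sum_eval_pderiv_const hP ht, sum_eval_pderiv_const hP le_rfl] at this
    simpa using this
  · have hvol : 0 ≤ bodyVol (zono s) := measureReal_nonneg
    have e : t = (t ^ m) ^ (1 / (m : ℝ)) := by
      rw [← Real.rpow_natCast, ← Real.rpow_mul ht.le, mul_one_div_cancel hm'.ne', Real.rpow_one]
    nth_rw 1 [e]
    rw [sum_eval_pderiv_const hP ht.le, ← Real.mul_rpow (by positivity) (by positivity)]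
    refine Real.rpow_le_rpow (by positivity) ?_ (by positivity)
    have h1 := zper_pointBody_add_smul hn s x ht
    have h2 := zper_mono s (ConvexBody.add_mono (show pointBody x ≤ K from by
      rw [← SetLike.coe_subset_coe]; exact singleton_subset_iff.2 hx)
      (le_refl (t.toNNReal • zono s)))
    linarith
end

section
variable {E : Type*} [NormedAddCommGroup E] [InnerProductSpace ℝ E]
variable {ι : Type*} [Fintype ι]

theorem mem_zono {s : ι → E} {x : E} :
    x ∈ (zono s : Set E) ↔ ∃ t ∈ Icc (0 : ι → ℝ) 1, x = ∑ i, t i • s i := by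
  have h := coe_sum_smul_segBody (fun _ : ι => 1) s
  simp only [one_smul, NNReal.coe_one] at h
  rw [zono, h, mem_parallelepiped_iff]

theorem zono_subset_closedBall {s : ι → E} {r : ℝ} (hr : 0 ≤ r)
    (h : ∀ x : E, ∑ i, max 0 (inner ℝ (s i) x) ≤ r * ‖x‖) : (zono s : Set E) ⊆ closedBall 0 r := by
  intro z hz
  obtain ⟨t, ht, htz⟩ := mem_zono.1 hz
  have h1 : ‖z‖ ^ 2 ≤ ∑ i, max 0 (inner ℝ (s i) z) := by
    rw [← real_inner_self_eq_norm_sq]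
    nth_rw 1 [htz]
    rw [sum_inner]
    refine Finset.sum_le_sum fun i _ => ?_
    rw [real_inner_smul_left]
    have h0 := ht.1 i
    have h1 := ht.2 i
    simp only [Pi.zero_apply, Pi.one_apply] at h0 h1
    exact (mul_le_mul_of_nonneg_left (le_max_right 0 _) h0).trans
      (mul_le_of_le_one_left (le_max_left _ _) h1)
  have h2 := h1.trans (h z)
  rw [mem_closedBall_zero_iff]
  rcases (norm_nonneg z).eq_or_lt with h0 | h0
  · exact h0 ▸ hr
  · nlinarith

theorem closedBall_subset_zono [CompleteSpace E] {s : ι → E} {r : ℝ}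
    (h : ∀ x : E, r * ‖x‖ ≤ ∑ i, max 0 (inner ℝ (s i) x)) :
    closedBall 0 r ⊆ (zono s : Set E) := by
  classical
  intro y hy
  by_contra hyz
  obtain ⟨f, u, hf, hu⟩ := geometric_hahn_banach_closed_point (zono s).convex
    (zono s).isCompact.isClosed hyz
  obtain ⟨x, rfl⟩ := (InnerProductSpace.toDual ℝ E).surjective f
  simp only [InnerProductSpace.toDual_apply_apply] at hf hu
  have h1 := hf (∑ i, (if 0 ≤ inner ℝ (s i) x then (1 : ℝ) else 0) • s i)
    (mem_zono.2 ⟨fun i => if 0 ≤ inner ℝ (s i) x then (1 : ℝ) else 0,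
      ⟨fun i => by simp only [Pi.zero_apply]; split_ifs <;> norm_num,
        fun i => by simp only [Pi.one_apply]; split_ifs <;> norm_num⟩, rfl⟩)
  rw [inner_sum] at h1
  have h2 : ∀ i, inner ℝ x ((if 0 ≤ inner ℝ (s i) x then (1 : ℝ) else 0) • s i) =
      max 0 (inner ℝ (s i) x) := fun i => by
    rw [real_inner_smul_right, real_inner_comm]
    split_ifs with h
    · rw [one_mul, max_eq_right h]
    · rw [zero_mul, max_eq_left (not_le.1 h).le]
  simp only [h2] at h1
  have h3 := real_inner_le_norm x y
  rw [mem_closedBall_zero_iff] at hy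
  have h4 := h x
  have h5 := mul_le_mul_of_nonneg_left hy (norm_nonneg x)
  linarith

variable [MeasurableSpace E] [BorelSpace E] [FiniteDimensional ℝ E]

theorem exists_integral_pos_part_inner [Nontrivial E] : ∃ κ : ℝ, 0 < κ ∧ ∀ x ∈ sphere (0 : E) 1,
    ∫ u in closedBall (0 : E) 1, max 0 (inner ℝ u x) = κ := by
  obtain ⟨x₀, hx₀⟩ := exists_norm_eq E zero_le_one
  have hint : ∀ x : E, IntegrableOn (fun u : E => max 0 (inner ℝ u x)) (closedBall 0 1) := fun x =>
    Continuous.continuousOn (by fun_prop) |>.integrableOn_compact (isCompact_closedBall 0 1)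
  refine ⟨∫ u in closedBall (0 : E) 1, max 0 (inner ℝ u x₀), ?_, fun x hx => ?_⟩
  · refine (setIntegral_pos_iff_support_of_nonneg_ae (f := fun u : E => max 0 (inner ℝ u x₀))
      (ae_of_all _ fun u => le_max_left _ _) (hint x₀)).2 ?_
    have ho : IsOpen (ball (0 : E) 1 ∩ {u | 0 < inner ℝ u x₀}) :=
      isOpen_ball.inter (isOpen_lt continuous_const (by fun_prop))
    refine (ho.measure_pos volume ⟨(1 / 2 : ℝ) • x₀, ?_, ?_⟩).trans_le (measure_mono ?_)
    · rw [mem_ball_zero_iff, norm_smul, hx₀]; norm_num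
    · rw [mem_ofPred_eq, real_inner_smul_left, real_inner_self_eq_norm_sq, hx₀]; norm_num
    · rintro u ⟨hu, hu'⟩
      refine ⟨?_, ball_subset_closedBall hu⟩
      rw [Function.mem_support, max_eq_right (le_of_lt hu')]
      exact (ne_of_gt hu')
  · rw [mem_sphere_zero_iff_norm] at hx
    set L := (ℝ ∙ (x - x₀))ᗮ.reflection with hL
    have hLx : L x = x₀ := Submodule.reflection_sub (hx.trans hx₀.symm)
    have h := L.measurePreserving.setIntegral_preimage_emb
      L.toHomeomorph.measurableEmbedding (fun u => max 0 (inner ℝ u x₀)) (closedBall 0 1)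
    rw [← h]
    have h2 : L ⁻¹' closedBall 0 1 = closedBall 0 1 := by
      rw [LinearIsometryEquiv.preimage_closedBall]; simp
    rw [h2]
    refine setIntegral_congr_fun measurableSet_closedBall fun u _ => ?_
    rw [← hLx, L.inner_map_map]

theorem exists_zono_approx [Nontrivial E] {ε : ℝ} (hε : 0 < ε) :
    ∃ (ι : Type) (_ : Fintype ι) (s : ι → E), (∀ i, s i ≠ 0) ∧
      Submodule.span ℝ (range s) = ⊤ ∧ closedBall 0 (1 - ε) ⊆ (zono s : Set E) ∧
      (zono s : Set E) ⊆ closedBall 0 1 := by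
  classical
  wlog hε1 : ε < 1 generalizing ε
  · obtain ⟨ι, h, s, h1, h2, h3, h4⟩ := this (ε := 1 / 2) (by norm_num) (by norm_num)
    exact ⟨ι, h, s, h1, h2, (closedBall_subset_closedBall (by linarith)).trans h3, h4⟩
  obtain ⟨κ, hκ, hκS⟩ := exists_integral_pos_part_inner (E := E)
  let f : C(E, C(sphere (0 : E) 1, ℝ)) :=
    ContinuousMap.curry ⟨fun q => max 0 (inner ℝ q.1 (q.2 : E)), by fun_prop⟩
  have hf : ∀ u x, f u x = max 0 (inner ℝ u (x : E)) := fun u x => rfl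
  set V : ℝ := volume.real (closedBall (0 : E) 1) with hV
  have hV0 : 0 < V := ENNReal.toReal_pos (measure_closedBall_pos _ _ one_pos).ne'
    measure_closedBall_lt_top.ne
  have hint : IntegrableOn f (closedBall 0 1) :=
    f.continuous.continuousOn.integrableOn_compact (isCompact_closedBall 0 1)
  have hmem := (convex_convexHull ℝ (range f)).set_average_mem_closure (μ := volume)
    (t := closedBall 0 1) (measure_closedBall_pos _ _ one_pos).ne' measure_closedBall_lt_top.ne
    (ae_of_all _ fun u => subset_convexHull ℝ _ (mem_range_self u)) hint
  set δ : ℝ := κ / V * ε / 2 with hδ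
  have hδ0 : 0 < δ := by positivity
  obtain ⟨g, hg, hga⟩ := Metric.mem_closure_iff.1 hmem δ hδ0
  obtain ⟨ι, _, w, z, hw, -, hz, rfl⟩ := mem_convexHull_iff_exists_fintype.1 hg
  choose u hu using hz
  have havg : ∀ x, (⨍ u in closedBall (0 : E) 1, f u ∂volume) x = κ / V := fun x => by
    rw [setAverage_eq, ContinuousMap.smul_apply, ContinuousMap.integral_apply hint]
    simp only [hf]
    rw [hκS x x.2, smul_eq_mul, div_eq_inv_mul]
  have hgx : ∀ x ∈ sphere (0 : E) 1, |κ / V - ∑ i, w i * max 0 (inner ℝ (u i) x)| < δ := by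
    intro x hx
    have := (ContinuousMap.dist_apply_le_dist (⟨x, hx⟩ : sphere (0 : E) 1)).trans_lt hga
    rw [havg, Real.dist_eq] at this
    simpa [ContinuousMap.sum_apply, ← hu, hf] using this
  set c : ℝ := (κ / V + δ)⁻¹ with hc
  have hκV : 0 < κ / V := by positivity
  have hc0 : 0 < c := by positivity
  have hs : ∀ x : E, (1 - ε) * ‖x‖ ≤ ∑ i, max 0 (inner ℝ ((c * w i) • u i) x) ∧
      ∑ i, max 0 (inner ℝ ((c * w i) • u i) x) ≤ 1 * ‖x‖ := fun x => by
    rcases eq_or_ne x 0 with rfl | hx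
    · simp
    have hx0 := norm_pos_iff.2 hx
    have h1 := abs_lt.1 (hgx (‖x‖⁻¹ • x) (by
      rw [mem_sphere_zero_iff_norm, norm_smul, norm_inv, norm_norm, inv_mul_cancel₀ hx0.ne']))
    have h2 : ∑ i, max 0 (inner ℝ ((c * w i) • u i) x) =
        c * ‖x‖ * ∑ i, w i * max 0 (inner ℝ (u i) (‖x‖⁻¹ • x)) := by
      rw [Finset.mul_sum]
      refine Finset.sum_congr rfl fun i _ => ?_
      rw [real_inner_smul_left, real_inner_smul_right, ← mul_assoc,
        mul_max_of_nonneg _ _ (by have := hw i; positivity)]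
      congr 1
      · simp
      · field_simp
    rw [h2]
    have h3 : c * (κ / V + δ) = 1 := inv_mul_cancel₀ (by positivity)
    have h4 : (1 - ε) * (κ / V + δ) ≤ κ / V - δ := by rw [hδ]; nlinarith
    constructor
    · have : (1 - ε) ≤ c * ∑ i, w i * max 0 (inner ℝ (u i) (‖x‖⁻¹ • x)) := by
        nlinarith
      nlinarith
    · have : c * ∑ i, w i * max 0 (inner ℝ (u i) (‖x‖⁻¹ • x)) ≤ 1 := by nlinarith
      nlinarith
  have hdrop : ∀ x : E, ∑ i : {i // (c * w i) • u i ≠ 0}, max 0 (inner ℝ ((c * w i.1) • u i.1) x) =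
      ∑ i, max 0 (inner ℝ ((c * w i) • u i) x) := fun x => by
    rw [← Finset.sum_subtype (Finset.univ.filter fun i => (c * w i) • u i ≠ 0) (by simp)
      (fun i => max 0 (inner ℝ ((c * w i) • u i) x))]
    refine Finset.sum_filter_of_ne fun i _ hi hi0 => hi ?_
    rw [hi0, inner_zero_left, max_self]
  have hsub : closedBall 0 (1 - ε) ⊆
      (zono (fun i : {i // (c * w i) • u i ≠ 0} => (c * w i.1) • u i.1) : Set E) :=
    closedBall_subset_zono fun x => by rw [hdrop]; exact (hs x).1
  refine ⟨{i // (c * w i) • u i ≠ 0}, inferInstance, fun i => (c * w i.1) • u i.1,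
    fun i => i.2, ?_, hsub, ?_⟩
  · rw [eq_top_iff]
    intro x _
    rcases eq_or_ne x 0 with rfl | hx
    · exact Submodule.zero_mem _
    have hx0 := norm_pos_iff.2 hx
    have h1 : ((1 - ε) * ‖x‖⁻¹) • x ∈ closedBall (0 : E) (1 - ε) := by
      rw [mem_closedBall_zero_iff, norm_smul, norm_mul, norm_inv, norm_norm, mul_assoc,
        inv_mul_cancel₀ hx0.ne', Real.norm_of_nonneg (by linarith), mul_one]
    obtain ⟨t, -, ht⟩ := mem_zono.1 (hsub h1)
    rw [← Submodule.smul_mem_iff _ (show (1 - ε) * ‖x‖⁻¹ ≠ 0 by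
      have : 0 < 1 - ε := by linarith
      positivity), ht]
    exact Submodule.sum_mem _ fun i _ => Submodule.smul_mem _ _
      (Submodule.subset_span (mem_range_self i))
  · exact zono_subset_closedBall zero_le_one fun x => by rw [hdrop]; exact (hs x).2
end

section
variable {E : Type*} [NormedAddCommGroup E] [InnerProductSpace ℝ E]

/-- The part, at heights in `I` above the hyperplane `⟪a, x⟫ = c`, of the orthogonal cylinder
over `F`. -/
def prism (a : E) (c : ℝ) (F : Set E) (I : Set ℝ) : Set E :=
  {y | y - (inner ℝ a y - c) • a ∈ F ∧ inner ℝ a y - c ∈ I}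

theorem prism_mono {a : E} {c : ℝ} {F : Set E} {I J : Set ℝ} (h : I ⊆ J) :
    prism a c F I ⊆ prism a c F J := fun _ hy => ⟨hy.1, h hy.2⟩

variable [MeasurableSpace E] [BorelSpace E] [FiniteDimensional ℝ E]

theorem measurableSet_prism {a : E} {c : ℝ} {F : Set E} {I : Set ℝ} (hF : MeasurableSet F)
    (hI : MeasurableSet I) : MeasurableSet (prism a c F I) :=
  (hF.preimage (Continuous.measurable (by fun_prop))).inter
    (hI.preimage (Continuous.measurable (by fun_prop)))

theorem volume_prism {m : ℕ} (hn : Module.finrank ℝ E = m + 1) {a : E} (ha : ‖a‖ = 1) {c : ℝ}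
    {F : Set E} (hF : MeasurableSet F) (hFc : ∀ x ∈ F, inner ℝ a x = c) {I : Set ℝ}
    (hI : MeasurableSet I) :
    volume (prism a c F I) = volume I * μHE[m] F := by
  have ha0 : a ≠ 0 := by rintro rfl; simp at ha
  have haa : inner ℝ a a = (1 : ℝ) := by rw [real_inner_self_eq_norm_sq, ha, one_pow]
  rw [← InnerProductSpace.euclideanHausdorffMeasure_eq_volume,
    EuclideanGeometry.euclideanHausdorffMeasure_eq_lintegral (c • a) ha0
      (measurableSet_prism hF hI)]
  have hsl : ∀ t : ℝ, μHE[Module.finrank ℝ E - 1]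
      (prism a c F I ∩ AffineSubspace.mk' (t • a +ᵥ c • a) (ℝ ∙ a)ᗮ) =
      I.indicator (fun _ => μHE[m] F) t := fun t => by
    have hmem : ∀ y : E, y ∈ AffineSubspace.mk' (t • a +ᵥ c • a) (ℝ ∙ a)ᗮ ↔
        inner ℝ a y - c = t := fun y => by
      rw [AffineSubspace.mem_mk', Submodule.mem_orthogonal_singleton_iff_inner_right,
        vsub_eq_sub, vadd_eq_add, inner_sub_right, inner_add_right, real_inner_smul_right,
        real_inner_smul_right, haa]
      constructor <;> intro h <;> linarith
    rw [hn, Nat.add_sub_cancel]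
    by_cases ht : t ∈ I
    · rw [indicator_of_mem ht]
      have : prism a c F I ∩ AffineSubspace.mk' (t • a +ᵥ c • a) (ℝ ∙ a)ᗮ =
          IsometryEquiv.addRight (t • a) '' F := by
        ext y
        simp only [mem_inter_iff, SetLike.mem_coe, hmem, mem_image, IsometryEquiv.addRight_apply]
        constructor
        · rintro ⟨⟨h1, -⟩, h2⟩
          rw [h2] at h1
          exact ⟨_, h1, by abel⟩
        · rintro ⟨x, hx, rfl⟩
          have : inner ℝ a (x + t • a) - c = t := by
            rw [inner_add_right, hFc x hx, real_inner_smul_right, haa]; ring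
          refine ⟨⟨?_, ?_⟩, this⟩
          · rw [this, add_sub_cancel_right]; exact hx
          · rw [this]; exact ht
      rw [this, (IsometryEquiv.addRight (t • a)).isometry.euclideanHausdorffMeasure_image]
    · rw [indicator_of_notMem ht]
      have : prism a c F I ∩ AffineSubspace.mk' (t • a +ᵥ c • a) (ℝ ∙ a)ᗮ = ∅ := by
        rw [← disjoint_iff_inter_eq_empty, Set.disjoint_left]
        rintro y ⟨-, h1⟩ h2
        rw [SetLike.mem_coe, hmem] at h2
        exact ht (h2 ▸ h1)
      rw [this, measure_empty]
  simp only [hsl]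
  rw [lintegral_indicator hI, setLIntegral_const, ← ofReal_norm, ha, ENNReal.ofReal_one, one_mul,
    mul_comm]

theorem LipschitzOnWith.euclideanHausdorffMeasure_image_le {f : E → E} {s : Set E} {m : ℕ}
    (hf : LipschitzOnWith 1 f s) : μHE[m] (f '' s) ≤ μHE[m] s := by
  have h := hf.hausdorffMeasure_image_le (d := m) (Nat.cast_nonneg m)
  rw [ENNReal.coe_one, ENNReal.one_rpow, one_mul] at h
  rw [Measure.euclideanHausdorffMeasure_def, Measure.smul_apply, Measure.smul_apply]
  gcongr

/-- The ratio between the Euclidean and Mathlib normalisations of the Hausdorff measure. -/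
def hausdorffFactor (m : ℕ) : ℝ≥0 :=
  Measure.addHaarScalarFactor (volume : Measure (EuclideanSpace ℝ (Fin m))) μH[m]

theorem euclideanHausdorffMeasure_apply (m : ℕ) (s : Set E) :
    μHE[m] s = hausdorffFactor m * μH[m] s := by
  rw [Measure.euclideanHausdorffMeasure_def, Measure.smul_apply, hausdorffFactor]
  rfl

theorem hausdorffFactor_pos (m : ℕ) : 0 < hausdorffFactor m :=
  pos_iff_ne_zero.2 (Measure.addHaarScalarFactor_volume_hausdorffMeasure_ne_zero m)

theorem hausdorffFactor_le_one (m : ℕ) : hausdorffFactor m ≤ 1 := by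
  set Q : Set (EuclideanSpace ℝ (Fin m)) := WithLp.ofLp ⁻¹' Icc 0 1 with hQ
  have h1 : volume Q = 1 := by
    rw [hQ, (PiLp.volume_preserving_ofLp (Fin m)).measure_preimage
      measurableSet_Icc.nullMeasurableSet, Real.volume_Icc_pi]
    simp
  have h2 : (1 : ℝ≥0∞) ≤ μH[m] Q := by
    have h := (PiLp.lipschitzWith_ofLp 2 (fun _ : Fin m => ℝ)).lipschitzOnWith (s := Q)
      |>.hausdorffMeasure_image_le (d := m) (Nat.cast_nonneg m)
    rw [ENNReal.coe_one, ENNReal.one_rpow, one_mul] at h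
    refine le_trans ?_ h
    have h3 : WithLp.ofLp '' Q = (Icc 0 1 : Set (Fin m → ℝ)) :=
      image_preimage_eq _ (WithLp.ofLp_surjective 2)
    have h4 := MeasureTheory.hausdorffMeasure_pi_real (ι := Fin m)
    rw [Fintype.card_fin] at h4
    rw [h3, h4, Real.volume_Icc_pi]
    simp
  have h3 := euclideanHausdorffMeasure_apply m Q
  rw [EuclideanSpace.euclideanHausdorffMeasure_eq_volume, h1] at h3
  have : (hausdorffFactor m : ℝ≥0∞) ≤ 1 := by
    calc (hausdorffFactor m : ℝ≥0∞) = hausdorffFactor m * 1 := (mul_one _).symm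
      _ ≤ hausdorffFactor m * μH[m] Q := by gcongr
      _ = 1 := h3.symm
  exact_mod_cast this
end

section
variable {E : Type*} [NormedAddCommGroup E] [InnerProductSpace ℝ E]

theorem subset_interior_of_disjoint_frontier {X : Type*} [TopologicalSpace X] {C s : Set X}
    (hc : IsPreconnected C) (hd : Disjoint C (frontier s)) (hne : (C ∩ s).Nonempty) :
    C ⊆ interior s := by
  have hI : ∀ x ∈ C, x ∈ closure s → x ∈ interior s := fun x hx hxs => by
    by_contra h
    exact Set.disjoint_left.1 hd hx ⟨hxs, h⟩
  refine hc.subset_left_of_subset_union isOpen_interior isClosed_closure.isOpen_compl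
    (disjoint_compl_right.mono_left (interior_subset.trans subset_closure)) (fun x hx => ?_) ?_
  · by_cases h : x ∈ closure s
    · exact Or.inl (hI x hx h)
    · exact Or.inr h
  · obtain ⟨x, hx, hxs⟩ := hne
    exact ⟨x, hx, hI x hx (subset_closure hxs)⟩

theorem exists_ray_mem_frontier {s : Set E} (hs : IsBounded s) {x a : E} (hx : x ∈ s)
    (ha : a ≠ 0) : ∃ t : ℝ, 0 ≤ t ∧ x + t • a ∈ frontier s := by
  by_contra! H
  obtain ⟨r, hr⟩ := hs.subset_closedBall x
  have hc : IsPreconnected ((fun t : ℝ => x + t • a) '' Ici 0) :=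
    isPreconnected_Ici.image _ (by fun_prop)
  have h0 : x ∈ (fun t : ℝ => x + t • a) '' Ici 0 := ⟨0, self_mem_Ici, by simp⟩
  have hd : Disjoint ((fun t : ℝ => x + t • a) '' Ici 0) (frontier s) := by
    rw [Set.disjoint_left]
    rintro _ ⟨t, ht, rfl⟩
    exact H t ht
  have hsub := subset_interior_of_disjoint_frontier hc hd ⟨x, h0, hx⟩
  have ha' := norm_pos_iff.2 ha
  have h1 := hr (interior_subset <| hsub ⟨(|r| + 1) / ‖a‖, by rw [mem_Ici]; positivity, rfl⟩)
  rw [mem_closedBall, dist_eq_norm, add_sub_cancel_left, norm_smul, Real.norm_of_nonneg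
    (by positivity), div_mul_cancel₀ _ ha'.ne'] at h1
  linarith [le_abs_self r]

theorem exists_pos_ray_mem_frontier {s : Set E} (ho : IsOpen s) (hs : IsBounded s) {x a : E}
    (hx : x ∈ s) (ha : a ≠ 0) : ∃ t : ℝ, 0 < t ∧ x + t • a ∈ frontier s := by
  obtain ⟨t, ht, htf⟩ := exists_ray_mem_frontier hs hx ha
  refine ⟨t, ht.lt_of_ne ?_, htf⟩
  rintro rfl
  rw [zero_smul, add_zero, ho.frontier_eq] at htf
  exact htf.2 hx

/-- The polyhedron with outer normals `A` and support numbers `h`. -/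
def poly (A : Finset E) (h : E → ℝ) : Set E := {x | ∀ a ∈ A, inner ℝ a x ≤ h a}

/-- The face of `poly A h` with outer normal `a`. -/
def facet (A : Finset E) (h : E → ℝ) (a : E) : Set E := {x ∈ poly A h | inner ℝ a x = h a}

theorem mem_poly {A : Finset E} {h : E → ℝ} {x : E} :
    x ∈ poly A h ↔ ∀ a ∈ A, inner ℝ a x ≤ h a := Iff.rfl

theorem isClosed_poly (A : Finset E) (h : E → ℝ) : IsClosed (poly A h) := by
  have : poly A h = ⋂ a ∈ A, {x | inner ℝ a x ≤ h a} := by ext; simp [poly]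
  rw [this]
  exact isClosed_biInter fun a _ => isClosed_le (by fun_prop) continuous_const

theorem convex_poly (A : Finset E) (h : E → ℝ) : Convex ℝ (poly A h) := by
  intro x hx y hy s t hs ht hst a ha
  rw [inner_add_right, real_inner_smul_right, real_inner_smul_right]
  have h1 := mul_le_mul_of_nonneg_left (hx a ha) hs
  have h2 := mul_le_mul_of_nonneg_left (hy a ha) ht
  have h3 : s * h a + t * h a = h a := by rw [← add_mul, hst, one_mul]
  linarith

theorem isClosed_facet (A : Finset E) (h : E → ℝ) (a : E) : IsClosed (facet A h a) :=
  (isClosed_poly A h).inter (isClosed_eq (by fun_prop) continuous_const)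

theorem poly_mono {A : Finset E} {h k : E → ℝ} (hk : ∀ a ∈ A, h a ≤ k a) :
    poly A h ⊆ poly A k := fun _ hx a ha => (hx a ha).trans (hk a ha)

theorem poly_sdiff_subset {A : Finset E} (hA : ∀ a ∈ A, ‖a‖ = 1) (h : E → ℝ) (δ : ℝ) :
    poly A h \ poly A (fun a => h a - δ) ⊆ ⋃ a ∈ A, prism a (h a) (facet A h a) (Icc (-δ) 0) := by
  rintro x ⟨hx, hxδ⟩
  rw [mem_poly] at hxδ
  push Not at hxδ
  obtain ⟨b, hb, hbx⟩ := hxδ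
  obtain ⟨a, ha, hmin⟩ := A.exists_min_image (fun a => h a - inner ℝ a x) ⟨b, hb⟩
  have h1 := hmin b hb
  have hax := hx a ha
  refine mem_biUnion ha ⟨⟨fun c hc => ?_, ?_⟩, ?_, ?_⟩
  · have h2 := hmin c hc
    have h3 := real_inner_le_norm c a
    rw [hA c hc, hA a ha, one_mul] at h3
    rw [inner_sub_right, real_inner_smul_right]
    nlinarith
  · rw [inner_sub_right, real_inner_smul_right, real_inner_self_eq_norm_sq, hA a ha]
    ring
  · linarith
  · linarith

theorem disjoint_prism_poly {A : Finset E} (h : E → ℝ) {a : E} (ha : a ∈ A) :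
    Disjoint (prism a (h a) (facet A h a) (Ioi 0)) (poly A h) := by
  rw [Set.disjoint_left]
  rintro y ⟨-, hy⟩ hyP
  have := hyP a ha
  rw [mem_Ioi] at hy
  linarith

theorem pairwiseDisjoint_prism {A : Finset E} (hA : ∀ a ∈ A, ‖a‖ = 1) (h : E → ℝ) :
    (A : Set E).PairwiseDisjoint fun a => prism a (h a) (facet A h a) (Ioi 0) := by
  intro a ha b hb hab
  rw [Function.onFun, Set.disjoint_left]
  rintro y ⟨hya, hta⟩ ⟨hyb, htb⟩
  refine hab ?_
  rw [mem_Ioi] at hta htb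
  set t := inner ℝ a y - h a
  set s := inner ℝ b y - h b
  have h1 : inner ℝ a (y - s • b) ≤ inner ℝ a (y - t • a) := (hyb.1 a ha).trans hya.2.ge
  have h2 : inner ℝ b (y - t • a) ≤ inner ℝ b (y - s • b) := (hya.1 b hb).trans hyb.2.ge
  have h3 : inner ℝ (s • b - t • a) (s • b - t • a) ≤ (0 : ℝ) := by
    have e1 : s • b - t • a = (y - t • a) - (y - s • b) := by abel
    nth_rw 2 [e1]
    rw [inner_sub_left, real_inner_smul_left, real_inner_smul_left, inner_sub_right b,
      inner_sub_right a]
    have h4 := mul_nonneg hta.le (sub_nonneg.2 h1)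
    have h5 := mul_nonneg htb.le (sub_nonneg.2 h2)
    linarith
  have h4 : s • b = t • a := by
    rw [real_inner_self_eq_norm_sq] at h3
    exact sub_eq_zero.1 (norm_eq_zero.1 (pow_eq_zero_iff two_ne_zero |>.1
      (le_antisymm h3 (sq_nonneg _))))
  have h5 : s = t := by
    have := congrArg norm h4
    rwa [norm_smul, norm_smul, hA a ha, hA b hb, mul_one, mul_one, Real.norm_of_nonneg hta.le,
      Real.norm_of_nonneg htb.le] at this
  rw [h5] at h4
  exact (smul_right_injective E hta.ne' h4).symm

variable [MeasurableSpace E]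

/-- The total `m`-dimensional measure of the facets of `poly A h`. -/
def facetSum [BorelSpace E] (m : ℕ) (A : Finset E) (h : E → ℝ) : ℝ≥0∞ :=
  ∑ a ∈ A, μHE[m] (facet A h a)

variable [BorelSpace E] [FiniteDimensional ℝ E]

theorem volume_prism_facet {m : ℕ} (hn : Module.finrank ℝ E = m + 1) {A : Finset E}
    (hA : ∀ a ∈ A, ‖a‖ = 1) (h : E → ℝ) {a : E} (ha : a ∈ A) {I : Set ℝ} (hI : MeasurableSet I) :
    volume (prism a (h a) (facet A h a) I) = volume I * μHE[m] (facet A h a) :=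
  volume_prism hn (hA a ha) (isClosed_facet A h a).measurableSet (fun _ hx => hx.2) hI

theorem volume_poly_sdiff_le {m : ℕ} (hn : Module.finrank ℝ E = m + 1) {A : Finset E}
    (hA : ∀ a ∈ A, ‖a‖ = 1) (h : E → ℝ) (δ : ℝ) :
    volume (poly A h \ poly A (fun a => h a - δ)) ≤ ENNReal.ofReal δ * facetSum m A h := by
  refine (measure_mono (poly_sdiff_subset hA h δ)).trans ((measure_biUnion_finset_le _ _).trans ?_)
  rw [facetSum, Finset.mul_sum]
  refine Finset.sum_le_sum fun a ha => ?_
  rw [volume_prism_facet hn hA h ha measurableSet_Icc, Real.volume_Icc, zero_sub, neg_neg]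

theorem volume_poly_add_le {m : ℕ} (hn : Module.finrank ℝ E = m + 1) {A : Finset E}
    (hA : ∀ a ∈ A, ‖a‖ = 1) (h : E → ℝ) {δ : ℝ} (hδ : 0 ≤ δ) :
    volume (poly A h) + ENNReal.ofReal δ * facetSum m A h ≤
      volume (poly A h + closedBall 0 δ) := by
  have hm : ∀ a ∈ A, MeasurableSet (prism a (h a) (facet A h a) (Ioc 0 δ)) := fun a _ =>
    measurableSet_prism (isClosed_facet A h a).measurableSet measurableSet_Ioc
  have h1 : ENNReal.ofReal δ * facetSum m A h =
      volume (⋃ a ∈ A, prism a (h a) (facet A h a) (Ioc 0 δ)) := by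
    rw [measure_biUnion_finset ((pairwiseDisjoint_prism hA h).mono_on
      fun a _ => prism_mono Ioc_subset_Ioi_self) hm, facetSum, Finset.mul_sum]
    refine Finset.sum_congr rfl fun a ha => ?_
    rw [volume_prism_facet hn hA h ha measurableSet_Ioc, Real.volume_Ioc, sub_zero]
  rw [h1, ← measure_union _ (Finset.measurableSet_biUnion _ hm)]
  · refine measure_mono (union_subset (fun x hx => ?_) (iUnion₂_subset fun a ha y hy => ?_))
    · exact ⟨x, hx, 0, mem_closedBall_self hδ, add_zero x⟩
    · refine ⟨_, hy.1.1, (inner ℝ a y - h a) • a, ?_, sub_add_cancel _ _⟩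
      rw [mem_closedBall_zero_iff, norm_smul, hA a ha, mul_one, Real.norm_of_nonneg hy.2.1.le]
      exact hy.2.2
  · rw [Set.disjoint_iUnion₂_right]
    exact fun a ha => ((disjoint_prism_poly h ha).mono_left
      (prism_mono Ioc_subset_Ioi_self)).symm

theorem facetSum_le_frontier {m : ℕ} {A : Finset E} (hA : ∀ a ∈ A, ‖a‖ = 1) {h : E → ℝ}
    {Ω : Set E} (hΩ : IsOpen Ω) (hb : IsBounded Ω) (hP : poly A h ⊆ Ω) :
    facetSum m A h ≤ μHE[m] (frontier Ω) := by
  have hm : ∀ a ∈ A, MeasurableSet (frontier Ω ∩ prism a (h a) (facet A h a) (Ioi 0)) :=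
    fun a _ => isClosed_frontier.measurableSet.inter
      (measurableSet_prism (isClosed_facet A h a).measurableSet measurableSet_Ioi)
  have h1 : ∀ a ∈ A, μHE[m] (facet A h a) ≤
      μHE[m] (frontier Ω ∩ prism a (h a) (facet A h a) (Ioi 0)) := fun a ha => by
    have haa : inner ℝ a a = (1 : ℝ) := by rw [real_inner_self_eq_norm_sq, hA a ha, one_pow]
    have hL : LipschitzWith 1 fun y : E => y - (inner ℝ a y - h a) • a := by
      refine LipschitzWith.of_dist_le_mul fun x y => ?_
      rw [NNReal.coe_one, one_mul, dist_eq_norm, dist_eq_norm]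
      have e : x - (inner ℝ a x - h a) • a - (y - (inner ℝ a y - h a) • a) =
          (x - y) - inner ℝ a (x - y) • a := by
        rw [inner_sub_right]; module
      rw [e]
      refine (sq_le_sq₀ (norm_nonneg _) (norm_nonneg _)).1 ?_
      rw [norm_sub_sq_real, real_inner_smul_right, norm_smul, hA a ha, real_inner_comm, mul_one,
        Real.norm_eq_abs, sq_abs]
      nlinarith [sq_nonneg (inner ℝ a (x - y))]
    refine le_trans (measure_mono ?_) (hL.lipschitzOnWith
      (s := frontier Ω ∩ prism a (h a) (facet A h a) (Ioi 0))).euclideanHausdorffMeasure_image_le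
    intro x hx
    obtain ⟨t, ht, htf⟩ := exists_pos_ray_mem_frontier hΩ hb (hP hx.1) (a := a)
      (by rintro rfl; simp at haa)
    have e : inner ℝ a (x + t • a) - h a = t := by
      rw [inner_add_right, hx.2, real_inner_smul_right, haa]; ring
    have e2 : x + t • a - (inner ℝ a (x + t • a) - h a) • a = x := by
      rw [e, add_sub_cancel_right]
    refine ⟨x + t • a, ⟨htf, ?_, ?_⟩, e2⟩
    · rw [e2]; exact hx
    · rw [e]; exact ht
  calc facetSum m A h ≤ ∑ a ∈ A, μHE[m] (frontier Ω ∩ prism a (h a) (facet A h a) (Ioi 0)) :=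
        Finset.sum_le_sum h1
    _ = μHE[m] (⋃ a ∈ A, frontier Ω ∩ prism a (h a) (facet A h a) (Ioi 0)) :=
        (measure_biUnion_finset ((pairwiseDisjoint_prism hA h).mono_on
          fun a _ => inter_subset_right) hm).symm
    _ ≤ _ := measure_mono (iUnion₂_subset fun a _ => inter_subset_left)
end

section
variable {E : Type*} [NormedAddCommGroup E] [InnerProductSpace ℝ E]

/-- The convex body with underlying set `poly A h`. -/
def polyBody [FiniteDimensional ℝ E] (A : Finset E) (h : E → ℝ) (hb : IsBounded (poly A h))
    (hne : (poly A h).Nonempty) : ConvexBody E where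
  carrier := poly A h
  convex' := convex_poly A h
  isCompact' := isCompact_of_isClosed_isBounded (isClosed_poly A h) hb
  nonempty' := hne

theorem coe_toNNReal_smul {t : ℝ} (ht : 0 ≤ t) (K : ConvexBody E) :
    ((t.toNNReal • K : ConvexBody E) : Set E) = t • (K : Set E) := by
  rw [ConvexBody.coe_smul']
  ext x
  simp only [mem_smul_set, NNReal.smul_def, Real.coe_toNNReal t ht]

theorem poly_add_closedBall_subset {A : Finset E} (hA : ∀ a ∈ A, ‖a‖ = 1) (h : E → ℝ) {δ : ℝ} :
    poly A (fun a => h a - δ) + closedBall 0 δ ⊆ poly A h := by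
  rintro _ ⟨x, hx, y, hy, rfl⟩ a ha
  rw [mem_closedBall_zero_iff] at hy
  have h1 := real_inner_le_norm a y
  rw [hA a ha, one_mul] at h1
  have h2 := hx a ha
  rw [inner_add_right]
  linarith

variable [MeasurableSpace E] [BorelSpace E] [FiniteDimensional ℝ E]

theorem facetSum_ne_top {m : ℕ} (hn : Module.finrank ℝ E = m + 1) {A : Finset E}
    (hA : ∀ a ∈ A, ‖a‖ = 1) {h : E → ℝ} (hb : IsBounded (poly A h)) : facetSum m A h ≠ ∞ := by
  have h1 := volume_poly_add_le hn hA h zero_le_one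
  rw [ENNReal.ofReal_one, one_mul] at h1
  have h2 : volume (poly A h + closedBall 0 1) < ∞ := (hb.add isBounded_closedBall).measure_lt_top
  exact ((le_add_self.trans h1).trans_lt h2).ne

variable {ι : Type*} [Fintype ι]

theorem facetSum_le_zper {m : ℕ} (hn : Module.finrank ℝ E = m + 1) {A : Finset E}
    (hA : ∀ a ∈ A, ‖a‖ = 1) {h : E → ℝ} {K : ConvexBody E} (hK : (K : Set E) = poly A h)
    {s : ι → E} {r : ℝ} (hr : 0 ≤ r) (hs : closedBall 0 r ⊆ (zono s : Set E)) :
    r * (facetSum m A h).toReal ≤ zper s K := by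
  refine ge_of_tendsto (tendsto_bodyVol_slope s K) ?_
  filter_upwards [self_mem_nhdsWithin] with δ hδ
  rw [mem_Ioi] at hδ
  have hb : IsBounded (poly A h) := hK ▸ K.isCompact.isBounded
  have h1 := volume_poly_add_le hn hA h (mul_nonneg hδ.le hr)
  have h2 : poly A h + closedBall 0 (δ * r) ⊆
      ((K + δ.toNNReal • zono s : ConvexBody E) : Set E) := by
    rw [ConvexBody.coe_add, hK, coe_toNNReal_smul hδ.le]
    refine add_subset_add_left ?_
    have := smul_closedBall δ (0 : E) hr
    rw [smul_zero, Real.norm_of_nonneg hδ.le] at this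
    rw [← this]
    exact smul_set_mono hs
  have h3 := ENNReal.toReal_mono (K + δ.toNNReal • zono s).isCompact.measure_lt_top.ne
    (h1.trans (measure_mono h2))
  rw [ENNReal.toReal_add hb.measure_lt_top.ne
    (ENNReal.mul_ne_top ENNReal.ofReal_ne_top (facetSum_ne_top hn hA hb)), ENNReal.toReal_mul,
    ENNReal.toReal_ofReal (mul_nonneg hδ.le hr), ← hK] at h3
  rw [le_div_iff₀ hδ, bodyVol, bodyVol, measureReal_def, measureReal_def]
  linarith

theorem zper_le_facetSum {m : ℕ} (hn : Module.finrank ℝ E = m + 1) {A : Finset E}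
    (hA : ∀ a ∈ A, ‖a‖ = 1) {h : E → ℝ} {K : ConvexBody E} (hK : (K : Set E) = poly A h)
    (hKi : (interior (K : Set E)).Nonempty)
    {s : ι → E} (hs : (zono s : Set E) ⊆ closedBall 0 1) :
    zper s K ≤ (facetSum m A h).toReal := by
  have hb : IsBounded (poly A h) := hK ▸ K.isCompact.isBounded
  set S := (facetSum m A h).toReal with hS
  have hS0 : 0 ≤ S := ENNReal.toReal_nonneg
  set V := bodyVol K with hV
  have hV0 : 0 < V := ENNReal.toReal_pos
    (Measure.measure_pos_of_nonempty_interior volume hKi).ne' K.isCompact.measure_lt_top.ne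
  have hlim : Filter.Tendsto (fun δ : ℝ => V * S / (V - δ * S)) (nhdsWithin 0 (Ioi 0))
      (nhds S) := by
    have : ContinuousAt (fun δ : ℝ => V * S / (V - δ * S)) 0 :=
      ContinuousAt.div (by fun_prop) (by fun_prop) (by simpa using hV0.ne')
    have h2 := this.tendsto
    rw [zero_mul, sub_zero, mul_div_cancel_left₀ _ hV0.ne'] at h2
    exact h2.mono_left nhdsWithin_le_nhds
  have hpos : ∀ᶠ δ : ℝ in nhdsWithin 0 (Ioi 0), 0 < V - δ * S := by
    have : ContinuousAt (fun δ : ℝ => V - δ * S) 0 := by fun_prop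
    exact (this.eventually (lt_mem_nhds (by simpa using hV0))).filter_mono nhdsWithin_le_nhds
  refine le_of_tendsto_of_tendsto (tendsto_bodyVol_slope s K) hlim ?_
  filter_upwards [self_mem_nhdsWithin, hpos] with δ hδ hδ2
  rw [mem_Ioi] at hδ
  have hPδ : IsCompact (poly A fun a => h a - δ) := isCompact_of_isClosed_isBounded
    (isClosed_poly _ _) (hb.subset (poly_mono fun a _ => by linarith))
  have h1 := ENNReal.toReal_mono (ENNReal.mul_ne_top ENNReal.ofReal_ne_top
    (facetSum_ne_top hn hA hb)) (volume_poly_sdiff_le hn hA h δ)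
  rw [ENNReal.toReal_mul, ENNReal.toReal_ofReal hδ.le, ← measureReal_def,
    measureReal_sdiff (poly_mono fun a _ => by linarith) hPδ.isClosed.measurableSet
      hb.measure_lt_top.ne, ← hK] at h1
  have h2 := brunn_minkowski_mul (K + δ.toNNReal • zono s).isCompact hPδ (l := 1 / 2)
    (by norm_num) (by norm_num)
  have h3 : (1 - 1 / 2 : ℝ) • ((K + δ.toNNReal • zono s : ConvexBody E) : Set E) +
      (1 / 2 : ℝ) • poly A (fun a => h a - δ) ⊆ K := by
    rintro _ ⟨_, ⟨_, ⟨x, hx, w, hw, rfl⟩, rfl⟩, _, ⟨y, hy, rfl⟩, rfl⟩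
    rw [SetLike.mem_coe, ← SetLike.mem_coe, coe_toNNReal_smul hδ.le] at hw
    obtain ⟨z, hz, rfl⟩ := hw
    have h4 : y + δ • z ∈ poly A h := poly_add_closedBall_subset hA h ⟨y, hy, δ • z, by
      have := hs hz
      rw [mem_closedBall_zero_iff] at this ⊢
      rw [norm_smul, Real.norm_of_nonneg hδ.le]
      exact mul_le_of_le_one_right hδ.le this, rfl⟩
    rw [← hK] at h4
    have h5 := K.convex hx h4 (a := 1 / 2) (b := 1 / 2) (by norm_num) (by norm_num) (by norm_num)
    convert h5 using 1
    beta_reduce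
    module
  have h4 := h2.trans (measureReal_mono h3 K.isCompact.measure_lt_top.ne)
  change bodyVol (K + δ.toNNReal • zono s) ^ _ * _ ≤ V at h4
  set W := bodyVol (K + δ.toNNReal • zono s) with hW
  have hW0 : 0 ≤ W := measureReal_nonneg
  set U := volume.real (poly A fun a => h a - δ) with hU
  have hU1 : V - δ * S ≤ U := by
    change V - U ≤ _ at h1
    linarith
  have h5 : W * U ≤ V ^ 2 := by
    have h6 := pow_le_pow_left₀ (by positivity) h4 2
    rw [mul_pow, ← Real.rpow_natCast, ← Real.rpow_natCast, ← Real.rpow_mul hW0,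
      ← Real.rpow_mul measureReal_nonneg] at h6
    norm_num at h6
    exact h6
  rw [div_le_div_iff₀ hδ hδ2]
  nlinarith
end

theorem pow_add_mul_pow_le {x δ : ℝ} (hx : 0 ≤ x) (hδ : 0 ≤ δ) (m : ℕ) :
    x ^ (m + 1) + (m + 1) * x ^ m * δ ≤ (x + δ) ^ (m + 1) := by
  induction m with
  | zero => simp
  | succ k ih =>
    have h1 := mul_le_mul_of_nonneg_right ih (add_nonneg hx hδ)
    have h2 : 0 ≤ (k + 1) * x ^ k * δ ^ 2 := by positivity
    push_cast
    rw [pow_succ (x + δ) (k + 1)]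
    refine le_trans ?_ h1
    have h3 : x ^ (k + 1 + 1) = x ^ k * x ^ 2 := by ring
    have h4 : x ^ (k + 1) = x ^ k * x := by ring
    rw [h3, h4]
    nlinarith

section
variable {E : Type*} [NormedAddCommGroup E] [InnerProductSpace ℝ E]
  [MeasurableSpace E] [BorelSpace E] [FiniteDimensional ℝ E]

theorem Convex.volume_eq_zero_of_interior {s : Set E} (hs : Convex ℝ s)
    (h : interior s = ∅) : volume s = 0 :=
  measure_mono_null (t := frontier s) (fun x hx => ⟨subset_closure hx, by simp [h]⟩) (hs.addHaar_frontier volume)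

theorem facetSum_root_add_le [Nontrivial E] {m : ℕ} (hm : m ≠ 0)
    (hn : Module.finrank ℝ E = m + 1) {A : Finset E}
    (hA : ∀ a ∈ A, ‖a‖ = 1) {h : E → ℝ} (hb : IsBounded (poly A h)) {τ : ℝ} (hτ : 0 ≤ τ)
    (hi : (interior (poly A fun a => h a - τ)).Nonempty) :
    (facetSum m A fun a => h a - τ).toReal ^ (1 / (m : ℝ)) +
      ((m + 1) * volume.real (closedBall (0 : E) 1)) ^ (1 / (m : ℝ)) * τ ≤
      (facetSum m A h).toReal ^ (1 / (m : ℝ)) := by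
  have hsub : poly A (fun a => h a - τ) ⊆ poly A h := poly_mono fun a _ => by linarith
  have hi' : (interior (poly A h)).Nonempty := hi.mono (interior_mono hsub)
  set P := polyBody A h hb (hi'.mono interior_subset) with hP
  set Q := polyBody A (fun a => h a - τ) (hb.subset hsub) (hi.mono interior_subset) with hQ
  set S := (facetSum m A h).toReal
  set T := (facetSum m A fun a => h a - τ).toReal
  have hT0 : 0 ≤ T := ENNReal.toReal_nonneg
  set ω := volume.real (closedBall (0 : E) 1)
  have hm' : (0 : ℝ) ≤ 1 / m := by positivity
  have key : ∀ ε ∈ Ioo (0 : ℝ) 1, ((1 - ε) * T) ^ (1 / (m : ℝ)) +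
      ((m + 1) * ((1 - ε) ^ (m + 1) * ω)) ^ (1 / (m : ℝ)) * τ ≤ S ^ (1 / (m : ℝ)) := by
    rintro ε ⟨hε, hε1⟩
    have hε2 : 0 ≤ 1 - ε := by linarith
    obtain ⟨ι, _, s, hs0, hs, hs1, hs2⟩ := exists_zono_approx (E := E) hε
    have h1 := facetSum_le_zper hn hA (K := Q) rfl hε2 hs1
    have h2 := zper_root_add_le hm hn hs0 hs (K := Q) hi hτ
    have h3 : Q + τ.toNNReal • zono s ≤ P := by
      rw [← SetLike.coe_subset_coe, ConvexBody.coe_add, coe_toNNReal_smul hτ]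
      refine (add_subset_add_left ?_).trans (poly_add_closedBall_subset hA h (δ := τ))
      have := smul_closedBall τ (0 : E) zero_le_one
      rw [smul_zero, Real.norm_of_nonneg hτ, mul_one] at this
      rw [← this]
      exact smul_set_mono hs2
    have h4 := (zper_mono s h3).trans (zper_le_facetSum hn hA (K := P) rfl hi' hs2)
    have h5 : (1 - ε) ^ (m + 1) * ω ≤ bodyVol (zono s) := by
      have h6 := measureReal_mono hs1 (zono s).isCompact.measure_lt_top.ne (μ := volume)
      rwa [measureReal_def, Measure.addHaar_closedBall' volume _ hε2, hn, ENNReal.toReal_mul,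
        ENNReal.toReal_ofReal (by positivity)] at h6
    have h7 : 0 ≤ (1 - ε) ^ (m + 1) * ω := mul_nonneg (by positivity) measureReal_nonneg
    calc _ ≤ zper s Q ^ (1 / (m : ℝ)) + ((m + 1) * bodyVol (zono s)) ^ (1 / (m : ℝ)) * τ := by
          gcongr
      _ ≤ _ := h2
      _ ≤ _ := Real.rpow_le_rpow (zper_nonneg _ _) h4 hm'
  have hcont : Continuous fun ε : ℝ => ((1 - ε) * T) ^ (1 / (m : ℝ)) +
      ((m + 1) * ((1 - ε) ^ (m + 1) * ω)) ^ (1 / (m : ℝ)) * τ :=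
    ((Real.continuous_rpow_const hm').comp (by fun_prop)).add
      (((Real.continuous_rpow_const hm').comp (by fun_prop)).mul continuous_const)
  have hlim := (hcont.tendsto 0).mono_left (nhdsWithin_le_nhds (s := Ioi 0))
  simp only [sub_zero, one_mul, one_pow] at hlim
  refine le_of_tendsto hlim ?_
  filter_upwards [Ioo_mem_nhdsGT one_pos] with ε hε using key ε hε

theorem facetSum_shift_le [Nontrivial E] {m : ℕ} (hm : m ≠ 0)
    (hn : Module.finrank ℝ E = m + 1) {A : Finset E}
    (hA : ∀ a ∈ A, ‖a‖ = 1) {h : E → ℝ} (hb : IsBounded (poly A h)) {R τ : ℝ} (hR : 0 ≤ R)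
    (hS : (facetSum m A h).toReal ≤ (m + 1) * volume.real (closedBall (0 : E) 1) * R ^ m)
    (hτ : 0 ≤ τ) (hi : (interior (poly A fun a => h a - τ)).Nonempty) :
    τ ≤ R ∧ (facetSum m A fun a => h a - τ).toReal ≤
      (m + 1) * volume.real (closedBall (0 : E) 1) * (R - τ) ^ m := by
  have h1 := facetSum_root_add_le hm hn hA hb hτ hi
  set T := (facetSum m A fun a => h a - τ).toReal
  have hT0 : 0 ≤ T := ENNReal.toReal_nonneg
  set ω := volume.real (closedBall (0 : E) 1)
  have hω : 0 < (m + 1) * ω := mul_pos (by positivity) (ENNReal.toReal_pos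
    (measure_closedBall_pos _ _ one_pos).ne' measure_closedBall_lt_top.ne)
  have hm' : (0 : ℝ) ≤ 1 / m := by positivity
  have hm0 : (m : ℝ) ≠ 0 := by positivity
  have hpm : ∀ x : ℝ, 0 ≤ x → (x ^ m) ^ (1 / (m : ℝ)) = x := fun x hx => by
    rw [← Real.rpow_natCast, ← Real.rpow_mul hx, mul_one_div_cancel hm0, Real.rpow_one]
  have hmp : ∀ x : ℝ, 0 ≤ x → (x ^ (1 / (m : ℝ))) ^ m = x := fun x hx => by
    rw [← Real.rpow_natCast, ← Real.rpow_mul hx, one_div_mul_cancel hm0, Real.rpow_one]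
  have h2 := Real.rpow_le_rpow ENNReal.toReal_nonneg hS hm'
  rw [Real.mul_rpow hω.le (by positivity), hpm R hR] at h2
  have hc : 0 < ((m + 1) * ω) ^ (1 / (m : ℝ)) := by positivity
  have hT1 : 0 ≤ T ^ (1 / (m : ℝ)) := by positivity
  have h3 : T ^ (1 / (m : ℝ)) ≤ ((m + 1) * ω) ^ (1 / (m : ℝ)) * (R - τ) := by
    rw [mul_sub]; linarith
  refine ⟨?_, ?_⟩
  · have := nonneg_of_mul_nonneg_right (hT1.trans h3) hc
    linarith
  · have h4 := pow_le_pow_left₀ hT1 h3 m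
    rwa [mul_pow, hmp _ hT0, hmp _ hω.le] at h4

theorem volume_poly_shift_step [Nontrivial E] {m : ℕ} (hm : m ≠ 0)
    (hn : Module.finrank ℝ E = m + 1) {A : Finset E}
    (hA : ∀ a ∈ A, ‖a‖ = 1) {h : E → ℝ} (hb : IsBounded (poly A h)) {R τ δ : ℝ} (hR : 0 ≤ R)
    (hS : (facetSum m A h).toReal ≤ (m + 1) * volume.real (closedBall (0 : E) 1) * R ^ m)
    (hτ : 0 ≤ τ) (hτR : τ ≤ R) (hδ : 0 ≤ δ) :
    volume.real (poly A fun a => h a - τ) - volume.real (poly A fun a => h a - (τ + δ)) ≤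
      volume.real (closedBall (0 : E) 1) *
        ((R + δ - τ) ^ (m + 1) - (R - τ) ^ (m + 1)) := by
  have hω : 0 ≤ volume.real (closedBall (0 : E) 1) := measureReal_nonneg
  have h1 := pow_add_mul_pow_le (sub_nonneg.2 hτR) hδ m
  rw [show R - τ + δ = R + δ - τ by ring] at h1
  have hx : 0 ≤ (R - τ) ^ m := pow_nonneg (sub_nonneg.2 hτR) m
  rcases eq_empty_or_nonempty (interior (poly A fun a => h a - τ)) with hi | hi
  · rw [measureReal_def, (convex_poly _ _).volume_eq_zero_of_interior hi, ENNReal.toReal_zero]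
    have h2 : 0 ≤ (m + 1) * (R - τ) ^ m * δ := by positivity
    have h3 : 0 ≤ volume.real (poly A fun a => h a - (τ + δ)) := measureReal_nonneg
    have h4 := mul_nonneg hω (show 0 ≤ (R + δ - τ) ^ (m + 1) - (R - τ) ^ (m + 1) by linarith)
    linarith
  · have h2 := (facetSum_shift_le hm hn hA hb hR hS hτ hi).2
    have hb' : IsBounded (poly A fun a => h a - τ) :=
      hb.subset (poly_mono fun a _ => by linarith)
    have h3 := ENNReal.toReal_mono (ENNReal.mul_ne_top ENNReal.ofReal_ne_top
      (facetSum_ne_top hn hA hb')) (volume_poly_sdiff_le hn hA (fun a => h a - τ) δ)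
    simp only [sub_sub] at h3
    rw [ENNReal.toReal_mul, ENNReal.toReal_ofReal hδ, ← measureReal_def,
      measureReal_sdiff (poly_mono fun a _ => by linarith) (isClosed_poly _ _).measurableSet
        hb'.measure_lt_top.ne] at h3
    refine h3.trans ((mul_le_mul_of_nonneg_left h2 hδ).trans ?_)
    have h4 := mul_le_mul_of_nonneg_left h1 hω
    linarith

theorem volume_poly_shift_le [Nontrivial E] {m : ℕ} (hm : m ≠ 0)
    (hn : Module.finrank ℝ E = m + 1) {A : Finset E}
    (hA : ∀ a ∈ A, ‖a‖ = 1) {h : E → ℝ} (hb : IsBounded (poly A h)) {R s t : ℝ} (hR : 0 ≤ R)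
    (hS : (facetSum m A h).toReal ≤ (m + 1) * volume.real (closedBall (0 : E) 1) * R ^ m)
    (hs : 0 ≤ s) (hst : s ≤ t) (htR : t ≤ R) :
    volume.real (poly A fun a => h a - s) - volume.real (poly A fun a => h a - t) ≤
      volume.real (closedBall (0 : E) 1) * ((R - s) ^ (m + 1) - (R - t) ^ (m + 1)) := by
  set ω := volume.real (closedBall (0 : E) 1)
  have key : ∀ N : ℕ, volume.real (poly A fun a => h a - s) -
      volume.real (poly A fun a => h a - t) ≤
      ω * ((R + (t - s) * (1 / ((N : ℝ) + 1)) - s) ^ (m + 1) -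
        (R + (t - s) * (1 / ((N : ℝ) + 1)) - t) ^ (m + 1)) := by
    intro N
    set δ := (t - s) * (1 / ((N : ℝ) + 1)) with hδ
    have hδ0 : 0 ≤ δ := mul_nonneg (by linarith) (by positivity)
    have hN : s + (N + 1 : ℕ) * δ = t := by
      rw [hδ]; push_cast; field_simp; ring
    have ind : ∀ k : ℕ, k ≤ N + 1 → volume.real (poly A fun a => h a - s) -
        volume.real (poly A fun a => h a - (s + k * δ)) ≤
        ω * ((R + δ - s) ^ (m + 1) - (R + δ - (s + k * δ)) ^ (m + 1)) := by
      intro k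
      induction k with
      | zero => intro _; simp
      | succ k ih =>
        intro hk
        have h1 := ih (by omega)
        have h2 : s + k * δ ≤ t := by
          rw [← hN]
          have : (k : ℝ) ≤ (N + 1 : ℕ) := by exact_mod_cast (by omega : k ≤ N + 1)
          gcongr
        have h3 := volume_poly_shift_step hm hn hA hb hR hS (τ := s + k * δ) (by positivity)
          (h2.trans htR) hδ0
        have e1 : s + k * δ + δ = s + (k + 1 : ℕ) * δ := by push_cast; ring
        have e2 : R - (s + k * δ) = R + δ - (s + (k + 1 : ℕ) * δ) := by push_cast; ring
        rw [e1, e2] at h3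
        linarith
    have := ind (N + 1) le_rfl
    rwa [hN] at this
  have hcont : Continuous fun δ : ℝ => ω * ((R + (t - s) * δ - s) ^ (m + 1) -
      (R + (t - s) * δ - t) ^ (m + 1)) := by fun_prop
  have hlim := (hcont.tendsto 0).comp (tendsto_one_div_add_atTop_nhds_zero_nat (𝕜 := ℝ))
  simp only [mul_zero, add_zero] at hlim
  exact ge_of_tendsto' hlim key
end

section
variable {E : Type*} [NormedAddCommGroup E] [InnerProductSpace ℝ E] [FiniteDimensional ℝ E]

theorem exists_norm_eq_one_inner_lt {Ω : Set E} (ho : IsOpen Ω) (hc : Convex ℝ Ω)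
    (hne : Ω.Nonempty) {y : E} (hy : y ∉ Ω) :
    ∃ a : E, ‖a‖ = 1 ∧ ∀ x ∈ Ω, inner ℝ a x < inner ℝ a y := by
  obtain ⟨f, hf⟩ := geometric_hahn_banach_open_point hc ho hy
  obtain ⟨a, rfl⟩ := (InnerProductSpace.toDual ℝ E).surjective f
  simp only [InnerProductSpace.toDual_apply_apply] at hf
  have ha : a ≠ 0 := by
    rintro rfl
    obtain ⟨x, hx⟩ := hne
    simpa using hf x hx
  have ha' := norm_pos_iff.2 ha
  refine ⟨‖a‖⁻¹ • a, ?_, fun x hx => ?_⟩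
  · rw [norm_smul, norm_inv, norm_norm, inv_mul_cancel₀ ha'.ne']
  · rw [real_inner_smul_left, real_inner_smul_left]
    exact mul_lt_mul_of_pos_left (hf x hx) (inv_pos.2 ha')

theorem exists_poly_between {C Ω : Set E} (hC : IsCompact C) (hCne : C.Nonempty)
    (ho : IsOpen Ω) (hb : IsBounded Ω) (hc : Convex ℝ Ω) (hCΩ : C ⊆ Ω) :
    ∃ (A : Finset E) (h : E → ℝ), (∀ a ∈ A, ‖a‖ = 1) ∧ C ⊆ poly A h ∧ poly A h ⊆ Ω := by
  classical
  have hex : ∀ y : E, ∃ a : E, y ∈ frontier Ω →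
      ‖a‖ = 1 ∧ ∀ x ∈ Ω, inner ℝ a x < inner ℝ a y := fun y => by
    by_cases hy : y ∈ frontier Ω
    · obtain ⟨a, ha⟩ := exists_norm_eq_one_inner_lt ho hc (hCne.mono hCΩ)
        (fun h => (ho.frontier_eq ▸ hy).2 h)
      exact ⟨a, fun _ => ha⟩
    · exact ⟨0, fun h => absurd h hy⟩
  choose a ha using hex
  set h : E → ℝ := fun a => sSup ((fun x => inner ℝ a x) '' C) with hh
  have hcont : ∀ b : E, ContinuousOn (fun x => inner ℝ b x) C := fun b => by fun_prop
  have hK : IsCompact (frontier Ω) :=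
    isCompact_of_isClosed_isBounded isClosed_frontier (hb.closure.subset frontier_subset_closure)
  obtain ⟨t, htF⟩ := hK.elim_nhds_subcover' (fun y _ => {z | h (a y) < inner ℝ (a y) z})
    fun y hy => (isOpen_lt continuous_const (by fun_prop)).mem_nhds (by
      obtain ⟨x, hx, hxs⟩ := hC.exists_sSup_image_eq hCne (hcont (a y))
      change sSup ((fun x => inner ℝ (a y) x) '' C) < inner ℝ (a y) y
      rw [hxs]
      exact (ha y hy).2 x (hCΩ hx))
  have hCP : C ⊆ poly (t.image fun y : frontier Ω => a y) h := fun x hx b _ =>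
    le_csSup (hC.image_of_continuousOn (hcont b)).bddAbove ⟨x, hx, rfl⟩
  refine ⟨t.image fun y : frontier Ω => a y, h, ?_, hCP, ?_⟩
  · intro b hb
    obtain ⟨y, -, rfl⟩ := Finset.mem_image.1 hb
    exact (ha y y.2).1
  · refine (subset_interior_of_disjoint_frontier (convex_poly _ _).isPreconnected ?_ ?_).trans
      interior_subset
    · rw [Set.disjoint_left]
      intro x hx hxF
      obtain ⟨y, hyt, hy⟩ := mem_iUnion₂.1 (htF hxF)
      exact not_lt.2 (hx (a y) (Finset.mem_image_of_mem _ hyt)) hy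
    · obtain ⟨x, hx⟩ := hCne
      exact ⟨x, hCP hx, hCΩ hx⟩

theorem frontier_poly_subset (A : Finset E) (h : E → ℝ) :
    frontier (poly A h) ⊆ ⋃ a ∈ A, facet A h a := by
  intro x hx
  have hxP : x ∈ poly A h := (isClosed_poly A h).frontier_subset hx
  by_contra hx'
  have hlt : ∀ a ∈ A, inner ℝ a x < h a := fun a ha =>
    (hxP a ha).lt_of_ne fun he => hx' (mem_biUnion ha ⟨hxP, he⟩)
  refine hx.2 (mem_interior.2 ⟨⋂ a ∈ A, {z | inner ℝ a z < h a}, fun z hz a ha => ?_,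
    isOpen_biInter_finset fun a _ => isOpen_lt (by fun_prop) continuous_const, ?_⟩)
  · exact le_of_lt (mem_iInter₂.1 hz a ha)
  · exact mem_iInter₂.2 hlt
end

theorem pow_sub_one_le {ε : ℝ} (hε : 0 ≤ ε) (m : ℕ) :
    (1 + ε) ^ (m + 1) - 1 ≤ (m + 1) * ε * (1 + ε) ^ m := by
  induction m with
  | zero => simp
  | succ k ih =>
    have h1 := mul_le_mul_of_nonneg_right ih (by linarith : 0 ≤ 1 + ε)
    have h2 : 1 ≤ (1 + ε) ^ (k + 1) := one_le_pow₀ (by linarith)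
    push_cast
    have e1 : (1 + ε) ^ (k + 1) = (1 + ε) ^ k * (1 + ε) := pow_succ _ _
    have e2 : (1 + ε) ^ (k + 1 + 1) = (1 + ε) ^ (k + 1) * (1 + ε) := pow_succ _ _
    have h3 := mul_le_mul_of_nonneg_left h2 hε
    rw [mul_assoc _ ((1 + ε) ^ k), ← e1] at h1
    rw [e2]
    linarith

section
variable {E : Type*} [NormedAddCommGroup E] [InnerProductSpace ℝ E]

theorem lipschitzOnWith_radial_retraction {R : ℝ} (hR : 0 < R) :
    LipschitzOnWith 1 (fun x : E => (R / ‖x‖) • x) (ball 0 R)ᶜ := by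
  refine LipschitzOnWith.of_dist_le_mul fun x hx y hy => ?_
  rw [mem_compl_iff, mem_ball_zero_iff, not_lt] at hx hy
  rw [NNReal.coe_one, one_mul, dist_eq_norm, dist_eq_norm]
  refine (sq_le_sq₀ (norm_nonneg _) (norm_nonneg _)).1 ?_
  have hr : 0 < ‖x‖ := hR.trans_le hx
  have hs : 0 < ‖y‖ := hR.trans_le hy
  rw [norm_sub_sq_real, norm_sub_sq_real, norm_smul, norm_smul, norm_div, norm_div, norm_norm,
    norm_norm, div_mul_cancel₀ _ hr.ne', div_mul_cancel₀ _ hs.ne', real_inner_smul_left,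
    real_inner_smul_right, Real.norm_of_nonneg hR.le]
  have hc := real_inner_le_norm x y
  set c : ℝ := inner ℝ x y
  set k := R / ‖x‖ * (R / ‖y‖) with hk
  have hk1 : k ≤ 1 := by
    rw [hk]
    exact mul_le_one₀ ((div_le_one hr).2 hx) (by positivity) ((div_le_one hs).2 hy)
  have hk2 : k * (‖x‖ * ‖y‖) = R ^ 2 := by rw [hk]; field_simp
  have h1 := mul_le_mul_of_nonneg_left hc (sub_nonneg.2 hk1)
  rw [← mul_assoc]
  nlinarith [sq_nonneg (‖x‖ - ‖y‖)]

theorem mem_poly_shift {A : Finset E} (hA : ∀ a ∈ A, ‖a‖ = 1) {h : E → ℝ} {x : E} {t : ℝ}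
    (ht : 0 ≤ t) (hx : closedBall x t ⊆ poly A h) : x ∈ poly A fun a => h a - t := by
  intro a ha
  have h1 : x + t • a ∈ closedBall x t := by
    rw [mem_closedBall, dist_eq_norm, add_sub_cancel_left, norm_smul, hA a ha,
      Real.norm_of_nonneg ht, mul_one]
  have h2 := hx h1 a ha
  rw [inner_add_right, real_inner_smul_right, real_inner_self_eq_norm_sq, hA a ha] at h2
  linarith

theorem interior_poly_shift_nonempty {A : Finset E} (hA : ∀ a ∈ A, ‖a‖ = 1) {h : E → ℝ} {x : E}
    {t r : ℝ} (ht : 0 ≤ t) (htr : t < r) (hx : closedBall x r ⊆ poly A h) :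
    (interior (poly A fun a => h a - t)).Nonempty := by
  refine ⟨x, mem_interior.2 ⟨ball x (r - t), fun y hy => mem_poly_shift hA ht ?_, isOpen_ball,
    mem_ball_self (by linarith)⟩⟩
  refine (closedBall_subset_closedBall' ?_).trans hx
  rw [mem_ball] at hy
  linarith

variable [MeasurableSpace E] [BorelSpace E] [FiniteDimensional ℝ E]

theorem facetSum_le_of_closedBall_subset {m : ℕ} (hn : Module.finrank ℝ E = m + 1) {A : Finset E}
    (hA : ∀ a ∈ A, ‖a‖ = 1) {h : E → ℝ} (hb : IsBounded (poly A h)) {R ε : ℝ} (hR : 0 < R)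
    (hε : 0 < ε) (hP : closedBall 0 R ⊆ poly A h) :
    (facetSum m A h).toReal ≤ (m + 1) * (1 + ε) ^ m * volume.real (poly A h) / R := by
  have h1 := volume_poly_add_le hn hA h (mul_pos hε hR).le
  have h2 : poly A h + closedBall 0 (ε * R) ⊆ (1 + ε) • poly A h := by
    rw [(convex_poly A h).add_smul zero_le_one hε.le, one_smul]
    refine add_subset_add_left ?_
    have := smul_closedBall ε (0 : E) hR.le
    rw [smul_zero, Real.norm_of_nonneg hε.le] at this
    rw [← this]
    exact smul_set_mono hP
  have h3 : volume ((1 + ε) • poly A h) = ENNReal.ofReal ((1 + ε) ^ (m + 1)) *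
      volume (poly A h) := by
    rw [Measure.addHaar_smul, hn, abs_of_nonneg (by positivity)]
  have h4 := h1.trans (measure_mono h2)
  have hVt : volume (poly A h) ≠ ∞ := hb.measure_lt_top.ne
  rw [h3] at h4
  have h5 := ENNReal.toReal_mono (ENNReal.mul_ne_top ENNReal.ofReal_ne_top hVt) h4
  rw [ENNReal.toReal_add hVt
    (ENNReal.mul_ne_top ENNReal.ofReal_ne_top (facetSum_ne_top hn hA hb)), ENNReal.toReal_mul,
    ENNReal.toReal_mul, ENNReal.toReal_ofReal (by positivity),
    ENNReal.toReal_ofReal (by positivity), ← measureReal_def] at h5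
  have h6 := mul_le_mul_of_nonneg_right (pow_sub_one_le hε.le m)
    (measureReal_nonneg (μ := volume) (s := poly A h))
  rw [le_div_iff₀ hR]
  refine le_of_mul_le_mul_left ?_ hε
  linarith

theorem sphere_le_facetSum {m : ℕ} {A : Finset E} {h : E → ℝ}
    (hb : IsBounded (poly A h)) {R : ℝ} (hR : 0 < R) (hP : closedBall 0 R ⊆ poly A h) :
    μHE[m] (sphere (0 : E) R) ≤ facetSum m A h := by
  have hsub : sphere (0 : E) R ⊆ (fun x : E => (R / ‖x‖) • x) '' frontier (poly A h) := by
    intro x hx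
    rw [mem_sphere_zero_iff_norm] at hx
    have hx0 : x ≠ 0 := norm_pos_iff.1 (hx ▸ hR)
    obtain ⟨t, ht, htf⟩ := exists_ray_mem_frontier hb (hP (by
      rw [mem_closedBall_zero_iff, hx] : x ∈ closedBall 0 R)) hx0
    refine ⟨_, htf, ?_⟩
    have e : x + t • x = (1 + t) • x := by module
    beta_reduce
    rw [e, norm_smul, hx, Real.norm_of_nonneg (by linarith), smul_smul]
    have : R / ((1 + t) * R) * (1 + t) = 1 := by field_simp
    rw [this, one_smul]
  have hfr : frontier (poly A h) ⊆ (ball 0 R)ᶜ := fun x hx hxb =>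
    hx.2 (interior_mono hP (ball_subset_interior_closedBall hxb))
  calc μHE[m] (sphere (0 : E) R)
      ≤ μHE[m] (frontier (poly A h)) := (measure_mono hsub).trans
        ((lipschitzOnWith_radial_retraction hR).mono hfr).euclideanHausdorffMeasure_image_le
    _ ≤ μHE[m] (⋃ a ∈ A, facet A h a) := measure_mono (frontier_poly_subset A h)
    _ ≤ _ := measure_biUnion_finset_le _ _

theorem volume_real_ball {m : ℕ} (hn : Module.finrank ℝ E = m + 1) {R : ℝ} (hR : 0 ≤ R) :
    volume.real (closedBall (0 : E) R) = R ^ (m + 1) * volume.real (closedBall (0 : E) 1) := by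
  rw [measureReal_def, Measure.addHaar_closedBall' volume _ hR, hn, ENNReal.toReal_mul,
    ENNReal.toReal_ofReal (by positivity), measureReal_def]

theorem euclideanHausdorffMeasure_sphere_le {m : ℕ} (hn : Module.finrank ℝ E = m + 1) {R : ℝ}
    (hR : 0 < R) : μHE[m] (sphere (0 : E) R) ≤
      ENNReal.ofReal ((m + 1) * volume.real (closedBall (0 : E) 1) * R ^ m) := by
  set ω := volume.real (closedBall (0 : E) 1)
  have key : ∀ ε > 0, μHE[m] (sphere (0 : E) R) ≤
      ENNReal.ofReal ((m + 1) * (1 + ε) ^ m * (((1 + ε) * R) ^ (m + 1) * ω) / R) := by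
    intro ε hε
    obtain ⟨A, h, hA, h1, h2⟩ := exists_poly_between (isCompact_closedBall (0 : E) R)
      ⟨0, mem_closedBall_self hR.le⟩ (isOpen_ball : IsOpen (ball (0 : E) ((1 + ε) * R))) isBounded_ball
      (convex_ball _ _) (closedBall_subset_ball (by nlinarith))
    have hb := isBounded_ball.subset h2
    refine (sphere_le_facetSum hb hR h1).trans (ENNReal.le_ofReal_iff_toReal_le
      (facetSum_ne_top hn hA hb) (by positivity) |>.2 ?_)
    refine (facetSum_le_of_closedBall_subset hn hA hb hR hε h1).trans ?_
    rw [← volume_real_ball hn (by positivity)]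
    gcongr
    · exact measure_closedBall_lt_top.ne
    · exact h2.trans ball_subset_closedBall
  have hcont : Continuous fun ε : ℝ => ENNReal.ofReal
      ((m + 1) * (1 + ε) ^ m * (((1 + ε) * R) ^ (m + 1) * ω) / R) :=
    ENNReal.continuous_ofReal.comp (by fun_prop)
  have hlim := (hcont.tendsto 0).mono_left (nhdsWithin_le_nhds (s := Ioi 0))
  have e : (m + 1 : ℝ) * (1 + 0) ^ m * (((1 + 0) * R) ^ (m + 1) * ω) / R =
      (m + 1) * ω * R ^ m := by
    field_simp
    ring
  rw [e] at hlim
  refine ge_of_tendsto hlim ?_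
  filter_upwards [self_mem_nhdsWithin] with ε hε using key ε hε

theorem le_euclideanHausdorffMeasure_sphere [Nontrivial E] {m : ℕ} (hm : m ≠ 0)
    (hn : Module.finrank ℝ E = m + 1) {R : ℝ} (hR : 0 < R) :
    (m + 1) * volume.real (closedBall (0 : E) 1) * R ^ m ≤
      (μHE[m] (sphere (0 : E) R)).toReal := by
  set ω := volume.real (closedBall (0 : E) 1)
  have key : ∀ τ ∈ Ioo 0 R, (m + 1) * ω * τ ^ m ≤ (μHE[m] (sphere (0 : E) R)).toReal := by
    rintro τ ⟨hτ, hτR⟩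
    obtain ⟨A, h, hA, h1, h2⟩ := exists_poly_between
      (isCompact_closedBall (0 : E) ((τ + R) / 2)) ⟨0, mem_closedBall_self (by linarith)⟩
      (isOpen_ball : IsOpen (ball (0 : E) R)) isBounded_ball
      (convex_ball _ _) (closedBall_subset_ball (by linarith))
    have hb := isBounded_ball.subset h2
    have h3 := facetSum_root_add_le hm hn hA hb hτ.le
      (interior_poly_shift_nonempty hA hτ.le (by linarith) h1)
    have h4 := facetSum_le_frontier (m := m) hA isOpen_ball isBounded_ball h2
    rw [frontier_ball _ hR.ne'] at h4
    have h5 := ENNReal.toReal_mono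
      ((euclideanHausdorffMeasure_sphere_le hn hR).trans_lt ENNReal.ofReal_lt_top).ne h4
    refine le_trans ?_ h5
    have hω : 0 ≤ (m + 1) * ω := mul_nonneg (by positivity) measureReal_nonneg
    have h6 : ((m + 1) * ω) ^ (1 / (m : ℝ)) * τ ≤ (facetSum m A h).toReal ^ (1 / (m : ℝ)) :=
      (le_add_of_nonneg_left (by positivity)).trans h3
    have h7 := pow_le_pow_left₀ (by positivity) h6 m
    have hm0 : (m : ℝ) ≠ 0 := by positivity
    have hmp : ∀ x : ℝ, 0 ≤ x → (x ^ (1 / (m : ℝ))) ^ m = x := fun x hx => by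
      rw [← Real.rpow_natCast, ← Real.rpow_mul hx, one_div_mul_cancel hm0, Real.rpow_one]
    rwa [mul_pow, hmp _ hω, hmp _ ENNReal.toReal_nonneg] at h7
  have hcont : Continuous fun τ : ℝ => (m + 1) * ω * τ ^ m := by fun_prop
  have hlim := (hcont.tendsto R).mono_left (nhdsWithin_le_nhds (s := Iio R))
  refine le_of_tendsto hlim ?_
  filter_upwards [Ioo_mem_nhdsLT hR] with τ hτ using key τ hτ
end

section
variable {E : Type*} [NormedAddCommGroup E] [InnerProductSpace ℝ E] [Nontrivial E]

theorem nonempty_compl_of_isBounded {Ω : Set E} (hb : IsBounded Ω) : Ωᶜ.Nonempty := by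
  rw [nonempty_compl]
  rintro rfl
  exact NormedSpace.unbounded_univ ℝ E hb

variable [FiniteDimensional ℝ E]

theorem lt_infDist_compl {Ω : Set E} (ho : IsOpen Ω) (hb : IsBounded Ω) {x : E} {t : ℝ}
    (h : closedBall x t ⊆ Ω) : t < infDist x Ωᶜ := by
  have : ProperSpace E := FiniteDimensional.proper ℝ E
  obtain ⟨y, hy, he⟩ := ho.isClosed_compl.exists_infDist_eq_dist (nonempty_compl_of_isBounded hb) x
  by_contra! hlt
  rw [he] at hlt
  exact hy (h (by rwa [mem_closedBall, dist_comm]))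

theorem closedBall_subset_of_lt_infDist {Ω : Set E} {x : E} {t : ℝ} (h : t < infDist x Ωᶜ) :
    closedBall x t ⊆ Ω :=
  (closedBall_subset_ball h).trans ball_infDist_compl_subset

variable [MeasurableSpace E] [BorelSpace E]

theorem facetSum_toReal_le {m : ℕ} {A : Finset E} (hA : ∀ a ∈ A, ‖a‖ = 1) {h : E → ℝ}
    {Ω : Set E} (ho : IsOpen Ω) (hb : IsBounded Ω) (hP : poly A h ⊆ Ω) {c : ℝ} (hc : 0 ≤ c)
    (hS : μHE[m] (frontier Ω) ≤ ENNReal.ofReal c) : (facetSum m A h).toReal ≤ c :=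
  ENNReal.toReal_le_of_le_ofReal hc ((facetSum_le_frontier hA ho hb hP).trans hS)

theorem infDist_compl_le {m : ℕ} (hm : m ≠ 0) (hn : Module.finrank ℝ E = m + 1) {Ω : Set E}
    (ho : IsOpen Ω) (hb : IsBounded Ω) (hc : Convex ℝ Ω) {R : ℝ} (hR : 0 ≤ R)
    (hS : μHE[m] (frontier Ω) ≤
      ENNReal.ofReal ((m + 1) * volume.real (closedBall (0 : E) 1) * R ^ m)) (x : E) :
    infDist x Ωᶜ ≤ R := by
  have : ProperSpace E := FiniteDimensional.proper ℝ E
  by_contra! hlt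
  obtain ⟨t', h1, h2⟩ := exists_between hlt
  obtain ⟨t, h3, h4⟩ := exists_between h1
  obtain ⟨A, h, hA, hCP, hPΩ⟩ := exists_poly_between (isCompact_closedBall x t')
    ⟨x, mem_closedBall_self (by linarith)⟩ ho hb hc (closedBall_subset_of_lt_infDist h2)
  have h5 := (facetSum_shift_le hm hn hA (hb.subset hPΩ) hR
    (facetSum_toReal_le hA ho hb hPΩ (by positivity) hS) (by linarith)
    (interior_poly_shift_nonempty hA (by linarith) h4 hCP)).1
  linarith

theorem volume_lt_infDist_le {m : ℕ} (hm : m ≠ 0) (hn : Module.finrank ℝ E = m + 1) {Ω : Set E}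
    (ho : IsOpen Ω) (hb : IsBounded Ω) (hc : Convex ℝ Ω) {R s t : ℝ}
    (hS : μHE[m] (frontier Ω) ≤
      ENNReal.ofReal ((m + 1) * volume.real (closedBall (0 : E) 1) * R ^ m))
    (hs : 0 ≤ s) (hst : s ≤ t) (htR : t ≤ R) :
    volume {x : E | s < infDist x Ωᶜ} ≤ volume {x : E | t < infDist x Ωᶜ} +
      ENNReal.ofReal (volume.real (closedBall (0 : E) 1) *
        ((R - s) ^ (m + 1) - (R - t) ^ (m + 1))) := by
  have : ProperSpace E := FiniteDimensional.proper ℝ E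
  have hopen : IsOpen {x : E | s < infDist x Ωᶜ} :=
    isOpen_lt continuous_const (continuous_infDist_pt _)
  rw [hopen.measure_eq_iSup_isCompact]
  refine iSup₂_le fun K hK => iSup_le fun hKc => ?_
  rcases K.eq_empty_or_nonempty with rfl | hKne
  · simp
  obtain ⟨A, h, hA, hCP, hPΩ⟩ := exists_poly_between
    (hKc.add (isCompact_closedBall (0 : E) s))
    (hKne.add ⟨0, mem_closedBall_self hs⟩) ho hb hc (by
      rintro _ ⟨x, hx, y, hy, rfl⟩
      refine closedBall_subset_of_lt_infDist (hK hx) ?_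
      rw [mem_closedBall_zero_iff] at hy
      rwa [mem_closedBall, dist_eq_norm, add_sub_cancel_left])
  have hbP := hb.subset hPΩ
  have hR : 0 ≤ R := by linarith
  have h1 := volume_poly_shift_le hm hn hA hbP hR
    (facetSum_toReal_le hA ho hb hPΩ (by positivity) hS) hs hst htR
  have hKP : K ⊆ poly A fun a => h a - s := fun x hx => mem_poly_shift hA hs fun y hy => hCP
    ⟨x, hx, y - x, by rwa [mem_closedBall_zero_iff, ← dist_eq_norm], by simp⟩
  have hPt : (poly A fun a => h a - t) ⊆ {x : E | t < infDist x Ωᶜ} := fun x hx =>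
    lt_infDist_compl ho hb fun y hy => hPΩ (poly_add_closedBall_subset hA h (δ := t)
      ⟨x, hx, y - x, by rwa [mem_closedBall_zero_iff, ← dist_eq_norm], by simp⟩)
  have hfin : ∀ r, 0 ≤ r → volume (poly A fun a => h a - r) ≠ ∞ := fun r hr =>
    (hbP.subset (poly_mono fun a _ => by linarith)).measure_lt_top.ne
  refine (measure_mono hKP).trans (le_trans ?_ (add_le_add_left (measure_mono hPt) _))
  rw [← ENNReal.ofReal_toReal (hfin s hs), ← ENNReal.ofReal_toReal (hfin t (hs.trans hst)),
    ← ENNReal.ofReal_add ENNReal.toReal_nonneg]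
  · refine ENNReal.ofReal_le_ofReal ?_
    rw [← measureReal_def, ← measureReal_def]
    linarith
  · refine mul_nonneg measureReal_nonneg (sub_nonneg.2 ?_)
    exact pow_le_pow_left₀ (by linarith) (by linarith) _

end

theorem StieltjesFunction.le_measure {μ : Measure ℝ} (F : StieltjesFunction ℝ)
    (h : ∀ a b, a < b → μ (Ioc a b) ≤ ENNReal.ofReal (F b - F a)) : μ ≤ F.measure := by
  have h' : μ.toOuterMeasure ≤ F.outer := OuterMeasure.le_ofFunction.2 fun s => by
    rw [F.length_eq]
    refine le_iInf fun a => le_iInf fun b => le_iInf fun hs => ?_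
    rw [show (botSet : Set ℝ) = ∅ from eq_empty_of_forall_notMem fun x hx =>
      not_isBot x hx, sdiff_empty] at hs
    refine (measure_mono hs).trans ?_
    rcases lt_or_ge a b with hab | hab
    · exact h a b hab
    · simp [Ioc_eq_empty (not_lt.2 hab)]
  refine Measure.le_iff.2 fun s hs => (h' s).trans_eq ?_
  rw [StieltjesFunction.measure]
  rfl

/-- The distribution function of the distance to the boundary in the ball of radius `R`. -/
def distStieltjes (ω R : ℝ) (hω : 0 ≤ ω) (m : ℕ) : StieltjesFunction ℝ where
  toFun s := -(ω * (R - max 0 (min s R)) ^ (m + 1))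
  mono' := fun s t hst => by
    by_cases hR : 0 ≤ R
    · have h1 : max 0 (min s R) ≤ max 0 (min t R) := by gcongr
      have h2 : max 0 (min t R) ≤ R := max_le hR (min_le_right _ _)
      have := pow_le_pow_left₀ (by linarith) (by linarith : R - max 0 (min t R) ≤
        R - max 0 (min s R)) (m + 1)
      have := mul_le_mul_of_nonneg_left this hω
      simpa using this
    · have : ∀ s, max 0 (min s R) = 0 := fun s =>
        max_eq_left ((min_le_right _ _).trans (not_le.1 hR).le)
      simp [this]
  right_continuous' := fun x => Continuous.continuousWithinAt (by fun_prop)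

section
variable {E : Type*} [NormedAddCommGroup E] [InnerProductSpace ℝ E] [Nontrivial E]
  [FiniteDimensional ℝ E] [MeasurableSpace E] [BorelSpace E]

theorem map_infDist_compl_le {m : ℕ} (hm : m ≠ 0) (hn : Module.finrank ℝ E = m + 1) {Ω : Set E}
    (ho : IsOpen Ω) (hb : IsBounded Ω) (hc : Convex ℝ Ω) {R : ℝ} (hR : 0 < R)
    (hS : μHE[m] (frontier Ω) ≤
      ENNReal.ofReal ((m + 1) * volume.real (closedBall (0 : E) 1) * R ^ m)) :
    (volume.restrict Ω).map (fun x => infDist x Ωᶜ) ≤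
      (volume.restrict (ball (0 : E) R)).map fun x => R - ‖x‖ := by
  set ω := volume.real (closedBall (0 : E) 1) with hω
  set F := distStieltjes ω R measureReal_nonneg m with hF
  have hcl : ∀ s, 0 ≤ max 0 (min s R) ∧ max 0 (min s R) ≤ R := fun s =>
    ⟨le_max_left _ _, max_le hR.le (min_le_right _ _)⟩
  have hcm : ∀ {s t : ℝ}, s ≤ t → max 0 (min s R) ≤ max 0 (min t R) := fun h => by gcongr
  have hFd : ∀ s t, F t - F s =
      ω * ((R - max 0 (min s R)) ^ (m + 1) - (R - max 0 (min t R)) ^ (m + 1)) := fun s t => by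
    change -(ω * (R - max 0 (min t R)) ^ (m + 1)) - -(ω * (R - max 0 (min s R)) ^ (m + 1)) = _
    ring
  have hiff : ∀ s d : ℝ, 0 < d → d ≤ R → (s < d ↔ max 0 (min s R) < d) := fun s d h0 hd => by
    rw [max_lt_iff, min_lt_iff]
    constructor
    · exact fun h => ⟨h0, Or.inl h⟩
    · rintro ⟨-, h | h⟩
      · exact h
      · linarith
  have h1 : (volume.restrict Ω).map (fun x => infDist x Ωᶜ) ≤ F.measure := by
    refine F.le_measure fun a b hab => ?_
    have hmeas : Measurable fun x : E => infDist x Ωᶜ := (continuous_infDist_pt _).measurable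
    rw [Measure.map_apply hmeas measurableSet_Ioc,
      Measure.restrict_apply (hmeas measurableSet_Ioc), hFd]
    have hsub : (fun x => infDist x Ωᶜ) ⁻¹' Ioc a b ∩ Ω ⊆
        {x | max 0 (min a R) < infDist x Ωᶜ} \ {x | max 0 (min b R) < infDist x Ωᶜ} := by
      rintro x ⟨⟨hxa, hxb⟩, hx⟩
      have hx0 : 0 < infDist x Ωᶜ := lt_infDist_compl ho hb (by simpa using hx)
      have hxR := infDist_compl_le hm hn ho hb hc hR.le hS x
      exact ⟨(hiff a _ hx0 hxR).1 hxa, fun h => absurd ((hiff b _ hx0 hxR).2 h) (not_lt.2 hxb)⟩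
    refine (measure_mono hsub).trans ?_
    have hfin : volume {x | max 0 (min b R) < infDist x Ωᶜ} ≠ ∞ := by
      refine (hb.subset fun x hx => ?_).measure_lt_top.ne
      exact closedBall_subset_of_lt_infDist hx (mem_closedBall_self (hcl b).1)
    have hsub' : {x | max 0 (min b R) < infDist x Ωᶜ} ⊆ {x | max 0 (min a R) < infDist x Ωᶜ} :=
      fun x (hx : _ < _) => (hcm hab.le).trans_lt hx
    rw [measure_sdiff hsub'
      (measurableSet_lt measurable_const hmeas).nullMeasurableSet hfin]
    exact tsub_le_iff_left.2
      (volume_lt_infDist_le hm hn ho hb hc hS (hcl a).1 (hcm hab.le) (hcl b).2)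
  refine h1.trans_eq (Measure.ext_of_Ioc _ _ fun a b hab => ?_)
  have hmeas : Measurable fun x : E => R - ‖x‖ := by fun_prop
  rw [F.measure_Ioc, Measure.map_apply hmeas measurableSet_Ioc,
    Measure.restrict_apply (hmeas measurableSet_Ioc), hFd]
  have hset : (fun x : E => R - ‖x‖) ⁻¹' Ioc a b ∩ ball 0 R =
      ball 0 (R - max 0 (min a R)) \ ball 0 (R - max 0 (min b R)) := by
    refine Subset.antisymm ?_ ?_
    rotate_left
    · rintro x ⟨h1, h2⟩
      rw [mem_ball_zero_iff] at h1 h2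
      have h3 : 0 < R - ‖x‖ := by linarith [(hcl a).1]
      have h4 : R - ‖x‖ ≤ R := by linarith [norm_nonneg x]
      exact ⟨⟨(hiff a _ h3 h4).2 (by linarith), not_lt.1 fun h =>
        h2 (by linarith [(hiff b _ h3 h4).1 h])⟩, by rw [mem_ball_zero_iff]; linarith⟩
    rintro x ⟨⟨h1, h2⟩, h3⟩
    rw [mem_ball_zero_iff] at h3
    have h3 : 0 < R - ‖x‖ := by linarith
    have h4 : R - ‖x‖ ≤ R := by linarith [norm_nonneg x]
    refine ⟨?_, fun h => ?_⟩
    · rw [mem_ball_zero_iff]; linarith [(hiff a _ h3 h4).1 h1]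
    · rw [mem_ball_zero_iff] at h
      exact absurd ((hiff b _ h3 h4).2 (by linarith)) (not_lt.2 h2)
  have hvol : ∀ s, volume (ball (0 : E) (R - max 0 (min s R))) =
      ENNReal.ofReal (ω * (R - max 0 (min s R)) ^ (m + 1)) := fun s => by
    have h0 : 0 ≤ R - max 0 (min s R) := sub_nonneg.2 (hcl s).2
    rw [mul_comm, hω, ← volume_real_ball hn h0, measureReal_def,
      ENNReal.ofReal_toReal measure_closedBall_lt_top.ne, Measure.addHaar_closedBall_eq_addHaar_ball]
  rw [hset, measure_sdiff (ball_subset_ball (by linarith [hcm hab.le]))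
    measurableSet_ball.nullMeasurableSet measure_ball_lt_top.ne, hvol, hvol,
    ← ENNReal.ofReal_sub _ (mul_nonneg measureReal_nonneg (pow_nonneg (sub_nonneg.2 (hcl b).2) _)),
    mul_sub]

end

open scoped Classical in
/-- The modulus of the derivative of `h`, with value `K` where `h` is not differentiable. -/
def radialSlope (K : ℝ) (h : ℝ → ℝ) (s : ℝ) : ℝ := if DifferentiableAt ℝ h s then ‖deriv h s‖ else K

theorem radialSlope_nonneg {K : ℝ} (hK : 0 ≤ K) (h : ℝ → ℝ) (s : ℝ) : 0 ≤ radialSlope K h s := by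
  unfold radialSlope; split_ifs
  · exact norm_nonneg _
  · exact hK

theorem radialSlope_le {K : ℝ≥0} {h : ℝ → ℝ} (hh : LipschitzWith K h) (s : ℝ) : radialSlope K h s ≤ K := by
  unfold radialSlope; split_ifs
  · exact norm_deriv_le_of_lipschitz hh
  · exact le_rfl

theorem measurable_radialSlope (K : ℝ) (h : ℝ → ℝ) : Measurable (radialSlope K h) := by
  classical
  exact Measurable.ite (measurableSet_of_differentiableAt ℝ h) (measurable_deriv h).norm
    measurable_const

section
variable {E : Type*} [NormedAddCommGroup E] [InnerProductSpace ℝ E]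

theorem norm_fderiv_comp_le {K : ℝ≥0} {h : ℝ → ℝ} (hh : LipschitzWith K h) {d : E → ℝ}
    (hd : LipschitzWith 1 d) (x : E) : ‖fderiv ℝ (fun y => h (d y)) x‖ ≤ radialSlope K h (d x) := by
  have hL : LipschitzWith K fun y => h (d y) := (mul_one K) ▸ hh.comp hd
  unfold radialSlope
  split_ifs with hdiff
  · by_cases hu : DifferentiableAt ℝ (fun y => h (d y)) x
    · refine le_of_forall_pos_le_add fun ε hε => ?_
      refine hu.hasFDerivAt.le_of_lip' (by positivity) ?_
      have h1 := hdiff.hasDerivAt.isLittleO.bound hε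
      filter_upwards [hd.continuous.continuousAt.eventually h1] with y hy
      have h2 := hd.dist_le_mul y x
      rw [NNReal.coe_one, one_mul, dist_eq_norm, dist_eq_norm] at h2
      have h3 : h (d y) - h (d x) = (h (d y) - h (d x) - (d y - d x) • deriv h (d x)) +
        (d y - d x) • deriv h (d x) := by ring
      rw [h3]
      refine (norm_add_le _ _).trans ((add_le_add_left hy _).trans ?_)
      rw [norm_smul, add_mul, mul_comm ‖deriv h (d x)‖, add_comm]
      gcongr
    · rw [fderiv_zero_of_not_differentiableAt hu]
      simp
  · exact norm_fderiv_le_of_lipschitz ℝ hL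

theorem radialSlope_norm_le {K : ℝ} {h : ℝ → ℝ} {v : E → ℝ} {x : E} (hx : x ≠ 0)
    (hv : v =ᶠ[nhds x] fun y => h ‖y‖) (hd : DifferentiableAt ℝ v x) :
    radialSlope K h ‖x‖ ≤ ‖fderiv ℝ v x‖ := by
  have hx0 := norm_pos_iff.2 hx
  have h1 := (hd.hasFDerivAt.congr_of_eventuallyEq hv.symm)
  have hl : HasDerivAt (fun s : ℝ => (s / ‖x‖) • x) ((1 / ‖x‖) • x) ‖x‖ :=
    ((hasDerivAt_id _).div_const _).smul_const x
  have hx1 : (‖x‖ / ‖x‖) • x = x := by rw [div_self hx0.ne', one_smul]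
  have h2 : HasDerivAt (fun s : ℝ => h ‖(s / ‖x‖) • x‖) (fderiv ℝ v x ((1 / ‖x‖) • x)) ‖x‖ :=
    HasFDerivAt.comp_hasDerivAt (l := fun y : E => h ‖y‖) _ (by rwa [hx1]) hl
  have h3 : HasDerivAt h (fderiv ℝ v x ((1 / ‖x‖) • x)) ‖x‖ := by
    refine h2.congr_of_eventuallyEq ?_
    filter_upwards [lt_mem_nhds hx0] with s hs
    rw [norm_smul, norm_div, norm_norm, div_mul_cancel₀ _ hx0.ne', Real.norm_of_nonneg hs.le]
  rw [radialSlope, if_pos h3.differentiableAt, h3.deriv]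
  refine (ContinuousLinearMap.le_opNorm _ _).trans_eq ?_
  rw [norm_smul, norm_div, norm_norm, norm_one, one_div_mul_cancel hx0.ne', mul_one]

variable [FiniteDimensional ℝ E] [MeasurableSpace E] [BorelSpace E]

theorem integral_comp_infDist_le [Nontrivial E] {m : ℕ} (hm : m ≠ 0)
    (hn : Module.finrank ℝ E = m + 1) {Ω : Set E}
    (ho : IsOpen Ω) (hb : IsBounded Ω) (hc : Convex ℝ Ω) {R : ℝ} (hR : 0 < R)
    (hS : μHE[m] (frontier Ω) ≤
      ENNReal.ofReal ((m + 1) * volume.real (closedBall (0 : E) 1) * R ^ m))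
    {g : ℝ → ℝ} (hg : Measurable g) (hg0 : ∀ s, 0 ≤ g s) {C : ℝ} (hgC : ∀ s, g s ≤ C) :
    ∫ x in Ω, g (R - infDist x Ωᶜ) ≤ ∫ x in ball (0 : E) R, g ‖x‖ := by
  have h1 := map_infDist_compl_le hm hn ho hb hc hR hS
  have hg' : Measurable fun s => g (R - s) := hg.comp (measurable_const.sub measurable_id)
  have hmd : Measurable fun x : E => infDist x Ωᶜ := (continuous_infDist_pt _).measurable
  have hmn : Measurable fun x : E => R - ‖x‖ := by fun_prop
  have e1 : ∫ x in Ω, g (R - infDist x Ωᶜ) =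
      ∫ s, g (R - s) ∂(volume.restrict Ω).map fun x => infDist x Ωᶜ :=
    (integral_map hmd.aemeasurable hg'.aestronglyMeasurable).symm
  have e2 : ∫ x in ball (0 : E) R, g ‖x‖ =
      ∫ s, g (R - s) ∂(volume.restrict (ball (0 : E) R)).map fun x => R - ‖x‖ := by
    rw [integral_map hmn.aemeasurable hg'.aestronglyMeasurable]
    simp
  rw [e1, e2]
  have : IsFiniteMeasure (volume.restrict (ball (0 : E) R)) :=
    ⟨by rw [Measure.restrict_apply_univ]; exact measure_ball_lt_top⟩
  have : IsFiniteMeasure ((volume.restrict (ball (0 : E) R)).map fun x => R - ‖x‖) :=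
    Measure.isFiniteMeasure_map _ _
  refine integral_mono_measure h1 (Filter.Eventually.of_forall fun s => hg0 _) ?_
  refine Integrable.of_bound hg'.aestronglyMeasurable C (Filter.Eventually.of_forall fun s => ?_)
  rw [Real.norm_of_nonneg (hg0 _)]
  exact hgC _

theorem volume_le_volume_ball [Nontrivial E] {m : ℕ} (hm : m ≠ 0)
    (hn : Module.finrank ℝ E = m + 1) {Ω : Set E}
    (ho : IsOpen Ω) (hb : IsBounded Ω) (hc : Convex ℝ Ω) {R : ℝ} (hR : 0 < R)
    (hS : μHE[m] (frontier Ω) ≤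
      ENNReal.ofReal ((m + 1) * volume.real (closedBall (0 : E) 1) * R ^ m)) :
    volume.real Ω ≤ volume.real (ball (0 : E) R) := by
  have := integral_comp_infDist_le hm hn ho hb hc hR hS (g := fun _ => 1) measurable_const
    (fun _ => zero_le_one) (fun _ => le_rfl)
  simpa using this

end

section
variable {E : Type*} [NormedAddCommGroup E] [InnerProductSpace ℝ E]
  [FiniteDimensional ℝ E] [MeasurableSpace E] [BorelSpace E]

theorem integrableOn_rpow_of_le {S : Set E} (hSm : MeasurableSet S) (hS : IsBounded S) {f : E → ℝ}
    (hf : Measurable f) {C p : ℝ} (hp : 0 ≤ p) (h : ∀ x ∈ S, 0 ≤ f x ∧ f x ≤ C) :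
    IntegrableOn (fun x => f x ^ p) S := by
  refine Measure.integrableOn_of_bounded (M := C ^ p) hS.measure_lt_top.ne
    (hf.pow_const p).aestronglyMeasurable ?_
  filter_upwards [ae_restrict_mem hSm] with x hx
  rw [Real.norm_of_nonneg (Real.rpow_nonneg (h x hx).1 p)]
  exact Real.rpow_le_rpow (h x hx).1 (h x hx).2 hp

theorem integral_fderiv_le [Nontrivial E] {m : ℕ} (hm : m ≠ 0)
    (hn : Module.finrank ℝ E = m + 1) {Ω : Set E}
    (ho : IsOpen Ω) (hb : IsBounded Ω) (hc : Convex ℝ Ω) {R : ℝ} (hR : 0 < R)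
    (hS : μHE[m] (frontier Ω) ≤
      ENNReal.ofReal ((m + 1) * volume.real (closedBall (0 : E) 1) * R ^ m))
    {K : ℝ≥0} {h : ℝ → ℝ} (hh : LipschitzWith K h) {p : ℝ} (hp : 0 ≤ p) {v : E → ℝ}
    (hv : ∀ x ∈ ball (0 : E) R, v x = h ‖x‖) :
    ∫ x in Ω, ‖fderiv ℝ (fun y => h (R - infDist y Ωᶜ)) x‖ ^ p ≤
      ∫ x in ball (0 : E) R, ‖fderiv ℝ v x‖ ^ p := by
  have hd : LipschitzWith 1 fun y : E => R - infDist y Ωᶜ := LipschitzWith.of_dist_le_mul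
    fun x y => by
      rw [dist_sub_left]
      exact (lipschitz_infDist_pt Ωᶜ).dist_le_mul x y
  have hvL : LipschitzWith K fun y : E => h ‖y‖ := (mul_one K) ▸ hh.comp lipschitzWith_one_norm
  have hev : ∀ x ∈ ball (0 : E) R, v =ᶠ[nhds x] fun y => h ‖y‖ := fun x hx => by
    filter_upwards [isOpen_ball.mem_nhds hx] with y hy using hv y hy
  have hg0 := radialSlope_nonneg K.2 h
  have hgm := measurable_radialSlope K h
  calc ∫ x in Ω, ‖fderiv ℝ (fun y => h (R - infDist y Ωᶜ)) x‖ ^ p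
      ≤ ∫ x in Ω, radialSlope K h (R - infDist x Ωᶜ) ^ p := by
        refine integral_mono_of_nonneg (Filter.Eventually.of_forall fun x => by positivity)
          (integrableOn_rpow_of_le ho.measurableSet hb (f := fun x =>
            radialSlope K h (R - infDist x Ωᶜ)) (hgm.comp hd.continuous.measurable) hp
            (fun x _ => ⟨hg0 _, radialSlope_le hh _⟩))
          (Filter.Eventually.of_forall fun x => ?_)
        exact Real.rpow_le_rpow (norm_nonneg _) (norm_fderiv_comp_le hh hd x) hp
    _ ≤ ∫ x in ball (0 : E) R, radialSlope K h ‖x‖ ^ p :=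
        integral_comp_infDist_le hm hn ho hb hc hR hS (g := fun s => radialSlope K h s ^ p)
          (hgm.pow_const p) (fun s => Real.rpow_nonneg (hg0 s) p) (C := (K : ℝ) ^ p)
          fun s => Real.rpow_le_rpow (hg0 s) (radialSlope_le hh s) hp
    _ ≤ ∫ x in ball (0 : E) R, ‖fderiv ℝ v x‖ ^ p := by
        refine integral_mono_of_nonneg
          (Filter.Eventually.of_forall fun x => Real.rpow_nonneg (hg0 _) p)
          (integrableOn_rpow_of_le measurableSet_ball isBounded_ball
            (measurable_fderiv ℝ v).norm hp (C := K) fun x hx => ⟨norm_nonneg _, ?_⟩) ?_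
        · rw [(hev x hx).fderiv_eq]
          exact norm_fderiv_le_of_lipschitz ℝ hvL
        · filter_upwards [ae_restrict_mem measurableSet_ball,
            ae_restrict_of_ae (hvL.ae_differentiableAt (μ := volume)),
            ae_restrict_of_ae (Measure.ae_ne volume (0 : E))] with x hx hdx hx0
          exact Real.rpow_le_rpow (hg0 _) (radialSlope_norm_le hx0 (hev x hx)
            (hdx.congr_of_eventuallyEq (hev x hx))) hp

theorem integral_rpow_sub_ge [Nontrivial E] {m : ℕ} (hm : m ≠ 0)
    (hn : Module.finrank ℝ E = m + 1) {Ω : Set E}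
    (ho : IsOpen Ω) (hb : IsBounded Ω) (hc : Convex ℝ Ω) {R : ℝ} (hR : 0 < R)
    (hS : μHE[m] (frontier Ω) ≤
      ENNReal.ofReal ((m + 1) * volume.real (closedBall (0 : E) 1) * R ^ m))
    {h : ℝ → ℝ} (hh : Measurable h) {p a C : ℝ} (hp : 0 ≤ p) (ha : 0 ≤ a)
    (hah : ∀ s, a ≤ h s) (hhC : ∀ s, h s ≤ C) {v : E → ℝ}
    (hv : ∀ x ∈ ball (0 : E) R, v x = h ‖x‖) :
    a ^ p * (volume.real (ball (0 : E) R) - volume.real Ω) ≤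
      (∫ x in ball (0 : E) R, |v x| ^ p) - ∫ x in Ω, |h (R - infDist x Ωᶜ)| ^ p := by
  have h0 : ∀ s, 0 ≤ h s := fun s => ha.trans (hah s)
  have h1 := integral_comp_infDist_le hm hn ho hb hc hR hS (g := fun s => h s ^ p - a ^ p)
    ((hh.pow_const p).sub_const _)
    (fun s => sub_nonneg.2 (Real.rpow_le_rpow ha (hah s) hp)) (C := C ^ p - a ^ p)
    fun s => sub_le_sub_right (Real.rpow_le_rpow (h0 s) (hhC s) hp) _
  have e1 : ∫ x in ball (0 : E) R, |v x| ^ p = ∫ x in ball (0 : E) R, h ‖x‖ ^ p :=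
    setIntegral_congr_fun measurableSet_ball fun x hx => by
      rw [hv x hx, abs_of_nonneg (h0 _)]
  have e2 : ∫ x in Ω, |h (R - infDist x Ωᶜ)| ^ p = ∫ x in Ω, h (R - infDist x Ωᶜ) ^ p :=
    integral_congr_ae (Filter.Eventually.of_forall fun x => by
      beta_reduce
      rw [abs_of_nonneg (h0 _)])
  rw [integral_sub (integrableOn_rpow_of_le ho.measurableSet hb (f := fun x =>
      h (R - infDist x Ωᶜ)) (hh.comp ((continuous_infDist_pt _).measurable.const_sub _)) hp
      fun x _ => ⟨h0 _, hhC _⟩) (integrableOn_const hb.measure_lt_top.ne),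
    integral_sub (integrableOn_rpow_of_le measurableSet_ball isBounded_ball (f := fun x : E =>
      h ‖x‖) (hh.comp measurable_norm) hp
      fun x _ => ⟨h0 _, hhC _⟩) (integrableOn_const measure_ball_lt_top.ne),
    setIntegral_const, setIntegral_const, smul_eq_mul, smul_eq_mul] at h1
  rw [e1, e2]
  linarith

end

section
variable {E : Type*} [NormedAddCommGroup E] [InnerProductSpace ℝ E]
  [FiniteDimensional ℝ E] [MeasurableSpace E] [BorelSpace E]

theorem euclideanHausdorffMeasure_sphere_center_le {m : ℕ} (hn : Module.finrank ℝ E = m + 1)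
    (z : E) {R : ℝ} (hR : 0 < R) : μHE[m] (sphere z R) ≤
      ENNReal.ofReal ((m + 1) * volume.real (closedBall (0 : E) 1) * R ^ m) := by
  refine le_trans ?_ (euclideanHausdorffMeasure_sphere_le hn hR)
  rw [← (isometry_add_left z).euclideanHausdorffMeasure_image (sphere 0 R)]
  refine measure_mono fun x hx => ⟨x - z, ?_, add_sub_cancel _ _⟩
  rwa [mem_sphere_zero_iff_norm, ← dist_eq_norm]

theorem euclideanHausdorffMeasure_frontier_inter_le {m : ℕ} (hn : Module.finrank ℝ E = m + 1)
    {Ω : Set E} (ho : IsOpen Ω) (hc : Convex ℝ Ω) (hne : Ω.Nonempty) (z : E) {δ : ℝ}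
    (hδ : 0 < δ) : μHE[m] (frontier Ω ∩ closedBall z δ) ≤
      ENNReal.ofReal ((m + 1) * volume.real (closedBall (0 : E) 1) * (2 * δ) ^ m) := by
  have hex : ∀ y : E, ∃ q : E, y ∈ frontier Ω ∩ closedBall z δ →
      q ∈ sphere z (2 * δ) ∧ ∀ x ∈ frontier Ω, inner ℝ (q - y) (x - y) ≤ 0 := fun y => by
    by_cases hy : y ∈ frontier Ω ∩ closedBall z δ
    · obtain ⟨a, ha, hlt⟩ := exists_norm_eq_one_inner_lt ho hc hne
        (fun h => (ho.frontier_eq ▸ hy.1).2 h)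
      obtain ⟨t, ht, htf⟩ := exists_ray_mem_frontier (isBounded_ball : IsBounded (ball z (2 * δ)))
        (x := y) (a := a) (closedBall_subset_ball (by linarith) hy.2)
        (norm_ne_zero_iff.1 (ha ▸ one_ne_zero))
      rw [frontier_ball _ (by positivity)] at htf
      refine ⟨y + t • a, fun _ => ⟨htf, fun x hx => ?_⟩⟩
      have hle : inner ℝ a x ≤ inner ℝ a y := by
        refine closure_minimal (fun x hx => ?_) (isClosed_le (f := fun x => inner ℝ a x)
          (g := fun _ => inner ℝ a y) (by fun_prop) (by fun_prop)) hx.1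
        exact (hlt x hx).le
      rw [add_sub_cancel_left, real_inner_smul_left, inner_sub_right]
      exact mul_nonpos_of_nonneg_of_nonpos ht (sub_nonpos.2 hle)
    · exact ⟨0, fun h => absurd h hy⟩
  choose q hq using hex
  set S := frontier Ω ∩ closedBall z δ
  have hanti : ∀ x ∈ S, ∀ y ∈ S, dist x y ≤ dist (q x) (q y) := fun x hx y hy => by
    have h1 := (hq x hx).2 y hy.1
    have h2 := (hq y hy).2 x hx.1
    have h3 := real_inner_le_norm (q x - q y) (x - y)
    have h4 : inner ℝ (q x - q y) (x - y) = - inner ℝ (q x - x) (y - x) -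
        inner ℝ (q y - y) (x - y) + inner ℝ (x - y) (x - y) := by
      rw [← neg_sub x y, inner_neg_right, neg_neg, ← inner_sub_left, ← inner_add_left]
      congr 1
      abel
    rw [real_inner_self_eq_norm_sq] at h4
    rw [dist_eq_norm, dist_eq_norm]
    rcases (norm_nonneg (x - y)).eq_or_lt with h0 | h0
    · rw [← h0]; positivity
    · refine le_of_mul_le_mul_right ?_ h0
      nlinarith
  have hinj : InjOn q S := fun x hx y hy hxy => by
    have := hanti x hx y hy
    rw [hxy, dist_self] at this
    exact dist_le_zero.1 this
  have hleft := hinj.leftInvOn_invFunOn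
  have hL : LipschitzOnWith 1 (Function.invFunOn q S) (q '' S) := by
    refine LipschitzOnWith.of_dist_le_mul ?_
    rintro _ ⟨x, hx, rfl⟩ _ ⟨y, hy, rfl⟩
    rw [hleft hx, hleft hy, NNReal.coe_one, one_mul]
    exact hanti x hx y hy
  have h1 := hL.euclideanHausdorffMeasure_image_le (m := m)
  rw [hleft.image_image] at h1
  refine h1.trans ((measure_mono ?_).trans
    (euclideanHausdorffMeasure_sphere_center_le hn z (R := 2 * δ) (by positivity)))
  rintro _ ⟨x, hx, rfl⟩
  exact (hq x hx).1

theorem euclideanHausdorffMeasure_frontier_lt_top {m : ℕ} (hn : Module.finrank ℝ E = m + 1)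
    {Ω : Set E} (ho : IsOpen Ω) (hb : IsBounded Ω) (hc : Convex ℝ Ω) (hne : Ω.Nonempty) :
    μHE[m] (frontier Ω) < ∞ := by
  obtain ⟨r, hr0, hr⟩ := hb.closure.subset_closedBall_lt 0 (0 : E)
  refine lt_of_le_of_lt (measure_mono ?_)
    ((euclideanHausdorffMeasure_frontier_inter_le hn ho hc hne 0 hr0).trans_lt
      ENNReal.ofReal_lt_top)
  exact fun x hx => ⟨hx, hr hx.1⟩

end

section
variable {E : Type*} [NormedAddCommGroup E] [InnerProductSpace ℝ E]

theorem exists_dist_le_of_smul_frontier {Ω : Set E} (hb : IsBounded Ω) (hc : Convex ℝ Ω)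
    (h0 : Ω ∈ nhds (0 : E)) : ∃ L : ℝ, 0 < L ∧ ∀ y ∈ frontier Ω, ∀ y' ∈ frontier Ω,
      ∀ s ∈ Icc (1 / 2 : ℝ) 1, ∀ s' ∈ Icc (1 / 2 : ℝ) 1,
      dist s s' ≤ L * dist (s • y) (s' • y') ∧ dist y y' ≤ L * dist (s • y) (s' • y') := by
  obtain ⟨K, hK⟩ := hc.lipschitz_gauge h0
  obtain ⟨D, hD0, hD⟩ := hb.closure.subset_closedBall_lt 0 (0 : E)
  have hmax : 0 < 2 * (1 + K * D) := by positivity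
  refine ⟨2 * (1 + K * D) + K, by positivity, fun y hy y' hy' s hs s' hs' => ?_⟩
  have hs0 : 0 ≤ s := by linarith [hs.1]
  have hs0' : 0 ≤ s' := by linarith [hs'.1]
  have h1 := hK.dist_le_mul (s • y) (s' • y')
  rw [gauge_smul_of_nonneg hs0, gauge_smul_of_nonneg hs0',
    (gauge_eq_one_iff_mem_frontier hc h0).2 hy, (gauge_eq_one_iff_mem_frontier hc h0).2 hy',
    smul_eq_mul, smul_eq_mul, mul_one, mul_one] at h1
  have hyD : ‖y'‖ ≤ D := by simpa using hD hy'.1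
  set δ := dist (s • y) (s' • y') with hδ
  have hδ0 : 0 ≤ δ := dist_nonneg
  refine ⟨h1.trans (by gcongr; linarith), ?_⟩
  have h2 : s * dist y y' ≤ δ + dist s s' * D := by
    have e : s * dist y y' = dist (s • y) (s • y') := by
      rw [dist_smul₀, Real.norm_of_nonneg hs0]
    have e' : dist (s' • y') (s • y') = dist s s' * ‖y'‖ := by
      rw [dist_eq_norm, ← sub_smul, norm_smul, dist_comm, ← dist_eq_norm]
    rw [e]
    refine (dist_triangle _ (s' • y') _).trans ?_
    rw [e']
    gcongr
  have h3 : dist s s' * D ≤ K * δ * D := by gcongr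
  have h4 : 1 / 2 * dist y y' ≤ s * dist y y' := by gcongr; exact hs.1
  have h5 : 0 ≤ (K : ℝ) * δ := by positivity
  nlinarith

variable [FiniteDimensional ℝ E] [MeasurableSpace E] [BorelSpace E]

theorem exists_map_smul_le {m : ℕ} (hn : Module.finrank ℝ E = m + 1) {Ω : Set E}
    (ho : IsOpen Ω) (hb : IsBounded Ω) (hc : Convex ℝ Ω) (h0 : (0 : E) ∈ Ω) :
    ∃ C : ℝ≥0, ((μHE[m].restrict (frontier Ω)).prod
      (volume.restrict (Icc (1 / 2 : ℝ) 1))).map (fun z => z.2 • z.1) ≤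
        C • (volume : Measure E) := by
  obtain ⟨L, hL0, hL⟩ := exists_dist_le_of_smul_frontier hb hc (ho.mem_nhds h0)
  set Φ : E × ℝ → E := fun z => z.2 • z.1 with hΦ
  have hΦc : Continuous Φ := by fun_prop
  have hfin : IsFiniteMeasure (μHE[m].restrict (frontier Ω)) :=
    ⟨by rw [Measure.restrict_apply_univ]
        exact euclideanHausdorffMeasure_frontier_lt_top hn ho hb hc ⟨0, h0⟩⟩
  set μ := (μHE[m].restrict (frontier Ω)) with hμ
  set ι := (volume.restrict (Icc (1 / 2 : ℝ) 1)) with hι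
  set ω := volume.real (closedBall (0 : E) 1)
  set A : ℝ := (m + 1) * ω * (2 * L) ^ m * (2 * L) + 1 with hA
  have hω : 0 ≤ ω := measureReal_nonneg
  have hA0 : 0 < A := by positivity
  have hae : ∀ᵐ z ∂(μ.prod ι), z.1 ∈ frontier Ω ∧ z.2 ∈ Icc (1 / 2 : ℝ) 1 :=
    (Measure.quasiMeasurePreserving_fst.ae (ae_restrict_mem isClosed_frontier.measurableSet)).and
      (Measure.quasiMeasurePreserving_snd.ae (ae_restrict_mem measurableSet_Icc))
  have key : ∀ T : Set E, IsClosed T → ∀ δ > 0, ediam T ≤ ENNReal.ofReal δ →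
      (μ.prod ι).map Φ T ≤ ENNReal.ofReal (A * δ ^ (m + 1)) := by
    intro T hT δ hδ hTδ
    rw [Measure.map_apply hΦc.measurable hT.measurableSet]
    by_cases hex : ∃ z : E × ℝ, Φ z ∈ T ∧ z.1 ∈ frontier Ω ∧ z.2 ∈ Icc (1 / 2 : ℝ) 1
    · obtain ⟨z₀, hz₀T, hz₀, hz₀'⟩ := hex
      have hsub : Φ ⁻¹' T ≤ᵐ[μ.prod ι] closedBall z₀.1 (L * δ) ×ˢ closedBall z₀.2 (L * δ) := by
        filter_upwards [hae] with z hz hzT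
        have h1 := hL z.1 hz.1 z₀.1 hz₀ z.2 hz.2 z₀.2 hz₀'
        have h2 : dist (z.2 • z.1) (z₀.2 • z₀.1) ≤ δ := by
          have := (edist_le_ediam_of_mem hzT hz₀T).trans hTδ
          rwa [edist_dist, ENNReal.ofReal_le_ofReal_iff hδ.le] at this
        have h3 := mul_le_mul_of_nonneg_left h2 hL0.le
        exact ⟨h1.2.trans h3, h1.1.trans h3⟩
      refine (measure_mono_ae hsub).trans ?_
      rw [Measure.prod_prod, hμ, Measure.restrict_apply measurableSet_closedBall, inter_comm]
      refine (mul_le_mul' (euclideanHausdorffMeasure_frontier_inter_le hn ho hc ⟨0, h0⟩ z₀.1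
        (mul_pos hL0 hδ)) (Measure.restrict_apply_le _ _)).trans ?_
      rw [Real.volume_closedBall, ← ENNReal.ofReal_mul (by positivity)]
      refine ENNReal.ofReal_le_ofReal ?_
      have e : A * δ ^ (m + 1) =
          (m + 1) * ω * (2 * (L * δ)) ^ m * (2 * (L * δ)) + δ ^ (m + 1) := by
        rw [hA, ← mul_assoc 2 L δ, mul_pow, pow_succ δ]; ring
      rw [e]
      exact le_add_of_nonneg_right (by positivity)
    · have : (μ.prod ι) (Φ ⁻¹' T) = 0 := by
        refine measure_mono_null_ae ?_ measure_empty
        filter_upwards [hae] with z hz hzT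
        exact hex ⟨z, hzT, hz⟩
      rw [this]
      exact zero_le
  have key2 : ∀ T : Set E, ediam T ≤ 1 →
      (μ.prod ι).map Φ T ≤ ENNReal.ofReal A * ediam T ^ (((m + 1 : ℕ) : ℝ)) := by
    intro T hT
    have hne : ediam T ≠ ∞ := (hT.trans_lt ENNReal.one_lt_top).ne
    have hcont : Continuous fun δ : ℝ => ENNReal.ofReal (A * δ ^ (m + 1)) :=
      ENNReal.continuous_ofReal.comp (by fun_prop)
    have hlim := (hcont.tendsto (ediam T).toReal).mono_left
      (nhdsWithin_le_nhds (s := Ioi (ediam T).toReal))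
    rw [ENNReal.ofReal_mul hA0.le, ENNReal.ofReal_pow ENNReal.toReal_nonneg,
      ENNReal.ofReal_toReal hne] at hlim
    rw [ENNReal.rpow_natCast]
    refine ge_of_tendsto hlim ?_
    filter_upwards [self_mem_nhdsWithin] with δ hδ
    refine (measure_mono subset_closure).trans (key _ isClosed_closure δ
      (ENNReal.toReal_nonneg.trans_lt hδ) ?_)
    rw [ediam_closure, ← ENNReal.ofReal_toReal hne]
    exact ENNReal.ofReal_le_ofReal (le_of_lt hδ)
  have hA1 : ENNReal.ofReal A ≠ 0 := by simpa using hA0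
  have key3 : (ENNReal.ofReal A)⁻¹ • (μ.prod ι).map Φ ≤ μH[((m + 1 : ℕ) : ℝ)] := by
    refine Measure.le_hausdorffMeasure _ _ 1 one_pos fun T hT => ?_
    rw [Measure.smul_apply, smul_eq_mul, mul_comm, ← div_eq_mul_inv]
    exact ENNReal.div_le_of_le_mul' (key2 T hT)
  have hvol : ∀ T, (volume : Measure E) T = hausdorffFactor (m + 1) * μH[((m + 1 : ℕ) : ℝ)] T :=
    fun T => by
      rw [← euclideanHausdorffMeasure_apply, ← hn,
        InnerProductSpace.euclideanHausdorffMeasure_eq_volume]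
  have hk := hausdorffFactor_pos (m + 1)
  refine ⟨(hausdorffFactor (m + 1))⁻¹ * A.toNNReal, Measure.le_iff.2 fun T _ => ?_⟩
  have h4 := key3 T
  rw [Measure.smul_apply, smul_eq_mul, mul_comm, ← div_eq_mul_inv,
    ENNReal.div_le_iff' hA1 ENNReal.ofReal_ne_top] at h4
  refine h4.trans_eq ?_
  have h5 : ((hausdorffFactor (m + 1))⁻¹ : ℝ≥0∞) * hausdorffFactor (m + 1) = 1 :=
    ENNReal.inv_mul_cancel (by simpa using hk.ne') ENNReal.coe_ne_top
  rw [Measure.smul_apply, hvol, ENNReal.smul_def, smul_eq_mul, ENNReal.coe_mul, ENNReal.ofReal,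
    ENNReal.coe_inv hk.ne']
  calc (A.toNNReal : ℝ≥0∞) * μH[((m + 1 : ℕ) : ℝ)] T
      = (((hausdorffFactor (m + 1))⁻¹ : ℝ≥0∞) * hausdorffFactor (m + 1)) *
        (A.toNNReal * μH[((m + 1 : ℕ) : ℝ)] T) := by rw [h5, one_mul]
    _ = _ := by ring

end

section
variable {E : Type*} [NormedAddCommGroup E] [InnerProductSpace ℝ E]

theorem enorm_le_add_lintegral_fderiv {K : ℝ≥0} {W : E → ℝ} (hW : LipschitzWith K W) {y : E}
    {D : ℝ≥0} (hy : ‖y‖ₑ ≤ D)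
    (hd : ∀ᵐ τ ∂(volume.restrict (Icc (1 / 2 : ℝ) 1)), DifferentiableAt ℝ W (τ • y))
    {s : ℝ} (hs : s ∈ Icc (1 / 2 : ℝ) 1) :
    ‖W y‖ₑ ≤ ‖W (s • y)‖ₑ + D * ∫⁻ τ in Icc (1 / 2 : ℝ) 1, ‖fderiv ℝ W (τ • y)‖ₑ := by
  set g : ℝ → ℝ := fun τ => W (τ • y)
  have hg : LipschitzWith (K * ‖y‖₊) g := by
    refine LipschitzWith.of_dist_le_mul fun a b => (hW.dist_le_mul _ _).trans_eq ?_
    rw [dist_eq_norm (a • y), ← sub_smul, norm_smul, dist_eq_norm a]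
    push_cast
    ring
  have hI := (hg.lipschitzOnWith (s := uIcc s 1)).absolutelyContinuousOnInterval.integral_deriv_eq_sub
  have hsub : Ioc s 1 ⊆ Icc (1 / 2 : ℝ) 1 := fun τ hτ => ⟨hs.1.trans hτ.1.le, hτ.2⟩
  have h1 : ‖g 1 - g s‖ₑ ≤ D * ∫⁻ τ in Icc (1 / 2 : ℝ) 1, ‖fderiv ℝ W (τ • y)‖ₑ := by
    rw [← hI, intervalIntegral.integral_of_le hs.2]
    refine (enorm_integral_le_lintegral_enorm _).trans ?_
    rw [← lintegral_const_mul' _ _ ENNReal.coe_ne_top]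
    refine (lintegral_mono_set hsub).trans (lintegral_mono_ae ?_)
    filter_upwards [hd] with τ hτ
    have h2 : HasDerivAt g (fderiv ℝ W (τ • y) y) τ := by
      have h3 : HasDerivAt (fun τ : ℝ => τ • y) ((1 : ℝ) • y) τ := (hasDerivAt_id τ).smul_const y
      rw [one_smul] at h3
      exact hτ.hasFDerivAt.comp_hasDerivAt τ h3
    rw [h2.deriv, mul_comm]
    exact (ContinuousLinearMap.le_opENorm _ _).trans (by gcongr)
  have h4 : W y = g s + (g 1 - g s) := by simp [g]
  rw [h4]
  exact (enorm_add_le _ _).trans (by gcongr)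

theorem enorm_le_lintegral_add {K : ℝ≥0} {W : E → ℝ} (hW : LipschitzWith K W) {y : E}
    {D : ℝ≥0} (hy : ‖y‖ₑ ≤ D)
    (hd : ∀ᵐ τ ∂(volume.restrict (Icc (1 / 2 : ℝ) 1)), DifferentiableAt ℝ W (τ • y)) :
    ‖W y‖ₑ ≤ (2 + D : ℝ≥0) *
      ∫⁻ τ in Icc (1 / 2 : ℝ) 1, (‖W (τ • y)‖ₑ + ‖fderiv ℝ W (τ • y)‖ₑ) := by
  have hmeas : Measurable fun τ : ℝ => ‖W (τ • y)‖ₑ :=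
    (hW.continuous.comp (by fun_prop)).measurable.enorm
  set J := ∫⁻ τ in Icc (1 / 2 : ℝ) 1, ‖fderiv ℝ W (τ • y)‖ₑ
  have hv : volume (Icc (1 / 2 : ℝ) 1) = 2⁻¹ := by
    rw [Real.volume_Icc, show (1 - 1 / 2 : ℝ) = 2⁻¹ by norm_num, ENNReal.ofReal_inv_of_pos two_pos]
    simp
  have h1 : ‖W y‖ₑ * 2⁻¹ ≤ (∫⁻ τ in Icc (1 / 2 : ℝ) 1, ‖W (τ • y)‖ₑ) + D * J * 2⁻¹ := by
    rw [← hv, ← setLIntegral_const, ← setLIntegral_const, ← lintegral_add_left hmeas]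
    exact setLIntegral_mono' measurableSet_Icc fun s hs => enorm_le_add_lintegral_fderiv hW hy hd hs
  have h2 : ‖W y‖ₑ ≤ 2 * (∫⁻ τ in Icc (1 / 2 : ℝ) 1, ‖W (τ • y)‖ₑ) + D * J := by
    have h22 : (2⁻¹ : ℝ≥0∞) * 2 = 1 := ENNReal.inv_mul_cancel two_ne_zero (by simp)
    calc ‖W y‖ₑ = ‖W y‖ₑ * 2⁻¹ * 2 := by rw [mul_assoc, h22, mul_one]
      _ ≤ ((∫⁻ τ in Icc (1 / 2 : ℝ) 1, ‖W (τ • y)‖ₑ) + D * J * 2⁻¹) * 2 := by gcongr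
      _ = _ := by rw [add_mul, mul_assoc (_ * J), h22, mul_one, mul_comm]
  rw [lintegral_add_left hmeas, mul_add]
  push_cast
  refine h2.trans ?_
  gcongr
  · exact le_self_add
  · exact le_add_self

variable [FiniteDimensional ℝ E] [MeasurableSpace E] [BorelSpace E]

theorem lintegral_frontier_le_of_mem {m : ℕ} (hn : Module.finrank ℝ E = m + 1) {Ω : Set E}
    (ho : IsOpen Ω) (hb : IsBounded Ω) (hc : Convex ℝ Ω) (h0 : (0 : E) ∈ Ω) :
    ∃ C : ℝ≥0, ∀ (W : E → ℝ) (K : ℝ≥0), LipschitzWith K W →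
      ∫⁻ y in frontier Ω, ‖W y‖ₑ ∂μHE[m] ≤ C * ∫⁻ x in Ω, (‖W x‖ₑ + ‖fderiv ℝ W x‖ₑ) := by
  obtain ⟨C, hC⟩ := exists_map_smul_le hn ho hb hc h0
  obtain ⟨D, hD0, hD⟩ := hb.closure.subset_closedBall_lt 0 (0 : E)
  refine ⟨(2 + D.toNNReal) * C, fun W K hW => ?_⟩
  have hΦc : Continuous fun z : E × ℝ => z.2 • z.1 := by fun_prop
  have hfin : IsFiniteMeasure (μHE[m].restrict (frontier Ω)) :=
    ⟨by rw [Measure.restrict_apply_univ]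
        exact euclideanHausdorffMeasure_frontier_lt_top hn ho hb hc ⟨0, h0⟩⟩
  set μ := (μHE[m].restrict (frontier Ω)) with hμ
  set ι := (volume.restrict (Icc (1 / 2 : ℝ) 1)) with hι
  set ν := (μ.prod ι).map (fun z => z.2 • z.1) with hν
  have hae : ∀ᵐ z ∂(μ.prod ι), z.1 ∈ frontier Ω ∧ z.2 ∈ Icc (1 / 2 : ℝ) 1 :=
    (Measure.quasiMeasurePreserving_fst.ae (ae_restrict_mem isClosed_frontier.measurableSet)).and
      (Measure.quasiMeasurePreserving_snd.ae (ae_restrict_mem measurableSet_Icc))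
  have hνΩ : ∀ᵐ x ∂ν, x ∈ closure Ω := by
    refine (ae_map_iff (p := fun x => x ∈ closure Ω) hΦc.aemeasurable
      isClosed_closure.measurableSet).2 ?_
    filter_upwards [hae] with z hz
    have := hc.closure (subset_closure h0) hz.1.1 (a := 1 - z.2) (b := z.2)
      (by linarith [hz.2.2]) (by linarith [hz.2.1]) (by ring)
    simpa using this
  have hνd : ∀ᵐ x ∂ν, DifferentiableAt ℝ W x := by
    have h1 : ∀ᵐ x ∂(C • (volume : Measure E)), DifferentiableAt ℝ W x :=
      Measure.ae_smul_measure hW.ae_differentiableAt C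
    exact (Measure.absolutelyContinuous_of_le hC).ae_le h1
  have hdd : ∀ᵐ y ∂μ, ∀ᵐ τ ∂ι, DifferentiableAt ℝ W (τ • y) :=
    Measure.ae_ae_of_ae_prod (ae_of_ae_map hΦc.aemeasurable hνd)
  set F : E → ℝ≥0∞ := fun x => ‖W x‖ₑ + ‖fderiv ℝ W x‖ₑ with hF
  have hFm : Measurable F := hW.continuous.measurable.enorm.add (measurable_fderiv ℝ W).enorm
  have h1 : ∫⁻ y, ‖W y‖ₑ ∂μ ≤ (2 + D.toNNReal : ℝ≥0) * ∫⁻ y, ∫⁻ τ, F (τ • y) ∂ι ∂μ := by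
    rw [← lintegral_const_mul' _ _ ENNReal.coe_ne_top]
    refine lintegral_mono_ae ?_
    filter_upwards [hdd, ae_restrict_mem isClosed_frontier.measurableSet] with y hy hyΩ
    refine enorm_le_lintegral_add hW ?_ hy
    rw [← ofReal_norm]
    exact ENNReal.ofReal_le_ofReal (by simpa using hD hyΩ.1)
  have h2 : ∫⁻ y, ∫⁻ τ, F (τ • y) ∂ι ∂μ = ∫⁻ x in closure Ω, F x ∂ν := by
    rw [Measure.restrict_eq_self_of_ae_mem hνΩ, hν, lintegral_map hFm hΦc.measurable]
    exact (lintegral_prod _ (hFm.comp hΦc.measurable).aemeasurable).symm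
  have h3 : ∫⁻ x in closure Ω, F x ∂ν ≤ C * ∫⁻ x in Ω, F x := by
    refine (lintegral_mono' (Measure.restrict_mono' (ae_of_all _ fun _ h => h) hC) le_rfl).trans ?_
    rw [Measure.restrict_smul, lintegral_smul_measure, ENNReal.smul_def, smul_eq_mul]
    have h4 : (closure Ω : Set E) =ᵐ[volume] Ω := by
      rw [closure_eq_self_union_frontier]
      exact union_ae_eq_left_of_ae_eq_empty (ae_eq_empty.2 (hc.addHaar_frontier volume))
    rw [Measure.restrict_congr_set h4]
  rw [ENNReal.coe_mul, mul_assoc]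
  exact h1.trans (by rw [h2]; gcongr)

theorem lintegral_frontier_le {m : ℕ} (hn : Module.finrank ℝ E = m + 1) {Ω : Set E}
    (ho : IsOpen Ω) (hb : IsBounded Ω) (hc : Convex ℝ Ω) (hne : Ω.Nonempty) :
    ∃ C : ℝ≥0, ∀ (W : E → ℝ) (K : ℝ≥0), LipschitzWith K W →
      ∫⁻ y in frontier Ω, ‖W y‖ₑ ∂μHE[m] ≤ C * ∫⁻ x in Ω, (‖W x‖ₑ + ‖fderiv ℝ W x‖ₑ) := by
  obtain ⟨x₀, hx₀⟩ := hne
  set e : E ≃ᵢ E := IsometryEquiv.addLeft x₀ with he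
  have hbe : IsBounded (e ⁻¹' Ω) := by
    rw [← e.image_symm]
    exact e.symm.isometry.lipschitz.isBounded_image hb
  have hce : Convex ℝ (e ⁻¹' Ω) := hc.translate_preimage_right x₀
  obtain ⟨C, hC⟩ := lintegral_frontier_le_of_mem hn (ho.preimage e.continuous) hbe hce
    (by simpa [he] using hx₀)
  refine ⟨C, fun W K hW => ?_⟩
  have h1 := hC (W ∘ e) K (by simpa using hW.comp e.isometry.lipschitz)
  have hf : frontier (e ⁻¹' Ω) = e ⁻¹' frontier Ω := (e.toHomeomorph.preimage_frontier Ω).symm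
  have hfd : ∀ x, fderiv ℝ (W ∘ e) x = fderiv ℝ W (e x) := fun x => fderiv_comp_add_left x₀
  simp only [hfd, hf] at h1
  have p1 : MeasurePreserving e μHE[m] μHE[m] := e.measurePreserving_euclideanHausdorffMeasure m
  have p2 : MeasurePreserving e volume volume := measurePreserving_add_left volume x₀
  have hem : MeasurableEmbedding e := e.toHomeomorph.measurableEmbedding
  rw [← p1.setLIntegral_comp_preimage_emb hem, ← p2.setLIntegral_comp_preimage_emb hem]
  exact h1

end

theorem norm_deriv_abs_rpow {p : ℝ} (hp : 1 < p) (x : ℝ) :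
    ‖p * |x| ^ (p - 2) * x‖ = p * |x| ^ (p - 1) := by
  rw [norm_mul, norm_mul, Real.norm_of_nonneg (by linarith : (0 : ℝ) ≤ p),
    Real.norm_of_nonneg (Real.rpow_nonneg (abs_nonneg x) _), Real.norm_eq_abs, mul_assoc]
  congr 1
  rcases eq_or_ne x 0 with rfl | hx
  · rw [abs_zero, mul_zero, Real.zero_rpow (by linarith)]
  · rw [← Real.rpow_add_one (abs_ne_zero.2 hx)]
    ring_nf

theorem LipschitzOnWith.exists_abs_rpow {X : Type*} [PseudoMetricSpace X] {K : ℝ≥0} {u : X → ℝ}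
    {S : Set X} (hu : LipschitzOnWith K u S) {p : ℝ} (hp : 1 < p) {M : ℝ}
    (hM : ∀ x ∈ S, |u x| ≤ M) : ∃ K' : ℝ≥0, LipschitzOnWith K' (fun x => |u x| ^ p) S := by
  rcases S.eq_empty_or_nonempty with rfl | ⟨x₀, hx₀⟩
  · exact ⟨0, by simp⟩
  have hM0 : 0 ≤ M := (abs_nonneg _).trans (hM x₀ hx₀)
  have h1 : LipschitzOnWith (Real.toNNReal (p * M ^ (p - 1))) (fun t : ℝ => |t| ^ p)
      (Icc (-M) M) := by
    refine Convex.lipschitzOnWith_of_nnnorm_deriv_le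
      (fun t _ => (hasDerivAt_abs_rpow t hp).differentiableAt) (fun t ht => ?_) (convex_Icc _ _)
    rw [(hasDerivAt_abs_rpow t hp).deriv, ← NNReal.coe_le_coe, coe_nnnorm, norm_deriv_abs_rpow hp,
      Real.coe_toNNReal _ (by positivity)]
    have := abs_le.2 ht
    gcongr
  exact ⟨_, h1.comp hu fun x hx => abs_le.1 (hM x hx)⟩

theorem mul_mul_rpow_sub_one_le {p a b M : ℝ} (hp : 1 < p) (ha : 0 ≤ a) (hb : 0 ≤ b)
    (hM : 0 < M) : p * a * b ^ (p - 1) ≤ p * M * b ^ p + p * M ^ (-(p - 1)) * a ^ p := by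
  have hp0 : 0 < p := by linarith
  have key : ∀ c : ℝ, 0 ≤ c → c ^ p = c * c ^ (p - 1) := fun c hc => by
    rcases eq_or_lt_of_le hc with rfl | h
    · rw [zero_mul, Real.zero_rpow hp0.ne']
    · rw [mul_comm, ← Real.rpow_add_one h.ne']; ring_nf
  rcases le_total a (M * b) with h | h
  · have : p * a * b ^ (p - 1) ≤ p * M * b ^ p := by
      rw [key b hb]
      calc p * a * b ^ (p - 1) ≤ p * (M * b) * b ^ (p - 1) := by gcongr
        _ = _ := by ring
    have h2 : 0 ≤ p * M ^ (-(p - 1)) * a ^ p := by positivity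
    linarith
  · have h1 : b ≤ a / M := by rw [le_div_iff₀ hM]; linarith
    have : p * a * b ^ (p - 1) ≤ p * M ^ (-(p - 1)) * a ^ p := by
      rw [key a ha]
      calc p * a * b ^ (p - 1) ≤ p * a * (a / M) ^ (p - 1) := by gcongr
        _ = _ := by rw [Real.div_rpow ha hM.le, Real.rpow_neg hM.le]; ring
    have h2 : 0 ≤ p * M * b ^ p := by positivity
    linarith

section
variable {E : Type*} [NormedAddCommGroup E] [InnerProductSpace ℝ E] [FiniteDimensional ℝ E]
  [MeasurableSpace E] [BorelSpace E]

theorem ae_enorm_fderiv_abs_rpow_le {Ω : Set E} (ho : IsOpen Ω) {K : ℝ≥0} {u W : E → ℝ}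
    (hu : LipschitzOnWith K u (closure Ω)) {p : ℝ} (hp : 1 < p)
    (hW : EqOn (fun x => |u x| ^ p) W (closure Ω)) :
    ∀ᵐ x ∂(volume.restrict Ω), ‖fderiv ℝ W x‖ ≤ p * ‖fderiv ℝ u x‖ * |u x| ^ (p - 1) := by
  rw [ae_restrict_iff' ho.measurableSet]
  filter_upwards [(hu.mono subset_closure).ae_differentiableWithinAt_of_mem] with x hx hxΩ
  have hd : HasFDerivAt u (fderiv ℝ u x) x :=
    ((hx hxΩ).differentiableAt (ho.mem_nhds hxΩ)).hasFDerivAt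
  have h1 := (hasDerivAt_abs_rpow (u x) hp).comp_hasFDerivAt x hd
  have h2 : W =ᶠ[nhds x] (fun t : ℝ => |t| ^ p) ∘ u := by
    filter_upwards [ho.mem_nhds hxΩ] with y hy
    exact (hW (subset_closure hy)).symm
  rw [h2.fderiv_eq, h1.fderiv, norm_smul, norm_deriv_abs_rpow hp]
  exact le_of_eq (by ring)

theorem integrableOn_abs_rpow {Ω : Set E} (hb : IsBounded Ω) {u : E → ℝ}
    (hu : ContinuousOn u (closure Ω)) {p : ℝ} (hp : 0 ≤ p) :
    IntegrableOn (fun x => |u x| ^ p) Ω :=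
  ((hu.abs.rpow_const fun _ _ => Or.inr hp).integrableOn_compact hb.isCompact_closure).mono_set
    subset_closure

theorem integrableOn_norm_fderiv_rpow {Ω : Set E} (ho : IsOpen Ω) (hb : IsBounded Ω) {K : ℝ≥0}
    {u : E → ℝ} (hu : LipschitzOnWith K u (closure Ω)) {p : ℝ} (hp : 0 ≤ p) :
    IntegrableOn (fun x => ‖fderiv ℝ u x‖ ^ p) Ω :=
  integrableOn_rpow_of_le ho.measurableSet hb (measurable_fderiv ℝ u).norm hp fun _ hx =>
    ⟨norm_nonneg _, norm_fderiv_le_of_lipschitzOn ℝ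
      (Filter.mem_of_superset (ho.mem_nhds hx) subset_closure) hu⟩

theorem exists_mul_integral_frontier_le {m : ℕ} (hn : Module.finrank ℝ E = m + 1) {Ω : Set E}
    (ho : IsOpen Ω) (hb : IsBounded Ω) (hc : Convex ℝ Ω) (hne : Ω.Nonempty) {p : ℝ} (hp : 1 < p)
    {B : ℝ} (hB : 0 ≤ B) : ∃ C : ℝ, ∀ (u : E → ℝ) (K : ℝ≥0), LipschitzOnWith K u (closure Ω) →
      B * ∫ x in frontier Ω, |u x| ^ p ∂μHE[m] ≤
        (∫ x in Ω, ‖fderiv ℝ u x‖ ^ p) + C * ∫ x in Ω, |u x| ^ p := by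
  obtain ⟨C, hC⟩ := lintegral_frontier_le hn ho hb hc hne
  have hp0 : 0 ≤ p := by linarith
  obtain ⟨M, hM0, hM⟩ : ∃ M : ℝ, 0 < M ∧ B * C * p * M ^ (-(p - 1)) ≤ 1 := by
    have h1 := (tendsto_rpow_neg_atTop (sub_pos.2 hp)).const_mul (B * C * p)
    rw [mul_zero] at h1
    obtain ⟨M, h2, h3⟩ := ((h1.eventually (Iic_mem_nhds one_pos)).and
      (Filter.eventually_gt_atTop 0)).exists
    exact ⟨M, h3, h2⟩
  refine ⟨B * C * (1 + p * M), fun u K hu => ?_⟩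
  obtain ⟨N, hN⟩ := hb.isCompact_closure.exists_bound_of_continuousOn hu.continuousOn
  obtain ⟨K', hK'⟩ := hu.exists_abs_rpow hp hN
  obtain ⟨W, hWL, hW⟩ := hK'.extend_real
  have i1 := integrableOn_abs_rpow hb hu.continuousOn hp0
  have i2 := integrableOn_norm_fderiv_rpow ho hb hu hp0
  set U := ∫ x in Ω, |u x| ^ p with hU
  set G := ∫ x in Ω, ‖fderiv ℝ u x‖ ^ p with hG
  have hU0 : 0 ≤ U := by positivity
  have hG0 : 0 ≤ G := by positivity
  have hp1 : 0 ≤ p * M ^ (-(p - 1)) := by positivity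
  have hp2 : 0 ≤ 1 + p * M := by positivity
  have h1 : ∫⁻ x in Ω, (‖W x‖ₑ + ‖fderiv ℝ W x‖ₑ) ≤
      ENNReal.ofReal ((1 + p * M) * U + p * M ^ (-(p - 1)) * G) := by
    have i3 := (i1.const_mul (1 + p * M)).add (i2.const_mul (p * M ^ (-(p - 1))))
    have e : (1 + p * M) * U + p * M ^ (-(p - 1)) * G =
        ∫ x in Ω, ((1 + p * M) * |u x| ^ p + p * M ^ (-(p - 1)) * ‖fderiv ℝ u x‖ ^ p) := by
      rw [hU, hG, ← integral_const_mul, ← integral_const_mul]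
      exact (integral_add (i1.const_mul _) (i2.const_mul _)).symm
    have e' := ofReal_integral_eq_lintegral_ofReal i3
      (ae_of_all _ fun x => add_nonneg (mul_nonneg hp2 (by positivity))
        (mul_nonneg hp1 (by positivity)))
    rw [e]
    refine le_trans ?_ e'.ge
    refine lintegral_mono_ae ?_
    filter_upwards [ae_enorm_fderiv_abs_rpow_le ho hu hp hW, ae_restrict_mem ho.measurableSet]
      with x hx hxΩ
    rw [← ofReal_norm, ← ofReal_norm, ← ENNReal.ofReal_add (norm_nonneg _) (norm_nonneg _)]
    refine ENNReal.ofReal_le_ofReal ?_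
    have e : ‖W x‖ = |u x| ^ p := by
      rw [← hW (subset_closure hxΩ), Real.norm_of_nonneg (by positivity)]
    rw [e]
    have := mul_mul_rpow_sub_one_le hp (norm_nonneg (fderiv ℝ u x)) (abs_nonneg (u x)) hM0
    simp only [Pi.add_apply]
    linarith
  have h2 : ∫ x in frontier Ω, |u x| ^ p ∂μHE[m] ≤
      C * ((1 + p * M) * U + p * M ^ (-(p - 1)) * G) := by
    have e : ∫ x in frontier Ω, |u x| ^ p ∂μHE[m] = ∫ x in frontier Ω, ‖W x‖ ∂μHE[m] := by
      refine setIntegral_congr_fun isClosed_frontier.measurableSet fun x hx => ?_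
      rw [← hW hx.1, Real.norm_of_nonneg (by positivity)]
    rw [e, integral_norm_eq_lintegral_enorm hWL.continuous.aestronglyMeasurable]
    refine ENNReal.toReal_le_of_le_ofReal (by positivity) ((hC W K' hWL).trans ?_)
    rw [ENNReal.ofReal_mul C.coe_nonneg, ENNReal.ofReal_coe_nnreal]
    gcongr
  calc B * ∫ x in frontier Ω, |u x| ^ p ∂μHE[m]
      ≤ B * (C * ((1 + p * M) * U + p * M ^ (-(p - 1)) * G)) := by gcongr
    _ = B * C * p * M ^ (-(p - 1)) * G + B * C * (1 + p * M) * U := by ring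
    _ ≤ 1 * G + B * C * (1 + p * M) * U := by gcongr
    _ = _ := by ring

theorem integral_euclideanHausdorffMeasure (m : ℕ) (S : Set E) (f : E → ℝ) :
    ∫ x in S, f x ∂μHE[m] = hausdorffFactor m * ∫ x in S, f x ∂μH[(m : ℝ)] := by
  have h : (μHE[m] : Measure E) = hausdorffFactor m • μH[(m : ℝ)] :=
    Measure.ext fun s _ => by rw [euclideanHausdorffMeasure_apply]; rfl
  rw [h, Measure.restrict_smul, integral_smul_nnreal_measure]
  rfl

end

theorem bddBelow_rayleigh {m : ℕ} {p β : ℝ} (hp : 1 < p) (hβ : β ≤ 0)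
    {Ω : Set (EuclideanSpace ℝ (Fin (m + 1)))} (ho : IsOpen Ω) (hb : IsBounded Ω)
    (hc : Convex ℝ Ω) (hne : Ω.Nonempty) :
    BddBelow {r : ℝ | ∃ u : EuclideanSpace ℝ (Fin (m + 1)) → ℝ,
      (∃ K : ℝ≥0, LipschitzOnWith K u (closure Ω)) ∧ (0 < ∫ x in Ω, |u x| ^ p) ∧
        r = rayleigh (m + 1) p β Ω u} := by
  have hk : (0 : ℝ) < hausdorffFactor m := hausdorffFactor_pos m
  obtain ⟨C, hC⟩ := exists_mul_integral_frontier_le (m := m) (by simp) ho hb hc hne hp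
    (B := -β / hausdorffFactor m) (div_nonneg (by linarith) hk.le)
  refine ⟨-C, ?_⟩
  rintro r ⟨u, ⟨K, hu⟩, hpos, rfl⟩
  have h1 := hC u K hu
  rw [integral_euclideanHausdorffMeasure, ← mul_assoc, div_mul_cancel₀ _ hk.ne'] at h1
  have e : ((m + 1 : ℕ) : ℝ) - 1 = m := by push_cast; ring
  rw [rayleigh, le_div_iff₀ hpos, e]
  linarith

theorem isoperimetric_const_le {m : ℕ} (hm : m ≠ 0) {ω R ρ : ℝ} (hω : 0 < ω) (hR : 0 < R)
    (h : (m + 1) * ω * R ^ m ≤ ρ) :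
    ((m : ℝ) + 1) ^ (((m : ℝ) + 1) / m) * ω ^ (1 / (m : ℝ)) * ρ ^ (-(1 / (m : ℝ))) ≤
      ρ / (R ^ (m + 1) * ω) := by
  have hm0 : (0 : ℝ) < m := by exact_mod_cast Nat.pos_of_ne_zero hm
  have hn0 : (0 : ℝ) < m + 1 := by positivity
  set q := 1 / (m : ℝ) with hq
  have hq0 : 0 < q := by positivity
  have h0 : 0 < (m + 1) * ω * R ^ m := by positivity
  have h1 : ρ ^ (-q) ≤ ((m + 1) * ω * R ^ m) ^ (-q) :=
    Real.rpow_le_rpow_of_nonpos h0 h (by linarith)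
  have h2 : ((m + 1) * ω * R ^ m) ^ (-q) = ((m : ℝ) + 1) ^ (-q) * ω ^ (-q) * R⁻¹ := by
    rw [Real.mul_rpow (by positivity) (by positivity), Real.mul_rpow hn0.le hω.le,
      ← Real.rpow_natCast R m, ← Real.rpow_mul hR.le, ← Real.rpow_neg_one R]
    congr 2
    rw [hq]; field_simp
  have h3 : ((m : ℝ) + 1) ^ (((m : ℝ) + 1) / m) = (m + 1) * ((m : ℝ) + 1) ^ q := by
    rw [← Real.rpow_one_add' hn0.le (by positivity)]
    congr 1
    rw [hq]; field_simp
  have h4 : ((m : ℝ) + 1) ^ q * ((m : ℝ) + 1) ^ (-q) = 1 := by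
    rw [← Real.rpow_add hn0]; simp
  have h5 : ω ^ q * ω ^ (-q) = 1 := by rw [← Real.rpow_add hω]; simp
  calc _ ≤ ((m : ℝ) + 1) ^ (((m : ℝ) + 1) / m) * ω ^ q *
        (((m : ℝ) + 1) ^ (-q) * ω ^ (-q) * R⁻¹) := by rw [← h2]; gcongr
    _ = (m + 1) * (((m : ℝ) + 1) ^ q * ((m : ℝ) + 1) ^ (-q)) * (ω ^ q * ω ^ (-q)) * R⁻¹ := by
        rw [h3]; ring
    _ = (m + 1) * ω * R ^ m / (R ^ (m + 1) * ω) := by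
        rw [h4, h5]; field_simp; ring
    _ ≤ _ := by gcongr

theorem quotient_sub_ge {Nu Nv S U V β ρ a b w l l' c : ℝ} (hβ : β < 0) (hρ : 0 ≤ ρ) (hU : 0 < U)
    (hV : 0 < V) (hb : 0 < b) (ha : 0 ≤ a) (hwb : w ≤ b) (hN : Nu ≤ Nv)
    (hUV : a * (b - w) ≤ V - U) (hl : l ≤ (Nu + β * S) / U) (hl' : l' = (Nv + β * S) / V)
    (hl1 : l' ≤ β * ρ / b) (hc : c ≤ ρ / b) :
    |β| * c * (a / V) * (b - w) ≤ l' - l := by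
  have hab : 0 ≤ a * (b - w) := mul_nonneg ha (by linarith)
  have hVU : U ≤ V := by linarith
  have hneg : l' ≤ 0 := hl1.trans (div_nonpos_of_nonpos_of_nonneg
    (mul_nonpos_of_nonpos_of_nonneg hβ.le hρ) hb.le)
  have e : l' * V = Nv + β * S := by rw [hl', div_mul_cancel₀ _ hV.ne']
  have h1 : l ≤ l' * V / U := hl.trans (by rw [e]; gcongr)
  have h2 : l' * V / U = l' + l' * ((V - U) / U) := by field_simp; ring
  have h3 : (V - U) / V ≤ (V - U) / U := by gcongr
  have h4 : a * (b - w) / V ≤ (V - U) / U := (by gcongr : _ ≤ (V - U) / V).trans h3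
  have h5 : |β| * c ≤ -l' := by
    rw [abs_of_neg hβ]
    have : -β * c ≤ -β * (ρ / b) := mul_le_mul_of_nonneg_left hc (by linarith)
    have e' : -β * (ρ / b) = -(β * ρ / b) := by ring
    linarith
  have h0 : 0 ≤ a * (b - w) / V := by positivity
  calc |β| * c * (a / V) * (b - w) = |β| * c * (a * (b - w) / V) := by ring
    _ ≤ -l' * (a * (b - w) / V) := by gcongr
    _ ≤ -l' * ((V - U) / U) := by gcongr; linarith
    _ ≤ _ := by linarith

theorem LipschitzOnWith.exists_radial_profile {E : Type*} [NormedAddCommGroup E] [NormedSpace ℝ E]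
    [Nontrivial E] {R : ℝ} (hR : 0 ≤ R) {K : ℝ≥0} {v : E → ℝ}
    (hv : LipschitzOnWith K v (closedBall 0 R)) {h : ℝ → ℝ}
    (hh : ∀ x ∈ closedBall (0 : E) R, v x = h ‖x‖) :
    ∃ g : ℝ → ℝ, LipschitzWith K g ∧ (∀ x ∈ closedBall (0 : E) R, v x = g ‖x‖) ∧
      ∀ s, ∃ x ∈ closedBall (0 : E) R, g s = v x := by
  obtain ⟨e, he⟩ := exists_norm_eq E zero_le_one
  have hmem : ∀ s : ℝ, (projIcc 0 R hR s : ℝ) • e ∈ closedBall (0 : E) R := fun s => by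
    rw [mem_closedBall_zero_iff, norm_smul, he, mul_one,
      Real.norm_of_nonneg (projIcc 0 R hR s).2.1]
    exact (projIcc 0 R hR s).2.2
  refine ⟨fun s => v ((projIcc 0 R hR s : ℝ) • e), ?_, fun x hx => ?_, fun s => ⟨_, hmem s, rfl⟩⟩
  · refine LipschitzWith.of_dist_le_mul fun a b =>
      (hv.dist_le_mul _ (hmem a) _ (hmem b)).trans ?_
    gcongr
    rw [dist_eq_norm, ← sub_smul, norm_smul, he, mul_one, ← dist_eq_norm]
    have := (LipschitzWith.projIcc hR).dist_le_mul a b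
    rwa [NNReal.coe_one, one_mul] at this
  · have hxR := mem_closedBall_zero_iff.1 hx
    have := hmem ‖x‖
    beta_reduce
    rw [projIcc_of_mem hR ⟨norm_nonneg x, hxR⟩] at this ⊢
    rw [hh x hx, hh _ this, norm_smul, he, mul_one, norm_norm]

theorem rayleigh_one {n : ℕ} {p : ℝ} (hp : 0 < p) (β : ℝ) (Ω : Set (EuclideanSpace ℝ (Fin n))) :
    rayleigh n p β Ω (fun _ => 1) = β * perim n Ω / volume.real Ω := by
  simp [rayleigh, perim, hp.ne', Real.zero_rpow, measureReal_def]

theorem robinEig_le {m : ℕ} {p β : ℝ} (hp : 1 < p) (hβ : β ≤ 0)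
    {Ω : Set (EuclideanSpace ℝ (Fin (m + 1)))} (ho : IsOpen Ω) (hb : IsBounded Ω)
    (hc : Convex ℝ Ω) (hne : Ω.Nonempty) {K : ℝ≥0} {u : EuclideanSpace ℝ (Fin (m + 1)) → ℝ}
    (hu : LipschitzOnWith K u (closure Ω)) (hpos : 0 < ∫ x in Ω, |u x| ^ p) :
    robinEig (m + 1) p β Ω ≤ rayleigh (m + 1) p β Ω u :=
  csInf_le (bddBelow_rayleigh hp hβ ho hb hc hne) ⟨u, ⟨K, hu⟩, hpos, rfl⟩

theorem robinEig_le_of_const {m : ℕ} {p β : ℝ} (hp : 1 < p) (hβ : β ≤ 0)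
    {Ω : Set (EuclideanSpace ℝ (Fin (m + 1)))} (ho : IsOpen Ω) (hb : IsBounded Ω)
    (hc : Convex ℝ Ω) (hne : Ω.Nonempty) :
    robinEig (m + 1) p β Ω ≤ β * perim (m + 1) Ω / volume.real Ω := by
  rw [← rayleigh_one (zero_lt_one.trans hp)]
  refine robinEig_le hp hβ ho hb hc hne (K := 0) (LipschitzWith.const 1).lipschitzOnWith ?_
  have : 0 < volume.real Ω :=
    ENNReal.toReal_pos (ho.measure_pos volume hne).ne' hb.measure_lt_top.ne
  simpa using this

theorem toReal_euclideanHausdorffMeasure_frontier {m : ℕ}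
    (Ω : Set (EuclideanSpace ℝ (Fin (m + 1)))) :
    (μHE[m] (frontier Ω)).toReal = hausdorffFactor m * perim (m + 1) Ω := by
  have e : ((m + 1 : ℕ) : ℝ) - 1 = m := by push_cast; ring
  rw [euclideanHausdorffMeasure_apply, ENNReal.toReal_mul, perim, e]
  rfl

theorem euclideanHausdorffMeasure_frontier_le_of_perim_eq {m : ℕ} {R : ℝ} (hR : 0 < R)
    {Ω : Set (EuclideanSpace ℝ (Fin (m + 1)))} (ho : IsOpen Ω) (hb : IsBounded Ω)
    (hc : Convex ℝ Ω) (hne : Ω.Nonempty)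
    (h : perim (m + 1) Ω = perim (m + 1) (ball 0 R)) :
    μHE[m] (frontier Ω) ≤ ENNReal.ofReal ((m + 1) *
      volume.real (closedBall (0 : EuclideanSpace ℝ (Fin (m + 1))) 1) * R ^ m) := by
  have hn : Module.finrank ℝ (EuclideanSpace ℝ (Fin (m + 1))) = m + 1 := by simp
  have h1 := euclideanHausdorffMeasure_sphere_le hn hR
  rw [← ENNReal.ofReal_toReal (euclideanHausdorffMeasure_frontier_lt_top hn ho hb hc hne).ne,
    toReal_euclideanHausdorffMeasure_frontier, h, ← toReal_euclideanHausdorffMeasure_frontier,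
    frontier_ball _ hR.ne', ENNReal.ofReal_toReal (h1.trans_lt ENNReal.ofReal_lt_top).ne]
  exact h1

theorem le_perim_ball {m : ℕ} (hm : m ≠ 0) {R : ℝ} (hR : 0 < R) :
    (m + 1) * volume.real (closedBall (0 : EuclideanSpace ℝ (Fin (m + 1))) 1) * R ^ m ≤
      perim (m + 1) (ball 0 R) := by
  have h1 := le_euclideanHausdorffMeasure_sphere hm
    (by simp : Module.finrank ℝ (EuclideanSpace ℝ (Fin (m + 1))) = m + 1) hR
  rw [← frontier_ball _ hR.ne', toReal_euclideanHausdorffMeasure_frontier] at h1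
  refine h1.trans (mul_le_of_le_one_left ENNReal.toReal_nonneg ?_)
  exact_mod_cast hausdorffFactor_le_one m

/-- Inequality (3.4) in the proof of Theorem 3: lower bound with explicit constant. -/
theorem stmt5 {n : ℕ} (hn : 2 ≤ n) (p β ρ : ℝ) (hp1 : 1 < p) (hβ : β < 0)
    (Ω : Set (EuclideanSpace ℝ (Fin n))) (hΩo : IsOpen Ω) (hΩb : IsBounded Ω)
    (hΩc : Convex ℝ Ω) (hΩne : Ω.Nonempty) (hΩρ : perim n Ω = ρ)
    (R : ℝ) (hR : 0 < R)
    (Ωstar : Set (EuclideanSpace ℝ (Fin n)))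
    (hstar : Ωstar = ball (0 : EuclideanSpace ℝ (Fin n)) R)
    (hper : perim n Ωstar = ρ)
    (v : EuclideanSpace ℝ (Fin n) → ℝ) (hv : IsFirstEigenfunction n p β Ωstar v)
    (vm : ℝ) (hvm : vm = sInf (v '' closure Ωstar)) :
    robinEig n p β Ωstar - robinEig n p β Ω ≥
      |β| * (n : ℝ) ^ ((n : ℝ) / ((n : ℝ) - 1)) * (unitBallVol n) ^ (1 / ((n : ℝ) - 1)) *
        ρ ^ (-(1 / ((n : ℝ) - 1))) * (vm ^ p / ∫ x in Ωstar, |v x| ^ p) *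
        ((volume Ωstar).toReal - (volume Ω).toReal) := by
  obtain ⟨m, rfl⟩ : ∃ m, n = m + 1 := ⟨n - 1, by omega⟩
  have hm : m ≠ 0 := by omega
  subst hstar hvm
  have hfr : Module.finrank ℝ (EuclideanSpace ℝ (Fin (m + 1))) = m + 1 := by simp
  have hcl : closure (ball (0 : EuclideanSpace ℝ (Fin (m + 1))) R) = closedBall 0 R := closure_ball _ hR.ne'
  have hfrt : frontier (ball (0 : EuclideanSpace ℝ (Fin (m + 1))) R) = sphere 0 R := frontier_ball _ hR.ne'
  obtain ⟨⟨K, hvK⟩, hv0, ⟨h, hh⟩, hVpos, hveq⟩ := hv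
  rw [hcl] at hvK hv0 hh ⊢
  obtain ⟨g, hgK, hg, hgv⟩ := hvK.exists_radial_profile hR.le hh
  have hcomp : IsCompact (closedBall (0 : EuclideanSpace ℝ (Fin (m + 1))) R) := isCompact_closedBall 0 R
  have himg : IsCompact (v '' closedBall 0 R) := hcomp.image_of_continuousOn hvK.continuousOn
  set vm := sInf (v '' closedBall 0 R)
  have hvm0 : 0 < vm := by
    obtain ⟨x, hx, hxe⟩ := himg.sInf_mem ⟨_, mem_image_of_mem v (mem_closedBall_self hR.le)⟩
    exact (hv0 x hx).trans_eq hxe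
  have hag : ∀ s, vm ≤ g s := fun s => by
    obtain ⟨x, hx, hxe⟩ := hgv s
    rw [hxe]
    exact csInf_le himg.bddBelow (mem_image_of_mem v hx)
  obtain ⟨C, hC⟩ := himg.bddAbove
  have hgC : ∀ s, g s ≤ C := fun s => by
    obtain ⟨x, hx, hxe⟩ := hgv s
    rw [hxe]
    exact hC (mem_image_of_mem v hx)
  have hS := euclideanHausdorffMeasure_frontier_le_of_perim_eq hR hΩo hΩb hΩc hΩne
    (hΩρ.trans hper.symm)
  have hρ := le_perim_ball hm hR
  have hgb : ∀ x ∈ ball (0 : EuclideanSpace ℝ (Fin (m + 1))) R, v x = g ‖x‖ := fun x hx => hg x (ball_subset_closedBall hx)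
  have hp0 : 0 ≤ p := by linarith
  have hN := integral_fderiv_le hm hfr hΩo hΩb hΩc hR hS hgK hp0 hgb
  have hVU := integral_rpow_sub_ge hm hfr hΩo hΩb hΩc hR hS hgK.continuous.measurable hp0 hvm0.le
    hag hgC hgb
  have hvol := volume_le_volume_ball hm hfr hΩo hΩb hΩc hR hS
  set u : EuclideanSpace ℝ (Fin (m + 1)) → ℝ := fun y => g (R - infDist y Ωᶜ)
  have huL : LipschitzWith (K * 1) u := hgK.comp (LipschitzWith.of_dist_le_mul fun x y => by
    rw [dist_sub_left]
    exact (lipschitz_infDist_pt Ωᶜ).dist_le_mul x y)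
  have huc : ContinuousOn u (closure Ω) := huL.continuous.continuousOn
  have hΩpos : 0 < volume.real Ω :=
    ENNReal.toReal_pos (hΩo.measure_pos volume hΩne).ne' hΩb.measure_lt_top.ne
  have hUpos : 0 < ∫ x in Ω, |u x| ^ p := by
    have h1 : ∫ _ in Ω, vm ^ p ≤ ∫ x in Ω, |u x| ^ p := by
      refine setIntegral_mono_on (integrableOn_const hΩb.measure_lt_top.ne)
        (integrableOn_abs_rpow hΩb huc hp0) hΩo.measurableSet fun x _ => ?_
      exact Real.rpow_le_rpow hvm0.le ((hag _).trans (le_abs_self _)) hp0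
    refine lt_of_lt_of_le ?_ h1
    rw [setIntegral_const, smul_eq_mul]
    positivity
  have hl := robinEig_le hp1 hβ.le hΩo hΩb hΩc hΩne huL.lipschitzOnWith hUpos
  have hl1 := robinEig_le_of_const hp1 hβ.le (isOpen_ball : IsOpen (ball (0 : EuclideanSpace ℝ (Fin (m + 1))) R)) isBounded_ball
    (convex_ball 0 R) ⟨0, mem_ball_self hR⟩
  rw [hper] at hl1 hρ
  have hbu : ∫ x in frontier Ω, |u x| ^ p ∂(μH[((m + 1 : ℕ) : ℝ) - 1]) = ρ * |g R| ^ p := by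
    rw [setIntegral_congr_fun (g := fun _ => |g R| ^ p) isClosed_frontier.measurableSet,
      setIntegral_const, smul_eq_mul, ← hΩρ]
    · rfl
    · intro x hx
      have : infDist x Ωᶜ = 0 := by
        rw [← mem_closure_iff_infDist_zero (nonempty_compl_of_isBounded hΩb)]
        exact frontier_subset_closure (frontier_compl Ω ▸ hx)
      simp [u, this]
  have hbv : ∫ x in frontier (ball (0 : EuclideanSpace ℝ (Fin (m + 1))) R), |v x| ^ p ∂(μH[((m + 1 : ℕ) : ℝ) - 1]) =
      ρ * |g R| ^ p := by
    rw [setIntegral_congr_fun (g := fun _ => |g R| ^ p) isClosed_frontier.measurableSet,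
      setIntegral_const, smul_eq_mul, ← hper]
    · rfl
    · intro x hx
      rw [hfrt] at hx
      simp [hg x (sphere_subset_closedBall hx), mem_sphere_zero_iff_norm.1 hx]
  rw [rayleigh, hbu] at hl
  have hl' := hveq.symm
  rw [rayleigh, hbv] at hl'
  have hω : unitBallVol (m + 1) = volume.real (closedBall (0 : EuclideanSpace ℝ (Fin (m + 1))) 1) := by
    rw [measureReal_def, Measure.addHaar_closedBall_eq_addHaar_ball]
    rfl
  have hω0 : 0 < volume.real (closedBall (0 : EuclideanSpace ℝ (Fin (m + 1))) 1) :=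
    ENNReal.toReal_pos (measure_closedBall_pos volume 0 one_pos).ne' measure_closedBall_lt_top.ne
  have hb : volume.real (ball (0 : EuclideanSpace ℝ (Fin (m + 1))) R) = R ^ (m + 1) * volume.real (closedBall (0 : EuclideanSpace ℝ (Fin (m + 1))) 1) := by
    rw [← volume_real_ball hfr hR.le, measureReal_def, measureReal_def,
      Measure.addHaar_closedBall_eq_addHaar_ball]
  have hc := isoperimetric_const_le hm hω0 hR hρ
  rw [← hb] at hc
  have key := quotient_sub_ge hβ (le_trans (by positivity) hρ) hUpos hVpos
    (by rw [hb]; positivity) (Real.rpow_nonneg hvm0.le p) hvol hN hVU hl hl' hl1 hc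
  rw [hω]
  have e : ((m + 1 : ℕ) : ℝ) - 1 = m := by push_cast; ring
  rw [e]
  push_cast
  refine ge_iff_le.2 (le_trans (le_of_eq ?_) key)
  simp only [measureReal_def]
  ring
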